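/- Let (A, X, B) be a Keller admissible triple over a field k of characteristic zero. Then the two natural projections π_A: Hoch_⊕^•(X) ↠ Hoch_⊕^•(A) and π_B: Hoch_⊕^•(X) ↠ Hoch_⊕^•(B) are quasi-isomorphisms and induce isomorphisms of Gerstenhaber algebras HH_⊕^•(A) ≅ H^•(Hoch_⊕(X)) ≅ HH_⊕^•(B) between the sum Hochschild cohomologies. -/

import Mathlib

set_option maxHeartbeats 1000000
set_option synthInstance.maxHeartbeats 400000
set_option linter.unusedVariables false

noncomputable section

namespace KD

open scoped BigOperators TensorProduct

variable (k : Type) [Field k]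

def ε (n : ℤ) : k := if Even n then 1 else -1

def ext0 {X : Type} [Zero X] {n : ℕ} (a : Fin n → X) (m : ℕ) : X :=
  if h : m < n then a ⟨m, h⟩ else 0

def compAtF {X : Type} [Zero X] (p₁ p₂ : ℤ)
    (f : (Fin p₁.toNat → X) → X) (g : (Fin p₂.toNat → X) → X)
    (i : ℕ) (a : Fin (p₁ + p₂ - 1).toNat → X) : X :=
  f (fun j => if (j : ℕ) < i then ext0 a (j : ℕ)
      else if (j : ℕ) = i then g (fun l => ext0 a (i + (l : ℕ)))
      else ext0 a ((j : ℕ) + p₂.toNat - 1))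

structure DGAlgebra (A : Type) [Ring A] [Algebra k A] : Type where
  gr : ℤ → Submodule k A
  one_mem : (1 : A) ∈ gr 0
  mul_mem : ∀ {i j : ℤ} {a b : A}, a ∈ gr i → b ∈ gr j → a * b ∈ gr (i + j)
  isInternal : DirectSum.IsInternal gr
  d : A →ₗ[k] A
  d_sq : ∀ a, d (d a) = 0
  d_mem : ∀ {i : ℤ} {a : A}, a ∈ gr i → d a ∈ gr (i + 1)
  d_leibniz : ∀ {i : ℤ} (a b : A), a ∈ gr i → d (a * b) = d a * b + ε k i • (a * d b)

variable {A : Type} [Ring A] [Algebra k A]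

abbrev Coch (A : Type) [Ring A] [Algebra k A] (p : ℤ) : Type :=
  MultilinearMap k (fun _ : Fin p.toNat => A) A

def cochCast {p q : ℤ} (h : p = q) (f : Coch k A p) : Coch k A q :=
  f.domDomCongr (finCongr (congrArg Int.toNat h))

def IsHomog (R : DGAlgebra k A) (p r : ℤ) (f : Coch k A p) : Prop :=
  ∀ (dg : ℕ → ℤ) (a : ℕ → A), (∀ i, a i ∈ R.gr (dg i)) →
    f (fun i => a (i : ℕ)) ∈ R.gr ((∑ i : Fin p.toNat, dg (i : ℕ)) + r)

/-- The family `dH` is the Hochschild differential of `(A, d_A)`. -/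
def IsHochDiff (R : DGAlgebra k A)
    (dH : ∀ p r : ℤ, Coch k A p →ₗ[k] Coch k A (p + 1)) : Prop :=
  ∀ (p : ℤ), 0 ≤ p → ∀ (r : ℤ) (f : Coch k A p) (dg : ℕ → ℤ) (a : ℕ → A),
    (∀ i, a i ∈ R.gr (dg i)) →
    dH p r f (fun i => a (i : ℕ)) =
      ε k (p + r - 1 + r * dg 0) • (a 0 * f (fun i => a ((i : ℕ) + 1)))
      + ∑ i : Fin p.toNat, ε k (p + r + (i : ℕ)) •
          f (fun j => if (j : ℕ) < (i : ℕ) then a (j : ℕ)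
              else if (j : ℕ) = (i : ℕ) then a (i : ℕ) * a ((i : ℕ) + 1)
              else a ((j : ℕ) + 1))
      + ε k r • (f (fun i => a (i : ℕ)) * a p.toNat)

/-- The family `pd` is the internal differential `∂` induced by `d_A`. -/
def IsIntDiff (R : DGAlgebra k A)
    (pd : ∀ p r : ℤ, Coch k A p →ₗ[k] Coch k A p) : Prop :=
  ∀ (p : ℤ), 0 ≤ p → ∀ (r : ℤ) (f : Coch k A p) (dg : ℕ → ℤ) (a : ℕ → A),
    (∀ i, a i ∈ R.gr (dg i)) →
    pd p r f (fun i => a (i : ℕ)) =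
      R.d (f (fun i => a (i : ℕ)))
      - ε k r • ∑ i : Fin p.toNat,
          ε k (∑ j ∈ Finset.range (i : ℕ), dg j) •
            f (fun j => if (j : ℕ) = (i : ℕ) then R.d (a (i : ℕ)) else a (j : ℕ))

/-- The family `cup` is the cup product of Hochschild cochains. -/
def IsCup (R : DGAlgebra k A)
    (cup : ∀ p₁ r₁ p₂ r₂ : ℤ, Coch k A p₁ →ₗ[k] Coch k A p₂ →ₗ[k] Coch k A (p₁ + p₂)) : Prop :=
  ∀ (p₁ : ℤ), 0 ≤ p₁ → ∀ (p₂ : ℤ), 0 ≤ p₂ → ∀ (r₁ r₂ : ℤ)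
    (f : Coch k A p₁) (g : Coch k A p₂) (dg : ℕ → ℤ) (a : ℕ → A),
    (∀ i, a i ∈ R.gr (dg i)) →
    cup p₁ r₁ p₂ r₂ f g (fun i => a (i : ℕ)) =
      ε k (p₁ * p₂ + r₂ * ((∑ j ∈ Finset.range p₁.toNat, dg j) + p₁)) •
        (f (fun i => a (i : ℕ)) * g (fun j => a (p₁.toNat + (j : ℕ))))

/-- The family `br` is the Gerstenhaber bracket of Hochschild cochains. -/
def IsBracket
    (br : ∀ p₁ r₁ p₂ r₂ : ℤ, Coch k A p₁ →ₗ[k] Coch k A p₂ →ₗ[k] Coch k A (p₁ + p₂ - 1)) : Prop :=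
  ∀ (p₁ r₁ p₂ r₂ : ℤ) (f : Coch k A p₁) (g : Coch k A p₂)
    (a : Fin (p₁ + p₂ - 1).toNat → A),
    br p₁ r₁ p₂ r₂ f g a =
      (∑ i : Fin p₁.toNat,
        ε k ((p₁ - 1) * r₂ + (i : ℕ) * (p₂ - 1)) • compAtF p₁ p₂ ⇑f ⇑g (i : ℕ) a)
      - ε k ((p₁ + r₁ - 1) * (p₂ + r₂ - 1)) •
        ∑ j : Fin p₂.toNat,
          ε k ((p₂ - 1) * r₁ + (j : ℕ) * (p₁ - 1)) •
            compAtF p₂ p₁ ⇑g ⇑f (j : ℕ) (fun m => a (Fin.cast (by omega) m))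

/- Total (sum) Hochschild complex -/

abbrev TotCoch (A : Type) [Ring A] [Algebra k A] : Type := ∀ p : ℕ, Coch k A (p : ℤ)

def TotHomog (R : DGAlgebra k A) (n : ℤ) (c : TotCoch k A) : Prop :=
  ∀ p : ℕ, IsHomog k R p (n - p) (c p)

def TotFinSupp (c : TotCoch k A) : Prop := ∃ N : ℕ, ∀ p ≥ N, c p = 0

/-- The total differential `d_H + ∂` on the sum Hochschild complex,
applied to a total cochain of total degree `n`. -/
def TotD (dH : ∀ p r : ℤ, Coch k A p →ₗ[k] Coch k A (p + 1))
    (pd : ∀ p r : ℤ, Coch k A p →ₗ[k] Coch k A p)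
    (n : ℤ) (c : TotCoch k A) : TotCoch k A :=
  fun p => match p with
  | 0 => pd 0 n (c 0)
  | (q+1) => pd ((q : ℤ) + 1) (n - ((q : ℤ) + 1)) (c (q + 1)) + dH (q : ℤ) (n - q) (c q)

def TotIsCocycle (dH : ∀ p r : ℤ, Coch k A p →ₗ[k] Coch k A (p + 1))
    (pd : ∀ p r : ℤ, Coch k A p →ₗ[k] Coch k A p)
    (n : ℤ) (c : TotCoch k A) : Prop :=
  ∀ p : ℕ, TotD k dH pd n c p = 0

def TotIsCoboundary (R : DGAlgebra k A)
    (dH : ∀ p r : ℤ, Coch k A p →ₗ[k] Coch k A (p + 1))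
    (pd : ∀ p r : ℤ, Coch k A p →ₗ[k] Coch k A p)
    (n : ℤ) (c : TotCoch k A) : Prop :=
  ∃ b : TotCoch k A, TotHomog k R (n - 1) b ∧ TotFinSupp k b ∧
    ∀ p : ℕ, c p = TotD k dH pd (n - 1) b p

/-- Total cup product of total cochains of total degrees `n₁`, `n₂`. -/
def totCup (cup : ∀ p₁ r₁ p₂ r₂ : ℤ, Coch k A p₁ →ₗ[k] Coch k A p₂ →ₗ[k] Coch k A (p₁ + p₂))
    (n₁ n₂ : ℤ) (c c' : TotCoch k A) : TotCoch k A :=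
  fun p => ∑ x ∈ (Finset.range (p + 1)).attach,
    cochCast k (by have := Finset.mem_range.mp x.2; omega)
      (cup (x.1 : ℤ) (n₁ - x.1) ((p - x.1 : ℕ) : ℤ) (n₂ - ((p - x.1 : ℕ) : ℤ))
        (c x.1) (c' (p - x.1)))

/-- Total Gerstenhaber bracket of total cochains of total degrees `n₁`, `n₂`. -/
def totBr (br : ∀ p₁ r₁ p₂ r₂ : ℤ, Coch k A p₁ →ₗ[k] Coch k A p₂ →ₗ[k] Coch k A (p₁ + p₂ - 1))
    (n₁ n₂ : ℤ) (c c' : TotCoch k A) : TotCoch k A :=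
  fun p => ∑ x ∈ (Finset.range (p + 2)).attach,
    cochCast k (by have := Finset.mem_range.mp x.2; omega)
      (br (x.1 : ℤ) (n₁ - x.1) ((p + 1 - x.1 : ℕ) : ℤ) (n₂ - ((p + 1 - x.1 : ℕ) : ℤ))
        (c x.1) (c' (p + 1 - x.1)))

/- ## Differential graded bimodules and Hochschild cochains with coefficients -/

variable {M : Type} [AddCommGroup M] [Module k M]

/-- A dg `A`-`A`-bimodule structure on `M` over a dg algebra `(A, R)`. -/
structure DGBimod (R : DGAlgebra k A) (M : Type) [AddCommGroup M] [Module k M] : Type where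
  gr : ℤ → Submodule k M
  isInternal : DirectSum.IsInternal gr
  actL : A →ₗ[k] M →ₗ[k] M
  actR : A →ₗ[k] M →ₗ[k] M
  actL_one : ∀ m, actL 1 m = m
  actL_mul : ∀ a b m, actL (a * b) m = actL a (actL b m)
  actR_one : ∀ m, actR 1 m = m
  actR_mul : ∀ a b m, actR (a * b) m = actR b (actR a m)
  actLR : ∀ a b m, actR b (actL a m) = actL a (actR b m)
  actL_mem : ∀ {i j : ℤ} {a : A} {m : M}, a ∈ R.gr i → m ∈ gr j → actL a m ∈ gr (i + j)
  actR_mem : ∀ {i j : ℤ} {a : A} {m : M}, a ∈ R.gr i → m ∈ gr j → actR a m ∈ gr (j + i)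
  dM : M →ₗ[k] M
  dM_sq : ∀ m, dM (dM m) = 0
  dM_mem : ∀ {j : ℤ} {m : M}, m ∈ gr j → dM m ∈ gr (j + 1)
  dM_actL : ∀ {i : ℤ} (a : A) (m : M), a ∈ R.gr i →
    dM (actL a m) = actL (R.d a) m + ε k i • actL a (dM m)
  dM_actR : ∀ {j : ℤ} (a : A) (m : M), m ∈ gr j →
    dM (actR a m) = actR a (dM m) + ε k j • actR (R.d a) m

/-- A dg algebra is a dg bimodule over itself. -/
def DGAlgebra.toBimod (R : DGAlgebra k A) : DGBimod k R A where
  gr := R.gr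
  isInternal := R.isInternal
  actL := LinearMap.mul k A
  actR := (LinearMap.mul k A).flip
  actL_one := fun m => one_mul m
  actL_mul := fun a b m => mul_assoc a b m
  actR_one := fun m => mul_one m
  actR_mul := fun a b m => (mul_assoc m a b).symm
  actLR := fun a b m => mul_assoc a m b
  actL_mem := fun ha hm => R.mul_mem ha hm
  actR_mem := fun ha hm => R.mul_mem hm ha
  dM := R.d
  dM_sq := R.d_sq
  dM_mem := R.d_mem
  dM_actL := fun a m ha => R.d_leibniz a m ha
  dM_actR := fun a m hm => R.d_leibniz m a hm

/-- Hochschild `p`-cochains of `A` with values in `M`. -/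
abbrev MCoch (A M : Type) [Ring A] [Algebra k A] [AddCommGroup M] [Module k M]
    (p : ℕ) : Type :=
  MultilinearMap k (fun _ : Fin p => A) M

variable {R : DGAlgebra k A}

/-- `f` is an `M`-valued Hochschild cochain of bidegree `(p, r)`. -/
def IsHomogM (St : DGBimod k R M) (p : ℕ) (r : ℤ) (f : MCoch k A M p) : Prop :=
  ∀ (dg : ℕ → ℤ) (a : ℕ → A), (∀ i, a i ∈ R.gr (dg i)) →
    f (fun i => a (i : ℕ)) ∈ St.gr ((∑ i : Fin p, dg (i : ℕ)) + r)

/-- The family `dHM` is the Hochschild differential with values in the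
dg bimodule `M`. -/
def IsHochDiffM (St : DGBimod k R M)
    (dHM : ∀ (p : ℕ) (r : ℤ), MCoch k A M p →ₗ[k] MCoch k A M (p + 1)) : Prop :=
  ∀ (p : ℕ) (r : ℤ) (f : MCoch k A M p) (dg : ℕ → ℤ) (a : ℕ → A),
    (∀ i, a i ∈ R.gr (dg i)) →
    dHM p r f (fun i => a (i : ℕ)) =
      ε k ((p : ℤ) + r - 1 + r * dg 0) • St.actL (a 0) (f (fun i => a ((i : ℕ) + 1)))
      + ∑ i : Fin p, ε k ((p : ℤ) + r + (i : ℕ)) •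
          f (fun j => if (j : ℕ) < (i : ℕ) then a (j : ℕ)
              else if (j : ℕ) = (i : ℕ) then a (i : ℕ) * a ((i : ℕ) + 1)
              else a ((j : ℕ) + 1))
      + ε k r • St.actR (a p) (f (fun i => a (i : ℕ)))

/-- The family `pdM` is the internal differential `∂` induced by `d_A` and `d_M`. -/
def IsIntDiffM (St : DGBimod k R M)
    (pdM : ∀ (p : ℕ) (r : ℤ), MCoch k A M p →ₗ[k] MCoch k A M p) : Prop :=
  ∀ (p : ℕ) (r : ℤ) (f : MCoch k A M p) (dg : ℕ → ℤ) (a : ℕ → A),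
    (∀ i, a i ∈ R.gr (dg i)) →
    pdM p r f (fun i => a (i : ℕ)) =
      St.dM (f (fun i => a (i : ℕ)))
      - ε k r • ∑ i : Fin p,
          ε k (∑ j ∈ Finset.range (i : ℕ), dg j) •
            f (fun j => if (j : ℕ) = (i : ℕ) then R.d (a (i : ℕ)) else a (j : ℕ))

/-- Recasting an `M`-valued cochain along an equality of arities. -/
def mcochCast {p q : ℕ} (h : p = q) (f : MCoch k A M p) : MCoch k A M q :=
  f.domDomCongr (finCongr h)

/-- Post-composition `H = h∘(−)` on `M`-valued cochains. -/
def Hop (h : M →ₗ[k] M) {p : ℕ} (f : MCoch k A M p) : MCoch k A M p :=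
  h.compMultilinearMap f

/-- The operators `𝔥_j = (H ∘ d_H)^j ∘ H` applied to cochains of bidegree `(p,r)`. -/
def frakh (dHM : ∀ (p : ℕ) (r : ℤ), MCoch k A M p →ₗ[k] MCoch k A M (p + 1))
    (h : M →ₗ[k] M) (p : ℕ) (r : ℤ) : (j : ℕ) → MCoch k A M p → MCoch k A M (p + j)
  | 0, f => Hop k h f
  | (j + 1), f => Hop k h (dHM (p + j) (r - j - 1) (frakh dHM h p r j f))

/-- `h` is a contracting homotopy for the dg bimodule `M` (a degree `-1` map
with `d_M ∘ h + h ∘ d_M = id`). -/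
def IsContracting (St : DGBimod k R M) (h : M →ₗ[k] M) : Prop :=
  (∀ m, St.dM (h m) + h (St.dM m) = m) ∧
  ∀ {j : ℤ} {m : M}, m ∈ St.gr j → h m ∈ St.gr (j - 1)

/-- The acyclic dg bimodule `M` is pointwisely nilpotent: some contracting
homotopy `h` satisfies that for every Hochschild cochain `f` with values in `M`
there is `N` with `𝔥_j f = 0` for all `j > N`. -/
def PointwiseNilpotent (St : DGBimod k R M)
    (dHM : ∀ (p : ℕ) (r : ℤ), MCoch k A M p →ₗ[k] MCoch k A M (p + 1)) : Prop :=
  ∃ h : M →ₗ[k] M, IsContracting k St h ∧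
    ∀ (p : ℕ) (r : ℤ) (f : MCoch k A M p), IsHomogM k St p r f →
      ∃ N : ℕ, ∀ j : ℕ, j > N → frakh k dHM h p r j f = 0

/- Total complex with values in `M` -/

abbrev TotMCoch (A M : Type) [Ring A] [Algebra k A] [AddCommGroup M] [Module k M] : Type :=
  ∀ p : ℕ, MCoch k A M p

def TotHomogM (St : DGBimod k R M) (n : ℤ) (c : TotMCoch k A M) : Prop :=
  ∀ p : ℕ, IsHomogM k St p (n - p) (c p)

def TotFinSuppM (c : TotMCoch k A M) : Prop := ∃ N : ℕ, ∀ p ≥ N, c p = 0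

def TotDM (dHM : ∀ (p : ℕ) (r : ℤ), MCoch k A M p →ₗ[k] MCoch k A M (p + 1))
    (pdM : ∀ (p : ℕ) (r : ℤ), MCoch k A M p →ₗ[k] MCoch k A M p)
    (n : ℤ) (c : TotMCoch k A M) : TotMCoch k A M :=
  fun p => match p with
  | 0 => pdM 0 n (c 0)
  | (q + 1) => pdM (q + 1) (n - ((q : ℤ) + 1)) (c (q + 1)) + dHM q (n - q) (c q)

def TotIsCocycleM (dHM : ∀ (p : ℕ) (r : ℤ), MCoch k A M p →ₗ[k] MCoch k A M (p + 1))
    (pdM : ∀ (p : ℕ) (r : ℤ), MCoch k A M p →ₗ[k] MCoch k A M p)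
    (n : ℤ) (c : TotMCoch k A M) : Prop :=
  ∀ p : ℕ, TotDM k dHM pdM n c p = 0

def TotIsCoboundaryM (St : DGBimod k R M)
    (dHM : ∀ (p : ℕ) (r : ℤ), MCoch k A M p →ₗ[k] MCoch k A M (p + 1))
    (pdM : ∀ (p : ℕ) (r : ℤ), MCoch k A M p →ₗ[k] MCoch k A M p)
    (n : ℤ) (c : TotMCoch k A M) : Prop :=
  ∃ b : TotMCoch k A M, TotHomogM k St (n - 1) b ∧ TotFinSuppM k b ∧
    ∀ p : ℕ, c p = TotDM k dHM pdM (n - 1) b p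

/- Morphisms of dg bimodules, quasi-isomorphisms, mapping cones -/

variable {N : Type} [AddCommGroup N] [Module k N]

/-- Morphism of dg `A`-`A`-bimodules (degree-preserving, chain map, bilinear). -/
def IsBimodHom (StM : DGBimod k R M) (StN : DGBimod k R N) (φ : M →ₗ[k] N) : Prop :=
  (∀ (i : ℤ) (m : M), m ∈ StM.gr i → φ m ∈ StN.gr i)
  ∧ (∀ m, φ (StM.dM m) = StN.dM (φ m))
  ∧ (∀ a m, φ (StM.actL a m) = StN.actL a (φ m))
  ∧ (∀ a m, φ (StM.actR a m) = StN.actR a (φ m))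

/-- `φ` is a quasi-isomorphism of dg bimodules (bijective on cohomology). -/
def IsQuasiIso (StM : DGBimod k R M) (StN : DGBimod k R N) (φ : M →ₗ[k] N) : Prop :=
  (∀ (i : ℤ) (n : N), n ∈ StN.gr i → StN.dM n = 0 →
    ∃ m ∈ StM.gr i, StM.dM m = 0 ∧ ∃ n' ∈ StN.gr (i - 1), φ m - n = StN.dM n')
  ∧ (∀ (i : ℤ) (m : M), m ∈ StM.gr i → StM.dM m = 0 →
    (∃ n' ∈ StN.gr (i - 1), φ m = StN.dM n') →
    ∃ m' ∈ StM.gr (i - 1), m = StM.dM m')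

/-- `(C, SC, inM, inN)` is a model for the mapping cone `Cone(φ) = M[1] ⊕ N`
as a dg `A`-`A`-bimodule. -/
def IsConeModel (StM : DGBimod k R M) (StN : DGBimod k R N) (φ : M →ₗ[k] N)
    {C : Type} [AddCommGroup C] [Module k C] (SC : DGBimod k R C)
    (inM : M →ₗ[k] C) (inN : N →ₗ[k] C) : Prop :=
  Function.Bijective (fun mn : M × N => inM mn.1 + inN mn.2)
  ∧ (∀ m, SC.dM (inM m) = - inM (StM.dM m) + inN (φ m))
  ∧ (∀ n, SC.dM (inN n) = inN (StN.dM n))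
  ∧ (∀ (i : ℤ) (m : M), m ∈ StM.gr (i + 1) → inM m ∈ SC.gr i)
  ∧ (∀ (i : ℤ) (n : N), n ∈ StN.gr i → inN n ∈ SC.gr i)
  ∧ (∀ (i : ℤ) (c : C), c ∈ SC.gr i → ∃ m ∈ StM.gr (i + 1), ∃ n ∈ StN.gr i,
      c = inM m + inN n)
  ∧ (∀ (i : ℤ) (a : A) (m : M), a ∈ R.gr i →
      SC.actL a (inM m) = ε k i • inM (StM.actL a m))
  ∧ (∀ (a : A) (n : N), SC.actL a (inN n) = inN (StN.actL a n))
  ∧ (∀ (a : A) (m : M), SC.actR a (inM m) = inM (StM.actR a m))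
  ∧ (∀ (a : A) (n : N), SC.actR a (inN n) = inN (StN.actR a n))

/-- A bundled model of the mapping cone of `φ`. -/
structure ConeData (StM : DGBimod k R M) (StN : DGBimod k R N) (φ : M →ₗ[k] N) where
  C : Type
  [instAdd : AddCommGroup C]
  [instMod : Module k C]
  SC : DGBimod k R C
  inM : M →ₗ[k] C
  inN : N →ₗ[k] C
  isCone : IsConeModel k StM StN φ SC inM inN

attribute [instance] ConeData.instAdd ConeData.instMod

/-- The mapping cone of `φ` is pointwisely nilpotent. -/
def ConePN (StM : DGBimod k R M) (StN : DGBimod k R N) (φ : M →ₗ[k] N) : Prop :=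
  ∃ D : ConeData k StM StN φ,
    ∃ dHC : ∀ (p : ℕ) (r : ℤ), MCoch k A D.C p →ₗ[k] MCoch k A D.C (p + 1),
      IsHochDiffM k D.SC dHC ∧ PointwiseNilpotent k D.SC dHC

/-- `φ` is weakly cone-nilpotent: its mapping cone is pointwisely nilpotent, or
it admits a right (resp. left) inverse morphism of dg bimodules whose mapping
cone is pointwisely nilpotent. -/
def WeaklyConeNilpotent (StM : DGBimod k R M) (StN : DGBimod k R N) (φ : M →ₗ[k] N) : Prop :=
  ConePN k StM StN φ
  ∨ (∃ ψ : N →ₗ[k] M, IsBimodHom k StN StM ψ ∧ (∀ n, φ (ψ n) = n) ∧ ConePN k StN StM ψ)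
  ∨ (∃ ψ : N →ₗ[k] M, IsBimodHom k StN StM ψ ∧ (∀ m, ψ (φ m) = m) ∧ ConePN k StN StM ψ)
/- ## Pairs of dg algebras and dg `A`-`B`-bimodules -/

variable {B : Type} [Ring B] [Algebra k B]
variable {X : Type} [AddCommGroup X] [Module k X]

/-- A dg `A`-`B`-bimodule structure on `X`. -/
structure ABBimod (RA : DGAlgebra k A) (RB : DGAlgebra k B)
    (X : Type) [AddCommGroup X] [Module k X] : Type where
  gr : ℤ → Submodule k X
  isInternal : DirectSum.IsInternal gr
  actL : A →ₗ[k] X →ₗ[k] X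
  actR : B →ₗ[k] X →ₗ[k] X
  actL_one : ∀ x, actL 1 x = x
  actL_mul : ∀ a a' x, actL (a * a') x = actL a (actL a' x)
  actR_one : ∀ x, actR 1 x = x
  actR_mul : ∀ b b' x, actR (b * b') x = actR b' (actR b x)
  actLR : ∀ a b x, actR b (actL a x) = actL a (actR b x)
  actL_mem : ∀ {i j : ℤ} {a : A} {x : X}, a ∈ RA.gr i → x ∈ gr j → actL a x ∈ gr (i + j)
  actR_mem : ∀ {i j : ℤ} {b : B} {x : X}, b ∈ RB.gr i → x ∈ gr j → actR b x ∈ gr (j + i)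
  dX : X →ₗ[k] X
  dX_sq : ∀ x, dX (dX x) = 0
  dX_mem : ∀ {j : ℤ} {x : X}, x ∈ gr j → dX x ∈ gr (j + 1)
  dX_actL : ∀ {i : ℤ} (a : A) (x : X), a ∈ RA.gr i →
    dX (actL a x) = actL (RA.d a) x + ε k i • actL a (dX x)
  dX_actR : ∀ {j : ℤ} (b : B) (x : X), x ∈ gr j →
    dX (actR b x) = actR b (dX x) + ε k j • actR (RB.d b) x

/-- Hochschild cochains of type `Hom(A^{⊗p} ⊗ X ⊗ B^{⊗q}, X)`, in curried form. -/
abbrev XCoch (A B X : Type) [Ring A] [Algebra k A] [Ring B] [Algebra k B]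
    [AddCommGroup X] [Module k X] (p q : ℕ) : Type :=
  MultilinearMap k (fun _ : Fin p => A)
    (X →ₗ[k] MultilinearMap k (fun _ : Fin q => B) X)

variable {RA : DGAlgebra k A} {RB : DGAlgebra k B}

/-- `f ∈ Hoch^{p,q,r}(A,X,B)`: homogeneity of internal degree `r`. -/
def IsHomogX (SX : ABBimod k RA RB X) (p q : ℕ) (r : ℤ) (f : XCoch k A B X p q) : Prop :=
  ∀ (dga : ℕ → ℤ) (a : ℕ → A), (∀ i, a i ∈ RA.gr (dga i)) →
  ∀ (ix : ℤ) (x : X), x ∈ SX.gr ix →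
  ∀ (dgb : ℕ → ℤ) (b : ℕ → B), (∀ j, b j ∈ RB.gr (dgb j)) →
    f (fun i => a (i : ℕ)) x (fun j => b (j : ℕ))
      ∈ SX.gr ((∑ i : Fin p, dga (i : ℕ)) + ix + (∑ j : Fin q, dgb (j : ℕ)) + r)

/-- `dXL` is the left part `(d_H^X)_L` of the Hochschild differential of the
dg `A`-`B`-bimodule `X`. -/
def IsDXL (SX : ABBimod k RA RB X)
    (dXL : ∀ (p q : ℕ) (r : ℤ), XCoch k A B X p q →ₗ[k] XCoch k A B X (p + 1) q) : Prop :=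
  ∀ (p q : ℕ) (r : ℤ) (f : XCoch k A B X p q)
    (dga : ℕ → ℤ) (a : ℕ → A), (∀ i, a i ∈ RA.gr (dga i)) →
    ∀ (x : X) (b : ℕ → B),
    dXL p q r f (fun i => a (i : ℕ)) x (fun j => b (j : ℕ)) =
      ε k ((p : ℤ) + q + r + r * dga 0) •
        SX.actL (a 0) (f (fun i => a ((i : ℕ) + 1)) x (fun j => b (j : ℕ)))
      + ∑ i : Fin p, ε k ((p : ℤ) + q + r + (i : ℕ) + 1) •
          f (fun j => if (j : ℕ) < (i : ℕ) then a (j : ℕ)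
              else if (j : ℕ) = (i : ℕ) then a (i : ℕ) * a ((i : ℕ) + 1)
              else a ((j : ℕ) + 1)) x (fun j => b (j : ℕ))
      + ε k ((q : ℤ) + r + 1) •
          f (fun i => a (i : ℕ)) (SX.actL (a p) x) (fun j => b (j : ℕ))

/-- `dXR` is the right part `(d_H^X)_R` of the Hochschild differential of `X`. -/
def IsDXR (SX : ABBimod k RA RB X)
    (dXR : ∀ (p q : ℕ) (r : ℤ), XCoch k A B X p q →ₗ[k] XCoch k A B X p (q + 1)) : Prop :=
  ∀ (p q : ℕ) (r : ℤ) (f : XCoch k A B X p q) (a : ℕ → A) (x : X) (b : ℕ → B),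
    dXR p q r f (fun i => a (i : ℕ)) x (fun j => b (j : ℕ)) =
      ε k ((q : ℤ) + r - 1) •
        f (fun i => a (i : ℕ)) (SX.actR (b 0) x) (fun j => b ((j : ℕ) + 1))
      + ∑ j : Fin q, ε k ((q : ℤ) + r + (j : ℕ)) •
          f (fun i => a (i : ℕ)) x
            (fun l => if (l : ℕ) < (j : ℕ) then b (l : ℕ)
              else if (l : ℕ) = (j : ℕ) then b (j : ℕ) * b ((j : ℕ) + 1)
              else b ((l : ℕ) + 1))
      + ε k r • SX.actR (b q) (f (fun i => a (i : ℕ)) x (fun j => b (j : ℕ)))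

/-- `pdX` is the internal differential `∂_X` on `Hoch(A,X,B)`. -/
def IsPdX (SX : ABBimod k RA RB X)
    (pdX : ∀ (p q : ℕ) (r : ℤ), XCoch k A B X p q →ₗ[k] XCoch k A B X p q) : Prop :=
  ∀ (p q : ℕ) (r : ℤ) (f : XCoch k A B X p q)
    (dga : ℕ → ℤ) (a : ℕ → A), (∀ i, a i ∈ RA.gr (dga i)) →
    ∀ (ix : ℤ) (x : X), x ∈ SX.gr ix →
    ∀ (dgb : ℕ → ℤ) (b : ℕ → B), (∀ j, b j ∈ RB.gr (dgb j)) →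
    pdX p q r f (fun i => a (i : ℕ)) x (fun j => b (j : ℕ)) =
      SX.dX (f (fun i => a (i : ℕ)) x (fun j => b (j : ℕ)))
      - ε k r • (
        (∑ i : Fin p, ε k (∑ j ∈ Finset.range (i : ℕ), dga j) •
          f (fun j => if (j : ℕ) = (i : ℕ) then RA.d (a (i : ℕ)) else a (j : ℕ)) x
            (fun j => b (j : ℕ)))
        + ε k (∑ j ∈ Finset.range p, dga j) •
            f (fun i => a (i : ℕ)) (SX.dX x) (fun j => b (j : ℕ))
        + ∑ j : Fin q, ε k ((∑ l ∈ Finset.range p, dga l) + ix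
              + (∑ l ∈ Finset.range (j : ℕ), dgb l)) •
            f (fun i => a (i : ℕ)) x
              (fun l => if (l : ℕ) = (j : ℕ) then RB.d (b (j : ℕ)) else b (l : ℕ)))

/-- `dAX` is the connecting component `d_H^{AX} : Hoch(A) → Hoch(A,X,B)`. -/
def IsDAX (SX : ABBimod k RA RB X)
    (dAX : ∀ (p : ℕ) (r : ℤ), Coch k A (p : ℤ) →ₗ[k] XCoch k A B X p 0) : Prop :=
  ∀ (p : ℕ) (r : ℤ) (fA : Coch k A (p : ℤ)) (a : ℕ → A) (x : X) (b : Fin 0 → B),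
    dAX p r fA (fun i => a (i : ℕ)) x b =
      ε k r • SX.actL (fA (fun i => a (i : ℕ))) x

/-- `dXB` is the connecting component `d_H^{XB} : Hoch(B) → Hoch(A,X,B)`. -/
def IsDXB (SX : ABBimod k RA RB X)
    (dXB : ∀ (q : ℕ) (r : ℤ), Coch k B (q : ℤ) →ₗ[k] XCoch k A B X 0 q) : Prop :=
  ∀ (q : ℕ) (r : ℤ) (fB : Coch k B (q : ℤ)) (a : Fin 0 → A)
    (ix : ℤ) (x : X), x ∈ SX.gr ix → ∀ (b : ℕ → B),
    dXB q r fB a x (fun j => b (j : ℕ)) =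
      ε k ((q : ℤ) + r - 1 + r * ix) • SX.actR (fB (fun j => b (j : ℕ))) x

/- ### The partial Hochschild sequences -/

/-- Cochains of type `Hom(X ⊗ B^{⊗q}, X)`. -/
abbrev YCoch (B X : Type) [Ring B] [Algebra k B] [AddCommGroup X] [Module k X]
    (q : ℕ) : Type :=
  X →ₗ[k] MultilinearMap k (fun _ : Fin q => B) X

/-- Cochains of type `Hom(A^{⊗p} ⊗ X, X)`. -/
abbrev ZCoch (A X : Type) [Ring A] [Algebra k A] [AddCommGroup X] [Module k X]
    (p : ℕ) : Type :=
  MultilinearMap k (fun _ : Fin p => A) (X →ₗ[k] X)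

def IsHomogY (SX : ABBimod k RA RB X) (q : ℕ) (r : ℤ) (f : YCoch k B X q) : Prop :=
  ∀ (ix : ℤ) (x : X), x ∈ SX.gr ix →
  ∀ (dgb : ℕ → ℤ) (b : ℕ → B), (∀ j, b j ∈ RB.gr (dgb j)) →
    f x (fun j => b (j : ℕ)) ∈ SX.gr (ix + (∑ j : Fin q, dgb (j : ℕ)) + r)

def IsHomogZ (SX : ABBimod k RA RB X) (p : ℕ) (r : ℤ) (f : ZCoch k A X p) : Prop :=
  ∀ (dga : ℕ → ℤ) (a : ℕ → A), (∀ i, a i ∈ RA.gr (dga i)) →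
  ∀ (ix : ℤ) (x : X), x ∈ SX.gr ix →
    f (fun i => a (i : ℕ)) x ∈ SX.gr ((∑ i : Fin p, dga (i : ℕ)) + ix + r)

/-- `dR` is the partial Hochschild differential `(d_H^X)_R` on `Hom(X⊗B^{⊗•}, X)`. -/
def IsDR (SX : ABBimod k RA RB X)
    (dR : ∀ (q : ℕ) (r : ℤ), YCoch k B X q →ₗ[k] YCoch k B X (q + 1)) : Prop :=
  ∀ (q : ℕ) (r : ℤ) (f : YCoch k B X q) (x : X) (b : ℕ → B),
    dR q r f x (fun j => b (j : ℕ)) =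
      ε k ((q : ℤ) + r - 1) • f (SX.actR (b 0) x) (fun j => b ((j : ℕ) + 1))
      + ∑ j : Fin q, ε k ((q : ℤ) + r + (j : ℕ)) •
          f x (fun l => if (l : ℕ) < (j : ℕ) then b (l : ℕ)
              else if (l : ℕ) = (j : ℕ) then b (j : ℕ) * b ((j : ℕ) + 1)
              else b ((l : ℕ) + 1))
      + ε k r • SX.actR (b q) (f x (fun j => b (j : ℕ)))

/-- `dL` is the partial Hochschild differential `(d_H^X)_L` on `Hom(A^{⊗•}⊗X, X)`. -/
def IsDL (SX : ABBimod k RA RB X)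
    (dL : ∀ (p : ℕ) (r : ℤ), ZCoch k A X p →ₗ[k] ZCoch k A X (p + 1)) : Prop :=
  ∀ (p : ℕ) (r : ℤ) (f : ZCoch k A X p)
    (dga : ℕ → ℤ) (a : ℕ → A), (∀ i, a i ∈ RA.gr (dga i)) → ∀ (x : X),
    dL p r f (fun i => a (i : ℕ)) x =
      ε k ((p : ℤ) + r + r * dga 0) • SX.actL (a 0) (f (fun i => a ((i : ℕ) + 1)) x)
      + ∑ i : Fin p, ε k ((p : ℤ) + r + (i : ℕ) + 1) •
          f (fun j => if (j : ℕ) < (i : ℕ) then a (j : ℕ)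
              else if (j : ℕ) = (i : ℕ) then a (i : ℕ) * a ((i : ℕ) + 1)
              else a ((j : ℕ) + 1)) x
      + ε k (r + 1) • f (fun i => a (i : ℕ)) (SX.actL (a p) x)

/-- Exactness of the sequence
`0 → Hom_{B^op}(X,X) ↪ Hom(X,X) → Hom(X⊗B,X) → Hom(X⊗B^{⊗2},X) → ⋯`. -/
def ExactR (SX : ABBimod k RA RB X)
    (dR : ∀ (q : ℕ) (r : ℤ), YCoch k B X q →ₗ[k] YCoch k B X (q + 1)) : Prop :=
  (∀ (r : ℤ) (f : YCoch k B X 0), IsHomogY k SX 0 r f →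
    (dR 0 r f = 0 ↔ ∀ (b : B) (x : X),
      f (SX.actR b x) (fun j => j.elim0) = SX.actR b (f x (fun j => j.elim0))))
  ∧ (∀ (q : ℕ) (r : ℤ) (f : YCoch k B X (q + 1)), IsHomogY k SX (q + 1) r f →
      dR (q + 1) r f = 0 →
      ∃ g : YCoch k B X q, IsHomogY k SX q r g ∧ dR q r g = f)

/-- Exactness of the sequence
`0 → Hom_A(X,X) ↪ Hom(X,X) → Hom(A⊗X,X) → Hom(A^{⊗2}⊗X,X) → ⋯`. -/
def ExactL (SX : ABBimod k RA RB X)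
    (dL : ∀ (p : ℕ) (r : ℤ), ZCoch k A X p →ₗ[k] ZCoch k A X (p + 1)) : Prop :=
  (∀ (r : ℤ) (f : ZCoch k A X 0), IsHomogZ k SX 0 r f →
    (dL 0 r f = 0 ↔ ∀ (i : ℤ) (a : A) (x : X), a ∈ RA.gr i →
      f (fun j => j.elim0) (SX.actL a x) = ε k (r * i) • SX.actL a (f (fun j => j.elim0) x)))
  ∧ (∀ (p : ℕ) (r : ℤ) (f : ZCoch k A X (p + 1)), IsHomogZ k SX (p + 1) r f →
      dL (p + 1) r f = 0 →
      ∃ g : ZCoch k A X p, IsHomogZ k SX p r g ∧ dL p r g = f)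

/- ### Models of `Hom_{B^op}(X,X)` and `Hom_A(X,X)` as dg bimodules -/

/-- A model `E` for the dg `A`-`A`-bimodule `Hom_{B^op}(X,X)` of graded right
`B`-linear endomorphisms of `X`, with differential `∂_X = [d_X, −]`. -/
structure EndBModel (SX : ABBimod k RA RB X) (E : Type)
    [AddCommGroup E] [Module k E] : Type where
  SE : DGBimod k RA E
  toEnd : E →ₗ[k] X →ₗ[k] X
  inj : Function.Injective toEnd
  rlin : ∀ {r : ℤ} {e : E}, e ∈ SE.gr r → ∀ (b : B) (x : X),
    toEnd e (SX.actR b x) = SX.actR b (toEnd e x)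
  graded : ∀ {r i : ℤ} {e : E} {x : X}, e ∈ SE.gr r → x ∈ SX.gr i →
    toEnd e x ∈ SX.gr (i + r)
  surj : ∀ (r : ℤ) (φ : X →ₗ[k] X),
    (∀ (b : B) (x : X), φ (SX.actR b x) = SX.actR b (φ x)) →
    (∀ (i : ℤ) (x : X), x ∈ SX.gr i → φ x ∈ SX.gr (i + r)) →
    ∃ e ∈ SE.gr r, toEnd e = φ
  d_eq : ∀ {r : ℤ} (e : E), e ∈ SE.gr r → ∀ x,
    toEnd (SE.dM e) x = SX.dX (toEnd e x) - ε k r • toEnd e (SX.dX x)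
  actL_eq : ∀ (a : A) (e : E) (x : X), toEnd (SE.actL a e) x = SX.actL a (toEnd e x)
  actR_eq : ∀ (a : A) (e : E) (x : X), toEnd (SE.actR a e) x = toEnd e (SX.actL a x)

/-- A model `E'` for the dg `B`-`B`-bimodule `Hom_A(X,X)` of graded left
`A`-linear endomorphisms of `X`, with differential `∂_X = [d_X, −]`. -/
structure EndAModel (SX : ABBimod k RA RB X) (E' : Type)
    [AddCommGroup E'] [Module k E'] : Type where
  SE : DGBimod k RB E'
  toEnd : E' →ₗ[k] X →ₗ[k] X
  inj : Function.Injective toEnd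
  llin : ∀ {r i : ℤ} {e : E'} {a : A}, e ∈ SE.gr r → a ∈ RA.gr i → ∀ x,
    toEnd e (SX.actL a x) = ε k (r * i) • SX.actL a (toEnd e x)
  graded : ∀ {r i : ℤ} {e : E'} {x : X}, e ∈ SE.gr r → x ∈ SX.gr i →
    toEnd e x ∈ SX.gr (i + r)
  surj : ∀ (r : ℤ) (φ : X →ₗ[k] X),
    (∀ (i : ℤ) (a : A) (x : X), a ∈ RA.gr i →
      φ (SX.actL a x) = ε k (r * i) • SX.actL a (φ x)) →
    (∀ (i : ℤ) (x : X), x ∈ SX.gr i → φ x ∈ SX.gr (i + r)) →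
    ∃ e ∈ SE.gr r, toEnd e = φ
  d_eq : ∀ {r : ℤ} (e : E'), e ∈ SE.gr r → ∀ x,
    toEnd (SE.dM e) x = SX.dX (toEnd e x) - ε k r • toEnd e (SX.dX x)
  actL_eq : ∀ {j r i : ℤ} (b : B) (e : E') (x : X),
    b ∈ RB.gr j → e ∈ SE.gr r → x ∈ SX.gr i →
    toEnd (SE.actL b e) x = ε k (j * (r + i)) • toEnd e (SX.actR b x)
  actR_eq : ∀ {j i : ℤ} (b : B) (e : E') (x : X), b ∈ RB.gr j → x ∈ SX.gr i →
    toEnd (SE.actR b e) x = ε k (j * i) • SX.actR b (toEnd e x)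

/-- `ρ_A : A → Hom_{B^op}(X,X)` is the left action map `ρ_A(a)(x) = a·x`. -/
def IsRhoA {E : Type} [AddCommGroup E] [Module k E] (SX : ABBimod k RA RB X)
    (EM : EndBModel k SX E) (ρA : A →ₗ[k] E) : Prop :=
  ∀ (a : A) (x : X), EM.toEnd (ρA a) x = SX.actL a x

/-- `ρ_B : B^op → Hom_A(X,X)` is the right action map
`ρ_B(b)(x) = (-1)^{|x||b|} x·b`. -/
def IsRhoB {E' : Type} [AddCommGroup E'] [Module k E'] (SX : ABBimod k RA RB X)
    (EM : EndAModel k SX E') (ρB : B →ₗ[k] E') : Prop :=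
  ∀ {j i : ℤ} (b : B) (x : X), b ∈ RB.gr j → x ∈ SX.gr i →
    EM.toEnd (ρB b) x = ε k (i * j) • SX.actR b x

/- ### The canonical embedding `Φ` -/

/-- The constant-multilinear-map inclusion. -/
def constML : X →ₗ[k] MultilinearMap k (fun _ : Fin 0 => B) X where
  toFun x := MultilinearMap.constOfIsEmpty k _ x
  map_add' x y := by ext m; simp
  map_smul' c x := by ext m; simp

/-- The embedding `Φ^{p,r} : Hoch^{p,r}(A, Hom_{B^op}(X,X)) → Hoch^{p,0,r}(A,X,B)`
(including the sign `(-1)^r`). -/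
def PhiMap {E : Type} [AddCommGroup E] [Module k E] (SX : ABBimod k RA RB X)
    (EM : EndBModel k SX E) (p : ℕ) (r : ℤ) (f : MCoch k A E p) :
    XCoch k A B X p 0 :=
  ε k r • ((((LinearMap.llcomp k X X (MultilinearMap k (fun _ : Fin 0 => B) X))
      (constML k)).comp EM.toEnd).compMultilinearMap f)

/-- The embedding `Ψ : Hoch^{q,r}(B, Hom_A(X,X)) → Hoch^{0,q,r}(A,X,B)`,
`Ψ(f)(x; b₁,…,b_q) = (-1)^{q+r-1}(-1)^{|x|(|b₁|+⋯+|b_q|)} f(b₁⊗⋯⊗b_q)(x)`. -/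
def IsPsi {E' : Type} [AddCommGroup E'] [Module k E'] (SX : ABBimod k RA RB X)
    (EM : EndAModel k SX E')
    (Psi : ∀ (q : ℕ) (r : ℤ), MCoch k B E' q →ₗ[k] XCoch k A B X 0 q) : Prop :=
  ∀ (q : ℕ) (r : ℤ) (f : MCoch k B E' q) (a : Fin 0 → A)
    (ix : ℤ) (x : X), x ∈ SX.gr ix →
    ∀ (dgb : ℕ → ℤ) (b : ℕ → B), (∀ j, b j ∈ RB.gr (dgb j)) →
    Psi q r f a x (fun j => b (j : ℕ)) =
      (ε k ((q : ℤ) + r - 1) * ε k (ix * ∑ j ∈ Finset.range q, dgb j)) •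
        EM.toEnd (f (fun j => b (j : ℕ))) x

/- ### The total Hochschild complex of the dg `A`-`B`-bimodule `X` -/

abbrev TotXCoch (A B X : Type) [Ring A] [Algebra k A] [Ring B] [Algebra k B]
    [AddCommGroup X] [Module k X] : Type := ∀ p q : ℕ, XCoch k A B X p q

def TotHomogX (SX : ABBimod k RA RB X) (n : ℤ) (cx : TotXCoch k A B X) : Prop :=
  ∀ p q : ℕ, IsHomogX k SX p q (n - p - q - 1) (cx p q)

def TotFinSuppX (cx : TotXCoch k A B X) : Prop :=
  ∃ N : ℕ, ∀ p q : ℕ, p + q ≥ N → cx p q = 0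

/-- The `X`-component of the total differential of the Hochschild complex
`Hoch_⊕(X) = Hoch_⊕(A) ⊕ Hoch_⊕(A,X,B) ⊕ Hoch_⊕(B)`, applied to an element of
total degree `n`. -/
def TotDXpart
    (dXL : ∀ (p q : ℕ) (r : ℤ), XCoch k A B X p q →ₗ[k] XCoch k A B X (p + 1) q)
    (dXR : ∀ (p q : ℕ) (r : ℤ), XCoch k A B X p q →ₗ[k] XCoch k A B X p (q + 1))
    (pdX : ∀ (p q : ℕ) (r : ℤ), XCoch k A B X p q →ₗ[k] XCoch k A B X p q)
    (dAX : ∀ (p : ℕ) (r : ℤ), Coch k A (p : ℤ) →ₗ[k] XCoch k A B X p 0)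
    (dXB : ∀ (q : ℕ) (r : ℤ), Coch k B (q : ℤ) →ₗ[k] XCoch k A B X 0 q)
    (n : ℤ) (cA : TotCoch k A) (cx : TotXCoch k A B X) (cB : TotCoch k B) :
    TotXCoch k A B X :=
  fun p q => match p, q with
  | 0, 0 => pdX 0 0 (n - 1) (cx 0 0) + dAX 0 n (cA 0) + dXB 0 n (cB 0)
  | (p + 1), 0 => pdX (p + 1) 0 (n - (p + 1) - 1) (cx (p + 1) 0)
      + dXL p 0 (n - p - 1) (cx p 0) + dAX (p + 1) (n - (p + 1)) (cA (p + 1))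
  | 0, (q + 1) => pdX 0 (q + 1) (n - (q + 1) - 1) (cx 0 (q + 1))
      + dXR 0 q (n - q - 1) (cx 0 q) + dXB (q + 1) (n - (q + 1)) (cB (q + 1))
  | (p + 1), (q + 1) => pdX (p + 1) (q + 1) (n - (p + 1) - (q + 1) - 1) (cx (p + 1) (q + 1))
      + dXL p (q + 1) (n - p - (q + 1) - 1) (cx p (q + 1))
      + dXR (p + 1) q (n - (p + 1) - q - 1) (cx (p + 1) q)

/-- A total cocycle of `Hoch_⊕(X)`, given componentwise by families
`(cA, cx, cB)` of total degree `n`. -/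
def TotXIsCocycle
    (dHA : ∀ p r : ℤ, Coch k A p →ₗ[k] Coch k A (p + 1))
    (pdA : ∀ p r : ℤ, Coch k A p →ₗ[k] Coch k A p)
    (dHB : ∀ p r : ℤ, Coch k B p →ₗ[k] Coch k B (p + 1))
    (pdB : ∀ p r : ℤ, Coch k B p →ₗ[k] Coch k B p)
    (dXL : ∀ (p q : ℕ) (r : ℤ), XCoch k A B X p q →ₗ[k] XCoch k A B X (p + 1) q)
    (dXR : ∀ (p q : ℕ) (r : ℤ), XCoch k A B X p q →ₗ[k] XCoch k A B X p (q + 1))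
    (pdX : ∀ (p q : ℕ) (r : ℤ), XCoch k A B X p q →ₗ[k] XCoch k A B X p q)
    (dAX : ∀ (p : ℕ) (r : ℤ), Coch k A (p : ℤ) →ₗ[k] XCoch k A B X p 0)
    (dXB : ∀ (q : ℕ) (r : ℤ), Coch k B (q : ℤ) →ₗ[k] XCoch k A B X 0 q)
    (n : ℤ) (cA : TotCoch k A) (cx : TotXCoch k A B X) (cB : TotCoch k B) : Prop :=
  (∀ p : ℕ, TotD k dHA pdA n cA p = 0)
  ∧ (∀ q : ℕ, TotD k dHB pdB n cB q = 0)
  ∧ (∀ p q : ℕ, TotDXpart k dXL dXR pdX dAX dXB n cA cx cB p q = 0)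

/-- `(cA, cx, cB)` (of total degree `n`) is a total coboundary in `Hoch_⊕(X)`. -/
def TotXIsCoboundary (SX : ABBimod k RA RB X)
    (dHA : ∀ p r : ℤ, Coch k A p →ₗ[k] Coch k A (p + 1))
    (pdA : ∀ p r : ℤ, Coch k A p →ₗ[k] Coch k A p)
    (dHB : ∀ p r : ℤ, Coch k B p →ₗ[k] Coch k B (p + 1))
    (pdB : ∀ p r : ℤ, Coch k B p →ₗ[k] Coch k B p)
    (dXL : ∀ (p q : ℕ) (r : ℤ), XCoch k A B X p q →ₗ[k] XCoch k A B X (p + 1) q)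
    (dXR : ∀ (p q : ℕ) (r : ℤ), XCoch k A B X p q →ₗ[k] XCoch k A B X p (q + 1))
    (pdX : ∀ (p q : ℕ) (r : ℤ), XCoch k A B X p q →ₗ[k] XCoch k A B X p q)
    (dAX : ∀ (p : ℕ) (r : ℤ), Coch k A (p : ℤ) →ₗ[k] XCoch k A B X p 0)
    (dXB : ∀ (q : ℕ) (r : ℤ), Coch k B (q : ℤ) →ₗ[k] XCoch k A B X 0 q)
    (n : ℤ) (cA : TotCoch k A) (cx : TotXCoch k A B X) (cB : TotCoch k B) : Prop :=
  ∃ (bA : TotCoch k A) (bx : TotXCoch k A B X) (bB : TotCoch k B),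
    TotHomog k RA (n - 1) bA ∧ TotFinSupp k bA ∧
    TotHomogX k SX (n - 1) bx ∧ TotFinSuppX k bx ∧
    TotHomog k RB (n - 1) bB ∧ TotFinSupp k bB ∧
    (∀ p : ℕ, cA p = TotD k dHA pdA (n - 1) bA p)
    ∧ (∀ q : ℕ, cB q = TotD k dHB pdB (n - 1) bB q)
    ∧ (∀ p q : ℕ, cx p q = TotDXpart k dXL dXR pdX dAX dXB (n - 1) bA bx bB p q)

/-- The total differential `d_H^X + ∂_X` of the complex `Hoch_⊕(A,X,B)` alone. -/
def TotDXonly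
    (dXL : ∀ (p q : ℕ) (r : ℤ), XCoch k A B X p q →ₗ[k] XCoch k A B X (p + 1) q)
    (dXR : ∀ (p q : ℕ) (r : ℤ), XCoch k A B X p q →ₗ[k] XCoch k A B X p (q + 1))
    (pdX : ∀ (p q : ℕ) (r : ℤ), XCoch k A B X p q →ₗ[k] XCoch k A B X p q)
    (n : ℤ) (cx : TotXCoch k A B X) : TotXCoch k A B X :=
  TotDXpart k dXL dXR pdX (fun _ _ => 0) (fun _ _ => 0) n (fun _ => 0) cx (fun _ => 0)

def TotXonlyCocycle
    (dXL : ∀ (p q : ℕ) (r : ℤ), XCoch k A B X p q →ₗ[k] XCoch k A B X (p + 1) q)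
    (dXR : ∀ (p q : ℕ) (r : ℤ), XCoch k A B X p q →ₗ[k] XCoch k A B X p (q + 1))
    (pdX : ∀ (p q : ℕ) (r : ℤ), XCoch k A B X p q →ₗ[k] XCoch k A B X p q)
    (n : ℤ) (cx : TotXCoch k A B X) : Prop :=
  ∀ p q : ℕ, TotDXonly k dXL dXR pdX n cx p q = 0

def TotXonlyCoboundary (SX : ABBimod k RA RB X)
    (dXL : ∀ (p q : ℕ) (r : ℤ), XCoch k A B X p q →ₗ[k] XCoch k A B X (p + 1) q)
    (dXR : ∀ (p q : ℕ) (r : ℤ), XCoch k A B X p q →ₗ[k] XCoch k A B X p (q + 1))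
    (pdX : ∀ (p q : ℕ) (r : ℤ), XCoch k A B X p q →ₗ[k] XCoch k A B X p q)
    (n : ℤ) (cx : TotXCoch k A B X) : Prop :=
  ∃ bx : TotXCoch k A B X, TotHomogX k SX (n - 1) bx ∧ TotFinSuppX k bx ∧
    ∀ p q : ℕ, cx p q = TotDXonly k dXL dXR pdX (n - 1) bx p q

/-- The totalization of `Φ` (resp. of `Ψ`-type maps), taking a total cochain of
`Hoch_⊕(A, Hom_{B^op}(X,X))` of total degree `m` to a total cochain of
`Hoch_⊕(A,X,B)` of total degree `m + 1`, supported in `q = 0`. -/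
def PhiTot {E : Type} [AddCommGroup E] [Module k E] (SX : ABBimod k RA RB X)
    (EM : EndBModel k SX E) (m : ℤ) (α : TotMCoch k A E) : TotXCoch k A B X :=
  fun p q => match q with
  | 0 => PhiMap k SX EM p (m - p) (α p)
  | _ + 1 => 0

def PsiTot {E' : Type} [AddCommGroup E'] [Module k E']
    (Psi : ∀ (q : ℕ) (r : ℤ), MCoch k B E' q →ₗ[k] XCoch k A B X 0 q)
    (m : ℤ) (β : TotMCoch k B E') : TotXCoch k A B X :=
  fun p q => match p with
  | 0 => Psi q (m - q) (β q)
  | _ + 1 => 0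

/- ### The trivial-extension dg algebra `A ⋉ X ⋊ B` -/

variable {C : Type} [Ring C] [Algebra k C]

/-- `(C, RC)` together with the inclusions `iA, iX, iB` and the projections
`prA, prX, prB` is a model of the trivial-extension dg algebra `A ⋉ X ⋊ B`. -/
def IsTrivExtModel (RA : DGAlgebra k A) (RB : DGAlgebra k B)
    (SX : ABBimod k RA RB X) (RC : DGAlgebra k C)
    (iA : A →ₗ[k] C) (iX : X →ₗ[k] C) (iB : B →ₗ[k] C)
    (prA : C →ₗ[k] A) (prX : C →ₗ[k] X) (prB : C →ₗ[k] B) : Prop :=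
  (∀ c : C, iA (prA c) + iX (prX c) + iB (prB c) = c)
  ∧ (∀ a, prA (iA a) = a) ∧ (∀ x, prX (iX x) = x) ∧ (∀ b, prB (iB b) = b)
  ∧ (∀ a, prX (iA a) = 0) ∧ (∀ a, prB (iA a) = 0)
  ∧ (∀ x, prA (iX x) = 0) ∧ (∀ x, prB (iX x) = 0)
  ∧ (∀ b, prA (iB b) = 0) ∧ (∀ b, prX (iB b) = 0)
  ∧ (∀ a a', iA a * iA a' = iA (a * a')) ∧ (∀ b b', iB b * iB b' = iB (b * b'))
  ∧ (∀ a x, iA a * iX x = iX (SX.actL a x)) ∧ (∀ x b, iX x * iB b = iX (SX.actR b x))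
  ∧ (∀ a b, iA a * iB b = 0) ∧ (∀ b a, iB b * iA a = 0)
  ∧ (∀ x a, iX x * iA a = 0) ∧ (∀ b x, iB b * iX x = 0) ∧ (∀ x x', iX x * iX x' = 0)
  ∧ (∀ a, RC.d (iA a) = iA (RA.d a)) ∧ (∀ x, RC.d (iX x) = iX (SX.dX x))
  ∧ (∀ b, RC.d (iB b) = iB (RB.d b))
  ∧ (∀ (i : ℤ) (a : A), a ∈ RA.gr i → iA a ∈ RC.gr i)
  ∧ (∀ (i : ℤ) (x : X), x ∈ SX.gr i → iX x ∈ RC.gr i)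
  ∧ (∀ (i : ℤ) (b : B), b ∈ RB.gr i → iB b ∈ RC.gr i)

/-- Membership in the subspace `Hoch_⊕(X) ⊆ Hoch_⊕(A ⋉ X ⋊ B)`: a cochain `F`
belongs to `Hoch_⊕(A) ⊕ Hoch_⊕(A,X,B) ⊕ Hoch_⊕(B)` (embedded via the canonical
inclusions and projections). -/
def InHochOfX (iA : A →ₗ[k] C) (iX : X →ₗ[k] C) (iB : B →ₗ[k] C)
    (prA : C →ₗ[k] A) (prX : C →ₗ[k] X) (prB : C →ₗ[k] B)
    (p : ℤ) (F : Coch k C p) : Prop :=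
  ∃ (gA : Coch k A p) (gB : Coch k B p)
    (gX : ∀ pa : ℕ, XCoch k A B X pa (p.toNat - 1 - pa)),
    ∀ c : Fin p.toNat → C,
      F c = iA (gA (fun i => prA (c i))) + iB (gB (fun i => prB (c i)))
        + ∑ s ∈ (Finset.range p.toNat).attach,
            iX (gX s.1
              (fun i : Fin s.1 =>
                prA (c ⟨i, by have := Finset.mem_range.mp s.2; have := i.isLt; omega⟩))
              (prX (c ⟨s.1, Finset.mem_range.mp s.2⟩))
              (fun j : Fin (p.toNat - 1 - s.1) =>
                prB (c ⟨s.1 + 1 + j, by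
                  have := Finset.mem_range.mp s.2; have := j.isLt; omega⟩)))

/-- The projection `π_A : Hoch_⊕(A ⋉ X ⋊ B) → Hoch_⊕(A)`. -/
def piA (iA : A →ₗ[k] C) (prA : C →ₗ[k] A) {p : ℤ} (F : Coch k C p) : Coch k A p :=
  prA.compMultilinearMap (F.compLinearMap (fun _ => iA))

/-- The projection `π_B : Hoch_⊕(A ⋉ X ⋊ B) → Hoch_⊕(B)`. -/
def piB (iB : B →ₗ[k] C) (prB : C →ₗ[k] B) {p : ℤ} (F : Coch k C p) : Coch k B p :=
  prB.compMultilinearMap (F.compLinearMap (fun _ => iB))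

/-- The inclusion `ι_A : Hoch_⊕(A) → Hoch_⊕(A ⋉ X ⋊ B)`. -/
def iotaA (iA : A →ₗ[k] C) (prA : C →ₗ[k] A) {p : ℤ} (g : Coch k A p) : Coch k C p :=
  iA.compMultilinearMap (g.compLinearMap (fun _ => prA))

/-- The inclusion `ι_B : Hoch_⊕(B) → Hoch_⊕(A ⋉ X ⋊ B)`. -/
def iotaB (iB : B →ₗ[k] C) (prB : C →ₗ[k] B) {p : ℤ} (g : Coch k B p) : Coch k C p :=
  iB.compMultilinearMap (g.compLinearMap (fun _ => prB))

section Homogeneous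

/-! ### Signs -/

theorem ε_add (m n : ℤ) : ε k (m + n) = ε k m * ε k n := by
  unfold ε
  by_cases hm : Even m <;> by_cases hn : Even n <;> simp [hm, hn, Int.even_add]

theorem ε_neg (n : ℤ) : ε k (-n) = ε k n := by simp [ε]

theorem ε_sub (m n : ℤ) : ε k (m - n) = ε k m * ε k n := by
  rw [sub_eq_add_neg, ε_add, ε_neg]

@[simp] theorem ε_zero : ε k 0 = 1 := by simp [ε]

@[simp] theorem ε_one : ε k 1 = -1 := by simp [ε]

theorem ε_mul_self (n : ℤ) : ε k n * ε k n = 1 := by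
  unfold ε; split_ifs <;> simp

theorem ε_cases (n : ℤ) : ε k n = 1 ∨ ε k n = -1 := by
  unfold ε; split_ifs <;> simp

theorem ε_ne_zero (n : ℤ) : ε k n ≠ 0 := by
  rcases ε_cases k n with h | h <;> simp [h]

theorem ε_mul_eq_pow (n : ℤ) (r : ℤ) : ε k (r * n) = if Even r then 1 else ε k n := by
  unfold ε
  by_cases hr : Even r <;> simp [hr, Int.even_mul]

theorem ε_natCast (n : ℕ) : ε k (n : ℤ) = (-1) ^ n := by
  unfold ε
  by_cases h : Even n
  · simp [h]
  · simp [h, (Nat.not_even_iff_odd.mp h).neg_one_pow]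

theorem ε_smul_smul (n : ℤ) (m : M) : ε k n • ε k n • m = m := by
  rw [smul_smul, ε_mul_self, one_smul]

variable {k}

/-! ### Multilinear maps on graded vector spaces -/

section Graded

variable {V W : Type} [AddCommGroup V] [Module k V] [AddCommGroup W] [Module k W]
  {gr : ℤ → Submodule k V}

/-- A basis of a graded vector space consisting of homogeneous elements. -/
def homBasis (h : DirectSum.IsInternal gr) :
    Module.Basis (Σ i, Module.Basis.ofVectorSpaceIndex k (gr i)) k V :=
  h.collectedBasis (fun i => Module.Basis.ofVectorSpace k (gr i))

theorem homBasis_mem (h : DirectSum.IsInternal gr) (j) : homBasis h j ∈ gr j.1 :=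
  h.collectedBasis_mem _ j

/-- The vectors of the homogeneous basis in degree `i`. -/
def homBasisSet (h : DirectSum.IsInternal gr) (i : ℤ) : Set V :=
  {w | ∃ j : (Σ i, Module.Basis.ofVectorSpaceIndex k (gr i)), j.1 = i ∧ homBasis h j = w}

theorem mem_span_homBasis (h : DirectSum.IsInternal gr) {i : ℤ} {v : V} (hv : v ∈ gr i) :
    v ∈ Submodule.span k (homBasisSet h i) := by
  have h1 := (Module.Basis.ofVectorSpace k (gr i)).mem_span ⟨v, hv⟩
  have h2 := Submodule.mem_map_of_mem (f := (gr i).subtype) h1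
  rw [Submodule.map_span] at h2
  refine Submodule.span_mono ?_ h2
  rintro _ ⟨_, ⟨j, rfl⟩, rfl⟩
  refine ⟨⟨i, j⟩, rfl, ?_⟩
  simp [homBasis]

theorem multilinear_mem_of_span {p : ℕ} (f : MultilinearMap k (fun _ : Fin p => V) W)
    (S : Fin p → Set V) (U : Submodule k W) (H : ∀ s, (∀ i, s i ∈ S i) → f s ∈ U)
    (a : Fin p → V) (ha : ∀ i, a i ∈ Submodule.span k (S i)) : f a ∈ U := by
  induction p with
  | zero => exact H a (fun i => i.elim0)
  | succ p ih =>
    have key : ∀ v ∈ Submodule.span k (S 0), f (Fin.cons v (Fin.tail a)) ∈ U := by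
      intro v hv
      induction hv using Submodule.span_induction with
      | mem x hx =>
        refine ih (f.curryLeft x) (fun i => S i.succ) ?_ (Fin.tail a) (fun i => ha i.succ)
        intro s hs
        refine H _ (fun i => ?_)
        refine Fin.cases ?_ (fun i => ?_) i
        · simpa using hx
        · simpa using hs i
      | zero => rw [f.map_coord_zero 0 (by simp)]; exact U.zero_mem
      | add x y _ _ hx hy =>
        rw [MultilinearMap.cons_add]; exact U.add_mem hx hy
      | smul c x _ hx =>
        rw [MultilinearMap.cons_smul]; exact U.smul_mem c hx
    simpa using key (a 0) (ha 0)

theorem multilinear_mem_of_homBasis (h : DirectSum.IsInternal gr) {p : ℕ}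
    (f : MultilinearMap k (fun _ : Fin p => V) W) (U : ℤ → Submodule k W) (r : ℤ)
    (H : ∀ J : Fin p → (Σ i, Module.Basis.ofVectorSpaceIndex k (gr i)),
      f (fun i => homBasis h (J i)) ∈ U ((∑ i, (J i).1) + r))
    (dg : Fin p → ℤ) (a : Fin p → V) (ha : ∀ i, a i ∈ gr (dg i)) :
    f a ∈ U ((∑ i, dg i) + r) := by
  refine multilinear_mem_of_span f (fun i => homBasisSet h (dg i)) _ ?_ a
    (fun i => mem_span_homBasis h (ha i))
  intro s hs
  have hs' : ∀ i, ∃ j : (Σ i, Module.Basis.ofVectorSpaceIndex k (gr i)),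
      j.1 = dg i ∧ homBasis h j = s i := hs
  choose J hJ hs using hs'
  have e : (fun i => homBasis h (J i)) = s := funext hs
  have e' : (∑ i, (J i).1) = ∑ i, dg i := Finset.sum_congr rfl fun i _ => hJ i
  rw [← e, ← e']
  exact H J

theorem multilinear_ext_hom (h : DirectSum.IsInternal gr) {p : ℕ}
    {f g : MultilinearMap k (fun _ : Fin p => V) W}
    (H : ∀ (dg : ℕ → ℤ) (a : ℕ → V), (∀ i, a i ∈ gr (dg i)) →
      f (fun i => a i) = g (fun i => a i)) : f = g := by
  refine Module.Basis.ext_multilinear (fun _ => homBasis h) (fun J => ?_)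
  have := H (fun i => if hi : i < p then (J ⟨i, hi⟩).1 else 0)
    (fun i => if hi : i < p then homBasis h (J ⟨i, hi⟩) else 0) (fun i => by
      by_cases hi : i < p
      · simpa [hi] using homBasis_mem h _
      · simp [hi])
  simpa using this

theorem linear_ext_hom (h : DirectSum.IsInternal gr) {f g : V →ₗ[k] W}
    (H : ∀ (i : ℤ) (v : V), v ∈ gr i → f v = g v) : f = g :=
  (homBasis h).ext fun j => H j.1 _ (homBasis_mem h j)

/-- Linear maps on the homogeneous components glue to a linear map. -/
def gradedLift (h : DirectSum.IsInternal gr) (φ : ∀ i, gr i →ₗ[k] W) : V →ₗ[k] W :=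
  (DirectSum.toModule k ℤ W φ).comp
    (LinearEquiv.ofBijective (DirectSum.coeLinearMap gr) h).symm.toLinearMap

theorem gradedLift_apply (h : DirectSum.IsInternal gr) (φ : ∀ i, gr i →ₗ[k] W) {i : ℤ} {v : V}
    (hv : v ∈ gr i) : gradedLift h φ v = φ i ⟨v, hv⟩ := by
  have : (LinearEquiv.ofBijective (DirectSum.coeLinearMap gr) h).symm v
      = DirectSum.lof k ℤ (fun i => gr i) i ⟨v, hv⟩ := by
    rw [LinearEquiv.symm_apply_eq]
    exact (DirectSum.coeLinearMap_lof gr i ⟨v, hv⟩).symm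
  simp [gradedLift, this]

/-- The parity involution `v ↦ (-1)^{|v|} v`. -/
def parity (h : DirectSum.IsInternal gr) : V →ₗ[k] V :=
  gradedLift h (fun i => ε k i • (gr i).subtype)

theorem parity_apply (h : DirectSum.IsInternal gr) {i : ℤ} {v : V} (hv : v ∈ gr i) :
    parity h v = ε k i • v := by
  rw [parity, gradedLift_apply h _ hv]; rfl

theorem parity_mem (h : DirectSum.IsInternal gr) {i : ℤ} {v : V} (hv : v ∈ gr i) :
    parity h v ∈ gr i := by
  rw [parity_apply h hv]; exact (gr i).smul_mem _ hv

/-- The multilinear map with prescribed values on tuples of basis vectors. -/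
def multilinearExtend {ι : Type} (b : Module.Basis ι k V) :
    (p : ℕ) → ((Fin p → ι) → W) →ₗ[k] MultilinearMap k (fun _ : Fin p => V) W
  | 0 =>
    { toFun := fun φ => MultilinearMap.constOfIsEmpty k _ (φ Fin.elim0)
      map_add' := fun φ ψ => by ext; simp
      map_smul' := fun c φ => by ext; simp }
  | p + 1 =>
    (multilinearCurryLeftEquiv k (fun _ : Fin (p + 1) => V) W).symm.toLinearMap ∘ₗ
      (b.constr k).toLinearMap ∘ₗ
      LinearMap.pi (fun i => (multilinearExtend b p) ∘ₗ LinearMap.funLeft k W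
        (fun J : Fin p → ι => (Fin.cons i J : Fin (p + 1) → ι)))

theorem multilinearExtend_basis {ι : Type} (b : Module.Basis ι k V) (p : ℕ)
    (φ : (Fin p → ι) → W) (J : Fin p → ι) :
    multilinearExtend b p φ (fun i => b (J i)) = φ J := by
  induction p with
  | zero => simp [multilinearExtend, Subsingleton.elim J Fin.elim0]
  | succ p ih =>
    have : Fin.tail (fun i => b (J i)) = fun i => b (Fin.tail J i) := rfl
    simp [multilinearExtend, this, ih, LinearMap.funLeft]

end Graded

end Homogeneous

section Sequences

variable {k}

/-! ### Faces and derivations of sequences -/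

/-- The sequence `a` with the entries `a i` and `a (i + 1)` multiplied. -/
def seqFace (i : ℕ) (a : ℕ → A) : ℕ → A := fun j =>
  if j < i then a j else if j = i then a i * a (i + 1) else a (j + 1)

/-- The sequence `a` without its first entry. -/
def seqShift (a : ℕ → A) : ℕ → A := fun j => a (j + 1)

/-- The degrees of `seqFace i a`. -/
def degFace (i : ℕ) (dg : ℕ → ℤ) : ℕ → ℤ := fun j =>
  if j < i then dg j else if j = i then dg i + dg (i + 1) else dg (j + 1)

/-- The sequence obtained from `a` by letting the differential act on the entry `i`. -/
def seqDer (R : DGAlgebra k A) (i : ℕ) (a : ℕ → A) : ℕ → A := fun j =>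
  if j < i then parity R.isInternal (a j) else if j = i then R.d (a j) else a j

/-- The degrees of `seqDer R i a`. -/
def degDer (i : ℕ) (dg : ℕ → ℤ) : ℕ → ℤ := fun j => if j = i then dg j + 1 else dg j

/-- The operator `a ↦ (-1)^{r|a|} a`. -/
def sgn (R : DGAlgebra k A) (r : ℤ) : A →ₗ[k] A :=
  if Even r then LinearMap.id else parity R.isInternal

theorem sgn_apply (r : ℤ) {i : ℤ} {a : A} (ha : a ∈ R.gr i) :
    sgn R r a = ε k (r * i) • a := by
  unfold sgn
  rw [ε_mul_eq_pow]
  split_ifs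
  · simp
  · rw [parity_apply R.isInternal ha]

theorem seqFace_mem {dg : ℕ → ℤ} {a : ℕ → A} (ha : ∀ i, a i ∈ R.gr (dg i)) (i j : ℕ) :
    seqFace i a j ∈ R.gr (degFace i dg j) := by
  unfold seqFace degFace
  split_ifs
  · exact ha _
  · exact R.mul_mem (ha _) (ha _)
  · exact ha _

theorem seqDer_mem {dg : ℕ → ℤ} {a : ℕ → A} (ha : ∀ i, a i ∈ R.gr (dg i)) (i j : ℕ) :
    seqDer R i a j ∈ R.gr (degDer i dg j) := by
  unfold seqDer degDer
  split_ifs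
  · omega
  · exact R.d_mem (ha _)
  · exact parity_mem _ (ha _)
  · exact ha _

theorem sgn_mul (r : ℤ) {i j : ℤ} {a b : A} (ha : a ∈ R.gr i) (hb : b ∈ R.gr j) :
    sgn R r (a * b) = sgn R r a * sgn R r b := by
  rw [sgn_apply r (R.mul_mem ha hb), sgn_apply r ha, sgn_apply r hb, mul_add, ε_add,
    smul_mul_smul_comm]

theorem parity_eq_sgn : parity R.isInternal = sgn R 1 := by simp [sgn]

theorem parity_mul {i j : ℤ} {a b : A} (ha : a ∈ R.gr i) (hb : b ∈ R.gr j) :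
    parity R.isInternal (a * b) = parity R.isInternal a * parity R.isInternal b := by
  rw [parity_eq_sgn, sgn_mul _ ha hb]

theorem d_parity {i : ℤ} {a : A} (ha : a ∈ R.gr i) :
    R.d (parity R.isInternal a) = - parity R.isInternal (R.d a) := by
  rw [parity_apply _ ha, parity_apply _ (R.d_mem ha), ε_add]; simp

theorem d_sgn (r : ℤ) {i : ℤ} {a : A} (ha : a ∈ R.gr i) :
    R.d (sgn R r a) = ε k r • sgn R r (R.d a) := by
  rw [sgn_apply _ ha, sgn_apply _ (R.d_mem ha), mul_add, ε_add, map_smul, smul_smul, mul_one,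
    mul_comm (ε k (r * i)), ← mul_assoc, ε_mul_self, one_mul]

theorem sgn_parity (r : ℤ) {i : ℤ} {a : A} (ha : a ∈ R.gr i) :
    sgn R r (parity R.isInternal a) = sgn R (r + 1) a := by
  rw [parity_apply _ ha, map_smul, sgn_apply _ ha, sgn_apply _ ha, smul_smul, ← ε_add]
  congr 2; ring

/-! ### The cofaces -/

/-- The value at a sequence. -/
abbrev evSeq {p : ℕ} (f : MCoch k A M p) (a : ℕ → A) : M := f (fun i => a i)

theorem evSeq_congr {p : ℕ} (f : MCoch k A M p) {a b : ℕ → A} (h : ∀ i < p, a i = b i) :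
    evSeq f a = evSeq f b :=
  congrArg f (funext fun i => h i i.2)

theorem evSeq_smul {p : ℕ} (f : MCoch k A M p) (c : ℕ → k) (a : ℕ → A) :
    evSeq f (fun i => c i • a i) = (∏ i ∈ Finset.range p, c i) • evSeq f a := by
  rw [Finset.prod_range]
  exact f.map_smul_univ (fun i => c i) (fun i => a i)

theorem evSeq_single_eq_zero {p : ℕ} (f : MCoch k A M p) {i : ℕ} (hi : i < p) {a : ℕ → A}
    (h : a i = 0) : evSeq f a = 0 :=
  f.map_coord_zero ⟨i, hi⟩ h

theorem evSeq_single_add {p : ℕ} (f : MCoch k A M p) {i : ℕ} (hi : i < p) {a b c : ℕ → A}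
    (h : c i = a i + b i) (hb : ∀ j, j ≠ i → b j = a j) (hc : ∀ j, j ≠ i → c j = a j) :
    evSeq f c = evSeq f a + evSeq f b := by
  have e : ∀ d : ℕ → A, (∀ j, j ≠ i → d j = a j) →
      (fun j : Fin p => d j) = Function.update (fun j : Fin p => a j) ⟨i, hi⟩ (d i) := by
    intro d hd
    funext j
    by_cases hj : (j : ℕ) = i
    · obtain rfl : j = ⟨i, hi⟩ := Fin.ext hj
      simp
    · rw [Function.update_of_ne (fun h => hj (by rw [h]))]
      exact hd _ hj
  unfold evSeq
  rw [e c hc, e b hb, e a (fun _ _ => rfl), h, f.map_update_add, Function.update_idem,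
    Function.update_idem]

/-- Composition of a linear map with a cochain, as a bilinear map. -/
def postComp (A M N : Type) [Ring A] [Algebra k A] [AddCommGroup M] [Module k M]
    [AddCommGroup N] [Module k N] (p : ℕ) :
    (M →ₗ[k] N) →ₗ[k] MCoch k A M p →ₗ[k] MCoch k A N p :=
  LinearMap.mk₂ k (fun φ f => φ.compMultilinearMap f)
    (fun _ _ _ => rfl) (fun _ _ _ => rfl)
    (fun φ f g => by ext; simp) (fun c φ f => by ext; simp)

/-- The cofaces of the Hochschild complex, on sequences. -/
def coface (St : DGBimod k R M) (p : ℕ) (r : ℤ) (j : ℕ) (F : (ℕ → A) → M) (a : ℕ → A) : M :=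
  if j = 0 then St.actL (sgn R r (a 0)) (F (seqShift a))
  else if j < p + 1 then F (seqFace (j - 1) a)
  else St.actR (a p) (F a)

/-- The signed sum of the cofaces. -/
def hochSum (St : DGBimod k R M) (p : ℕ) (r : ℤ) (F : (ℕ → A) → M) (a : ℕ → A) : M :=
  (- ε k (p + r)) • ∑ j ∈ Finset.range (p + 2), (-1 : k) ^ j • coface St p r j F a

/-- The internal differential, on sequences. -/
def intSum (St : DGBimod k R M) (p : ℕ) (r : ℤ) (F : (ℕ → A) → M) (a : ℕ → A) : M :=
  St.dM (F a) - ε k r • ∑ i ∈ Finset.range p, F (seqDer R i a)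

theorem hochSum_eq (St : DGBimod k R M) (p : ℕ) (r : ℤ) (f : MCoch k A M p) {dg : ℕ → ℤ}
    {a : ℕ → A} (ha : ∀ i, a i ∈ R.gr (dg i)) :
    hochSum St p r (evSeq f) a =
      ε k ((p : ℤ) + r - 1 + r * dg 0) • St.actL (a 0) (f (fun i => a ((i : ℕ) + 1)))
      + ∑ i : Fin p, ε k ((p : ℤ) + r + (i : ℕ)) •
          f (fun j => if (j : ℕ) < (i : ℕ) then a (j : ℕ)
              else if (j : ℕ) = (i : ℕ) then a (i : ℕ) * a ((i : ℕ) + 1)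
              else a ((j : ℕ) + 1))
      + ε k r • St.actR (a p) (f (fun i => a (i : ℕ))) := by
  rw [hochSum, Finset.sum_range_succ, Finset.sum_range_succ', smul_add, smul_add,
    Finset.sum_range, Finset.smul_sum, add_comm (∑ i, _)]
  refine congrArg₂ _ (congrArg₂ _ ?_ (Finset.sum_congr rfl fun i _ => ?_)) ?_
  · simp only [coface, if_pos, pow_zero, sgn_apply r (ha 0), map_smul,
      LinearMap.smul_apply, smul_smul]
    congr 1
    simp [ε_add, ε_sub]
  · have : (i : ℕ) + 1 < p + 1 := by omega
    simp only [coface, this, if_true, Nat.add_eq_zero_iff, one_ne_zero, and_false, if_false,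
      smul_smul, Nat.add_sub_cancel]
    refine congrArg₂ _ ?_ rfl
    simp [ε_add, ε_natCast, pow_succ]
  · simp only [coface, Nat.add_eq_zero_iff, one_ne_zero, and_false, if_false, lt_irrefl, smul_smul]
    refine congrArg₂ _ ?_ rfl
    rw [ε_add, ε_natCast, pow_succ]
    have : ((-1 : k) ^ p) * (-1) ^ p = 1 := by rw [← ε_natCast, ε_mul_self]
    linear_combination (ε k r) * this

theorem evSeq_seqDer (f : MCoch k A M p) {dg : ℕ → ℤ}
    {a : ℕ → A} (ha : ∀ i, a i ∈ R.gr (dg i)) (i : Fin p) :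
    evSeq f (seqDer R i a) = ε k (∑ j ∈ Finset.range (i : ℕ), dg j) •
            f (fun j => if (j : ℕ) = (i : ℕ) then R.d (a (i : ℕ)) else a (j : ℕ)) := by
  have : seqDer R i a = fun j : ℕ => (if j < (i : ℕ) then ε k (dg j) else 1) •
      (if j = (i : ℕ) then R.d (a (i : ℕ)) else a j) := by
    funext j
    unfold seqDer
    split_ifs with h1 h2 h3
    · omega
    · exact parity_apply _ (ha j)
    · subst h3; simp
    · simp
  rw [this, evSeq_smul]
  congr 1
  obtain ⟨m, hm⟩ := i
  obtain ⟨t, rfl⟩ : ∃ t, p = m + t := ⟨p - m, by omega⟩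
  rw [Finset.prod_range_add]
  have h1 : ∏ x ∈ Finset.range t, (if m + x < m then ε k (dg (m + x)) else 1) = 1 :=
    Finset.prod_eq_one fun x _ => by simp
  rw [h1, mul_one]
  have h2 : ∀ l ≤ m, ∏ x ∈ Finset.range l, (if x < m then ε k (dg x) else 1)
      = ε k (∑ x ∈ Finset.range l, dg x) := by
    intro l
    induction l with
    | zero => simp
    | succ l ih =>
      intro hl
      rw [Finset.prod_range_succ, Finset.sum_range_succ, ih (by omega), ε_add,
        if_pos (by omega)]
  exact h2 m le_rfl

theorem intSum_eq (St : DGBimod k R M) (p : ℕ) (r : ℤ) (f : MCoch k A M p) {dg : ℕ → ℤ}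
    {a : ℕ → A} (ha : ∀ i, a i ∈ R.gr (dg i)) :
    intSum St p r (evSeq f) a =
      St.dM (f (fun i => a (i : ℕ)))
      - ε k r • ∑ i : Fin p,
          ε k (∑ j ∈ Finset.range (i : ℕ), dg j) •
            f (fun j => if (j : ℕ) = (i : ℕ) then R.d (a (i : ℕ)) else a (j : ℕ)) := by
  rw [intSum, Finset.sum_range]
  simp only [evSeq_seqDer f ha]

theorem IsIntDiffM.eq_intSum {St : DGBimod k R M}
    {pd : ∀ (p : ℕ) (r : ℤ), MCoch k A M p →ₗ[k] MCoch k A M p}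
    (h : IsIntDiffM k St pd) {p : ℕ} {r : ℤ} (f : MCoch k A M p) {dg : ℕ → ℤ}
    {a : ℕ → A} (ha : ∀ i, a i ∈ R.gr (dg i)) :
    evSeq (pd p r f) a = intSum St p r (evSeq f) a :=
  (h p r f dg a ha).trans (intSum_eq St p r f ha).symm

/-! ### Existence of the differentials -/

/-- The multilinear form of `seqFace`. -/
def faceMap (A M : Type) [Ring A] [Algebra k A] [AddCommGroup M] [Module k M] :
    (p : ℕ) → ℕ → MCoch k A M p →ₗ[k] MCoch k A M (p + 1)
  | 0, _ => 0
  | p + 1, 0 =>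
    (multilinearCurryLeftEquiv k (fun _ : Fin (p + 2) => A) M).symm.toLinearMap ∘ₗ
    (multilinearCurryLeftEquiv k (fun _ : Fin (p + 1) => A) M).symm.toLinearMap.compRight k ∘ₗ
    { toFun := fun f => (LinearMap.llcomp k A A (MCoch k A M p) f) ∘ₗ LinearMap.mul k A
      map_add' := fun f g => by ext; simp
      map_smul' := fun c f => by ext; simp } ∘ₗ
    (multilinearCurryLeftEquiv k (fun _ : Fin (p + 1) => A) M).toLinearMap
  | p + 1, i + 1 =>
    (multilinearCurryLeftEquiv k (fun _ : Fin (p + 2) => A) M).symm.toLinearMap ∘ₗ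
    (faceMap A M p i).compRight k ∘ₗ
    (multilinearCurryLeftEquiv k (fun _ : Fin (p + 1) => A) M).toLinearMap

theorem faceMap_apply (p i : ℕ) (hi : i < p) (f : MCoch k A M p) (a : ℕ → A) :
    evSeq (faceMap A M p i f) a = evSeq f (seqFace i a) := by
  induction p generalizing i a with
  | zero => omega
  | succ p ih =>
    cases i with
    | zero =>
      refine (?_ : _ = f _)
      simp only [faceMap, evSeq, LinearMap.comp_apply]
      refine (?_ : f (Fin.cons (a 0 * a 1) (fun j => a (j + 2))) = _)
      refine congrArg f (funext fun j => ?_)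
      refine Fin.cases ?_ (fun j => ?_) j
      · simp [seqFace]
      · simp [seqFace]
    | succ i =>
      have := ih i (by omega) (f.curryLeft (a 0)) (seqShift a)
      simp only [faceMap, evSeq, LinearMap.comp_apply]
      refine (this.trans (?_ : f (Fin.cons (a 0) _) = _))
      refine congrArg f (funext fun j => ?_)
      refine Fin.cases ?_ (fun j => ?_) j
      · simp [seqFace]
      · simp [seqFace, seqShift]

/-- The multilinear form of `seqDer`. -/
def derMap (R : DGAlgebra k A) (M : Type) [AddCommGroup M] [Module k M] (p i : ℕ) :
    MCoch k A M p →ₗ[k] MCoch k A M p :=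
  MultilinearMap.compLinearMapₗ (fun j : Fin p =>
    if (j : ℕ) < i then parity R.isInternal else if (j : ℕ) = i then R.d else LinearMap.id)

theorem derMap_apply (p i : ℕ) (f : MCoch k A M p) (a : ℕ → A) :
    evSeq (derMap R M p i f) a = evSeq f (seqDer R i a) := by
  refine congrArg f (funext fun j => ?_)
  simp only [seqDer]
  split_ifs <;> rfl

/-- The multilinear form of `coface`. -/
def cofaceMap (St : DGBimod k R M) (p : ℕ) (r : ℤ) (j : ℕ) :
    MCoch k A M p →ₗ[k] MCoch k A M (p + 1) :=
  if j = 0 then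
    (multilinearCurryLeftEquiv k (fun _ : Fin (p + 1) => A) M).symm.toLinearMap ∘ₗ
      { toFun := fun f => (postComp A M M p).flip f ∘ₗ
          St.actL ∘ₗ sgn R r
        map_add' := fun f g => by ext; simp
        map_smul' := fun c f => by ext; simp }
  else if j < p + 1 then faceMap A M p (j - 1)
  else (multilinearCurryRightEquiv k (fun _ : Fin (p + 1) => A) M).symm.toLinearMap ∘ₗ
      postComp A M (A →ₗ[k] M) p St.actR.flip

theorem cofaceMap_apply (St : DGBimod k R M) (p : ℕ) (r : ℤ) (j : ℕ) (f : MCoch k A M p)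
    (a : ℕ → A) : evSeq (cofaceMap St p r j f) a = coface St p r j (evSeq f) a := by
  unfold cofaceMap coface
  split_ifs with h1 h2
  · rfl
  · exact faceMap_apply _ _ (by omega) _ _
  · rfl

/-- The Hochschild differential with values in a dg bimodule. -/
def hochDiff (St : DGBimod k R M) (p : ℕ) (r : ℤ) : MCoch k A M p →ₗ[k] MCoch k A M (p + 1) :=
  (- ε k (p + r)) • ∑ j ∈ Finset.range (p + 2), (-1 : k) ^ j • cofaceMap St p r j

/-- The internal differential on cochains with values in a dg bimodule. -/
def intDiff (St : DGBimod k R M) (p : ℕ) (r : ℤ) : MCoch k A M p →ₗ[k] MCoch k A M p :=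
  postComp A M M p St.dM
    - ε k r • ∑ i ∈ Finset.range p, derMap R M p i

theorem isHochDiffM_hochDiff (St : DGBimod k R M) : IsHochDiffM k St (hochDiff St) := by
  intro p r f dg a ha
  rw [← hochSum_eq St p r f ha]
  simp only [hochDiff, hochSum, LinearMap.smul_apply, LinearMap.sum_apply,
    _root_.smul_apply, _root_.sum_apply]
  simp only [← cofaceMap_apply]

theorem isIntDiffM_intDiff (St : DGBimod k R M) : IsIntDiffM k St (intDiff St) := by
  intro p r f dg a ha
  rw [← intSum_eq St p r f ha]
  simp only [intDiff, intSum, LinearMap.smul_apply, LinearMap.sum_apply, LinearMap.sub_apply,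
    _root_.smul_apply, _root_.sum_apply, _root_.sub_apply]
  simp only [← derMap_apply]
  rfl

theorem IsHochDiffM.eq_hochDiff {St : DGBimod k R M}
    {dH : ∀ (p : ℕ) (r : ℤ), MCoch k A M p →ₗ[k] MCoch k A M (p + 1)}
    (h : IsHochDiffM k St dH) (p : ℕ) (r : ℤ) : dH p r = hochDiff St p r :=
  LinearMap.ext fun f => multilinear_ext_hom R.isInternal fun dg a ha =>
    (h p r f dg a ha).trans (isHochDiffM_hochDiff St p r f dg a ha).symm

theorem IsIntDiffM.eq_intDiff {St : DGBimod k R M}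
    {pd : ∀ (p : ℕ) (r : ℤ), MCoch k A M p →ₗ[k] MCoch k A M p}
    (h : IsIntDiffM k St pd) (p : ℕ) (r : ℤ) : pd p r = intDiff St p r :=
  LinearMap.ext fun f => multilinear_ext_hom R.isInternal fun dg a ha =>
    (h p r f dg a ha).trans (isIntDiffM_intDiff St p r f dg a ha).symm

end Sequences

section CochainComplexes

variable {k}

/-! ### The identities between the differentials -/

theorem sum_alternating_eq_zero {W : Type} [AddCommGroup W] [Module k W] (n : ℕ)
    (T : ℕ → ℕ → W) (h : ∀ i j, i < j → j ≤ n + 1 → T j i = T i (j - 1)) :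
    ∑ j ∈ Finset.range (n + 2), ∑ i ∈ Finset.range (n + 1), (-1 : k) ^ (j + i) • T j i = 0 := by
  rw [← Finset.sum_product']
  refine Finset.sum_involution
    (fun x _ => if x.2 < x.1 then (x.2, x.1 - 1) else (x.2 + 1, x.1)) ?_ ?_ ?_ ?_
  · rintro ⟨j, i⟩ hx
    simp only [Finset.mem_product, Finset.mem_range] at hx
    dsimp only
    split_ifs with hij
    · dsimp only
      rw [h i j hij (by omega), ← add_smul]
      obtain ⟨m, rfl⟩ : ∃ m, j = m + 1 := ⟨j - 1, by omega⟩
      rw [show m + 1 + i = i + (m + 1 - 1) + 1 by omega, pow_succ]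
      simp
    · dsimp only
      rw [h j (i + 1) (by omega) (by omega), Nat.add_sub_cancel, ← add_smul]
      rw [show i + 1 + j = j + i + 1 by omega, pow_succ]
      simp
  · rintro ⟨j, i⟩ hx - h2
    dsimp only at h2
    split_ifs at h2 with hij <;> simp only [Prod.mk.injEq] at h2 <;> omega
  · rintro ⟨j, i⟩ hx
    simp only [Finset.mem_product, Finset.mem_range] at hx ⊢
    split_ifs with hij <;> dsimp only <;> omega
  · rintro ⟨j, i⟩ hx
    dsimp only
    by_cases hij : i < j
    · have h1 : ¬ (j - 1 < i) := by omega
      simp only [hij, if_true, h1, if_false, Prod.mk.injEq]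
      exact ⟨by omega, trivial⟩
    · have h1 : j < i + 1 := by omega
      simp only [hij, if_true, h1, if_false, Prod.mk.injEq]
      exact ⟨trivial, by omega⟩

theorem sum_antisymm_eq_zero {W : Type} [AddCommGroup W] (n : ℕ) (T : ℕ → ℕ → W)
    (h : ∀ i j, i < n → j < n → i ≠ j → T i j + T j i = 0) (h' : ∀ i < n, T i i = 0) :
    ∑ i ∈ Finset.range n, ∑ j ∈ Finset.range n, T i j = 0 := by
  rw [← Finset.sum_product']
  refine Finset.sum_involution (fun x _ => (x.2, x.1)) ?_ ?_ ?_ ?_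
  · rintro ⟨i, j⟩ hx
    simp only [Finset.mem_product, Finset.mem_range] at hx
    by_cases hij : i = j
    · subst hij; simp [h' i hx.1]
    · exact h i j hx.1 hx.2 hij
  · rintro ⟨i, j⟩ hx h1 h2
    simp only [Finset.mem_product, Finset.mem_range] at hx
    simp only [Prod.mk.injEq] at h2
    exact h1 (by rw [h2.1]; exact h' i hx.1)
  · rintro ⟨i, j⟩ hx
    simpa [and_comm] using hx
  · rintro ⟨i, j⟩ hx; rfl

theorem evSeq_ext {p : ℕ} {f g : MCoch k A M p} (R : DGAlgebra k A)
    (h : ∀ (dg : ℕ → ℤ) (a : ℕ → A), (∀ i, a i ∈ R.gr (dg i)) → evSeq f a = evSeq g a) : f = g :=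
  multilinear_ext_hom R.isInternal h

theorem cofaceMap_comm (St : DGBimod k R M) (p : ℕ) (r : ℤ) (f : MCoch k A M p) (i j : ℕ)
    (hij : i < j) (hj : j ≤ p + 2) :
    cofaceMap St (p + 1) r j (cofaceMap St p r i f)
      = cofaceMap St (p + 1) r i (cofaceMap St p r (j - 1) f) := by
  refine evSeq_ext R fun dg a ha => ?_
  have e : ∀ l, evSeq (cofaceMap St p r l f) = coface St p r l (evSeq f) :=
    fun l => funext fun a => cofaceMap_apply St p r l f a
  rw [cofaceMap_apply, cofaceMap_apply, e, e]
  obtain ⟨m, rfl⟩ : ∃ m, j = m + 1 := ⟨j - 1, by omega⟩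
  simp only [Nat.add_sub_cancel]
  rcases Nat.eq_zero_or_pos i with rfl | hi
  · rcases Nat.eq_zero_or_pos m with rfl | hm
    · simp [coface, seqFace, sgn_mul r (ha 0) (ha 1), St.actL_mul]
      rfl
    · by_cases hmp : m < p + 1
      · have h1 : m ≠ 0 := by omega
        simp only [coface, Nat.add_eq_zero_iff, one_ne_zero, and_false, if_false, if_true,
          Nat.add_sub_cancel, hmp, h1, Nat.add_lt_add_iff_right]
        have h2 : seqFace m a 0 = a 0 := by simp [seqFace, hm]
        have h3 : seqShift (seqFace m a) = seqFace (m - 1) (seqShift a) := by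
          funext l
          simp only [seqShift, seqFace]
          grind
        rw [h2, h3]
      · have h1 : m ≠ 0 := by omega
        obtain rfl : m = p + 1 := by omega
        simp [coface, St.actLR]
        rfl
  · have hi' : i ≠ 0 := by omega
    by_cases hmp : m < p + 1
    · have h1 : m ≠ 0 := by omega
      have h2 : i < p + 1 + 1 := by omega
      have h3 : i < p + 1 := by omega
      simp only [coface, Nat.add_eq_zero_iff, one_ne_zero, and_false, if_false, if_true,
          Nat.add_sub_cancel, hmp, h1, h2, h3, hi', Nat.add_lt_add_iff_right]
      congr 1
      funext l
      simp only [seqFace]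
      grind [mul_assoc]
    · obtain rfl : m = p + 1 := by omega
      by_cases hip : i < p + 1
      · have h2 : i < p + 1 + 1 := by omega
        have h3 : seqFace (i - 1) a p = a (p + 1) := by
          simp only [seqFace]; grind
        simp [coface, hi', hip, h2, h3]
      · obtain rfl : i = p + 1 := by omega
        have h3 : seqFace p a p = a p * a (p + 1) := by simp [seqFace]
        have h4 : evSeq f (seqFace p a) = evSeq f a :=
          evSeq_congr f fun l hl => by simp [seqFace, hl]
        simp only [coface, Nat.add_eq_zero_iff, one_ne_zero, and_false, if_false, if_true,
          Nat.add_sub_cancel, lt_irrefl, Nat.lt_succ_self, h3, h4, St.actR_mul]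

theorem hochDiff_hochDiff (St : DGBimod k R M) (p : ℕ) (r : ℤ) (f : MCoch k A M p) :
    hochDiff St (p + 1) r (hochDiff St p r f) = 0 := by
  simp only [hochDiff, LinearMap.smul_apply, LinearMap.sum_apply, map_smul, map_sum,
    Finset.smul_sum, smul_smul]
  have := sum_alternating_eq_zero (k := k) (p + 1)
    (fun j i => cofaceMap St (p + 1) r j (cofaceMap St p r i f))
    (fun i j hij hj => cofaceMap_comm St p r f i j hij hj)
  have h2 := congrArg (fun x => (- ε k ((p + 1 : ℕ) + r) * - ε k (p + r)) • x) this
  simp only [smul_zero, Finset.smul_sum, smul_smul] at h2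
  refine Eq.trans ?_ h2
  rw [Finset.sum_comm]
  refine Finset.sum_congr rfl fun j _ => Finset.sum_congr rfl fun i _ => ?_
  congr 1
  rw [pow_add]; ring

theorem evSeq_seqDer_seqDer {p : ℕ} (f : MCoch k A M p) {dg : ℕ → ℤ} {a : ℕ → A}
    (ha : ∀ i, a i ∈ R.gr (dg i)) {i j : ℕ} (hij : i < j) (hj : j < p) :
    evSeq f (seqDer R j (seqDer R i a)) + evSeq f (seqDer R i (seqDer R j a)) = 0 := by
  have h0 : evSeq f (fun l => if l = i then 0 else seqDer R j (seqDer R i a) l) = 0 :=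
    evSeq_single_eq_zero f (i := i) (by omega) (by simp)
  rw [← h0]
  refine (evSeq_single_add f (i := i) (by omega) ?_ ?_ ?_).symm
  · simp only [seqDer, hij, lt_irrefl, if_true, if_false]
    rw [d_parity (ha i)]; simp
  · intro l hl
    simp only [seqDer]
    grind
  · intro l hl
    simp [hl]

theorem intDiff_intDiff (St : DGBimod k R M) (p : ℕ) (r : ℤ) (f : MCoch k A M p) :
    intDiff St p (r + 1) (intDiff St p r f) = 0 := by
  refine evSeq_ext R fun dg a ha => ?_
  have key : ∑ i ∈ Finset.range p, ∑ j ∈ Finset.range p, evSeq f (seqDer R j (seqDer R i a))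
      = 0 := by
    refine sum_antisymm_eq_zero p _ (fun i j hi hj hij => ?_) (fun i hi => ?_)
    · rcases lt_or_gt_of_ne hij with h | h
      · exact evSeq_seqDer_seqDer f ha h hj
      · rw [add_comm]; exact evSeq_seqDer_seqDer f ha h hi
    · exact evSeq_single_eq_zero f hi (by simp [seqDer, R.d_sq])
  have e : ∀ (s : ℤ) (g : MCoch k A M p) (dg : ℕ → ℤ) (a : ℕ → A), (∀ i, a i ∈ R.gr (dg i)) →
      evSeq (intDiff St p s g) a = intSum St p s (evSeq g) a :=
    fun s g dg a ha => (isIntDiffM_intDiff St).eq_intSum g ha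
  rw [e _ _ _ _ ha]
  have e2 : ∀ i, evSeq (intDiff St p r f) (seqDer R i a) = intSum St p r (evSeq f) (seqDer R i a) :=
    fun i => e _ _ _ _ (seqDer_mem ha i)
  simp only [intSum, e2, e _ _ _ _ ha] 
  simp only [Finset.sum_sub_distrib, ← Finset.smul_sum, key, map_sub, map_smul, map_sum,
    St.dM_sq, ε_add, ε_one]
  simp

theorem evSeq_parity {p : ℕ} (f : MCoch k A M p) {dg : ℕ → ℤ} {a : ℕ → A}
    (ha : ∀ i, a i ∈ R.gr (dg i)) :
    evSeq f (fun i => parity R.isInternal (a i)) = ε k (∑ i : Fin p, dg i) • evSeq f a := by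
  have : (fun i => parity R.isInternal (a i)) = fun i => ε k (dg i) • a i :=
    funext fun i => KD.parity_apply _ (ha i)
  rw [this, evSeq_smul]
  congr 1
  rw [← Finset.sum_range (fun i => dg i)]
  clear * -
  induction p with
  | zero => simp
  | succ p ih => rw [Finset.prod_range_succ, Finset.sum_range_succ, ih, ε_add]

theorem cofaceMap_intDiff (St : DGBimod k R M) (p : ℕ) (r : ℤ) (f : MCoch k A M p)
    (hf : IsHomogM k St p r f) (j : ℕ) (hj : j ≤ p + 1) :
    cofaceMap St p (r + 1) j (intDiff St p r f) = intDiff St (p + 1) r (cofaceMap St p r j f) := by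
  refine evSeq_ext R fun dg a ha => ?_
  have e : ∀ l, evSeq (cofaceMap St p r l f) = coface St p r l (evSeq f) :=
    fun l => funext fun a => cofaceMap_apply St p r l f a
  have e' : ∀ (dg : ℕ → ℤ) (a : ℕ → A), (∀ i, a i ∈ R.gr (dg i)) →
      evSeq (intDiff St p r f) a = intSum St p r (evSeq f) a :=
    fun dg a ha => (isIntDiffM_intDiff St).eq_intSum f ha
  rw [cofaceMap_apply, (isIntDiffM_intDiff St).eq_intSum _ ha, e, intSum]
  rcases Nat.eq_zero_or_pos j with rfl | hj0
  · have h1 := e' _ (seqShift a) (fun i => ha (i + 1))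
    simp only [coface, if_true]
    rw [h1, intSum, Finset.sum_range_succ']
    have h2 : ∀ i, seqShift (seqDer R (i + 1) a) = seqDer R i (seqShift a) := by
      intro i; funext l
      simp [seqShift, seqDer]
    have h3 : ∀ i, seqDer R (i + 1) a 0 = parity R.isInternal (a 0) := by
      intro i; simp [seqDer]
    have h4 : seqShift (seqDer R 0 a) = seqShift a := by
      funext l; simp [seqShift, seqDer]
    have h5 : seqDer R 0 a 0 = R.d (a 0) := by simp [seqDer]
    have h6 : sgn R r (a 0) ∈ R.gr (dg 0) := by
      rw [sgn_apply r (ha 0)]; exact Submodule.smul_mem _ _ (ha 0)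
    simp only [h2, h3, h4, h5, sgn_parity r (ha 0)]
    rw [St.dM_actL _ _ h6, d_sgn r (ha 0)]
    have h7 : sgn R (r + 1) (a 0) = ε k (dg 0) • sgn R r (a 0) := by
      rw [sgn_apply _ (ha 0), sgn_apply _ (ha 0), smul_smul, ← ε_add]; congr 2; ring
    simp only [h7, map_sub, map_sum, map_smul, LinearMap.smul_apply, smul_add,
      ← Finset.smul_sum]
    abel
  · obtain ⟨j, rfl⟩ : ∃ m, j = m + 1 := ⟨j - 1, by omega⟩
    by_cases hjp : j < p
    · simp only [coface, Nat.add_eq_zero_iff, one_ne_zero, and_false, if_false, if_true,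
        Nat.add_lt_add_iff_right, hjp, Nat.add_sub_cancel]
      rw [e' _ _ (seqFace_mem ha j), intSum]
      congr 2
      obtain ⟨t, rfl⟩ : ∃ t, p = j + 1 + t := ⟨p - (j + 1), by omega⟩
      rw [show j + 1 + t + 1 = (j + 1 + 1) + t by omega, Finset.sum_range_add,
        Finset.sum_range_add _ (j + 1 + 1), Finset.sum_range_succ, Finset.sum_range_succ _ (j + 1),
        Finset.sum_range_succ _ j]
      have h1 : ∀ i < j, seqDer R i (seqFace j a) = seqFace j (seqDer R i a) := by
        intro i hi; funext l
        simp only [seqDer, seqFace]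
        grind
      have h2 : ∀ i, seqDer R (j + 1 + i) (seqFace j a) =
          seqFace j (seqDer R (j + 1 + 1 + i) a) := by
        intro i; funext l
        simp only [seqDer, seqFace]
        have := parity_mul (ha j) (ha (j + 1))
        grind
      have h3 : evSeq f (seqDer R j (seqFace j a)) = evSeq f (seqFace j (seqDer R j a))
          + evSeq f (seqFace j (seqDer R (j + 1) a)) := by
        refine evSeq_single_add f hjp ?_ ?_ ?_
        · simp [seqDer, seqFace, R.d_leibniz _ _ (ha j), KD.parity_apply _ (ha j)]
        · intro l hl
          simp only [seqDer, seqFace]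
          grind
        · intro l hl
          simp only [seqDer, seqFace]
          grind
      rw [h3, Finset.sum_congr rfl fun i hi => by rw [h1 i (Finset.mem_range.mp hi)]]
      simp only [h2]
      abel
    · obtain rfl : j = p := by omega
      simp only [coface, Nat.add_eq_zero_iff, one_ne_zero, and_false, if_false, lt_irrefl]
      rw [e' _ _ ha, intSum, Finset.sum_range_succ]
      have h1 : ∀ i < j, seqDer R i a j = a j := by
        intro i hi; simp only [seqDer]; grind
      have h2 : seqDer R j a j = R.d (a j) := by simp [seqDer]
      have h3 : evSeq f (seqDer R j a) = evSeq f (fun i => parity R.isInternal (a i)) :=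
        evSeq_congr f fun i hi => by simp [seqDer, hi]
      rw [St.dM_actR _ _ (hf dg a ha), h2, h3, evSeq_parity f ha]
      have h4 : ∑ x ∈ Finset.range j, (St.actR (seqDer R x a j)) (evSeq f (seqDer R x a))
          = St.actR (a j) (∑ x ∈ Finset.range j, evSeq f (seqDer R x a)) := by
        rw [map_sum]
        exact Finset.sum_congr rfl fun i hi => by rw [h1 i (Finset.mem_range.mp hi)]
      simp only [h4, ε_add, map_sub, map_smul, smul_add, smul_smul]
      rw [mul_comm (ε k r)]
      abel

theorem hochDiff_intDiff (St : DGBimod k R M) (p : ℕ) (r : ℤ) (f : MCoch k A M p)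
    (hf : IsHomogM k St p r f) :
    hochDiff St p (r + 1) (intDiff St p r f) + intDiff St (p + 1) r (hochDiff St p r f) = 0 := by
  simp only [hochDiff, LinearMap.smul_apply, LinearMap.sum_apply, map_smul, map_sum]
  rw [Finset.sum_congr rfl fun j hj => by
    rw [cofaceMap_intDiff St p r f hf j (by have := Finset.mem_range.mp hj; omega)],
    ← add_smul, ← add_assoc, ε_add k _ 1]
  simp

theorem IsHomogM.hochDiff {St : DGBimod k R M} {p : ℕ} {r : ℤ} {f : MCoch k A M p}
    (hf : IsHomogM k St p r f) : IsHomogM k St (p + 1) r (hochDiff St p r f) := by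
  intro dg a ha
  rw [isHochDiffM_hochDiff St p r f dg a ha]
  refine Submodule.add_mem _ (Submodule.add_mem _ ?_ ?_) ?_
  · refine Submodule.smul_mem _ _ ?_
    have := St.actL_mem (ha 0) (hf (fun i => dg (i + 1)) (fun i => a (i + 1)) (fun i => ha _))
    rw [Fin.sum_univ_succ]
    convert this using 2
    simp [add_assoc]
  · refine Submodule.sum_mem _ fun i _ => Submodule.smul_mem _ _ ?_
    have := hf (degFace i dg) (seqFace i a) (seqFace_mem ha i)
    convert this using 2
    swap
    · rfl
    congr 1
    rw [← Finset.sum_range (fun i => dg i), ← Finset.sum_range (fun j => degFace i dg j)]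
    obtain ⟨i, hi⟩ := i
    obtain ⟨t, rfl⟩ : ∃ t, p = i + 1 + t := ⟨p - (i + 1), by omega⟩
    rw [show i + 1 + t + 1 = (i + 1 + 1) + t by omega, Finset.sum_range_add _ (i + 1 + 1),
        Finset.sum_range_add _ (i + 1) t, Finset.sum_range_succ _ (i + 1),
        Finset.sum_range_succ _ i, Finset.sum_range_succ _ i]
    have h1 : ∑ x ∈ Finset.range i, degFace i dg x = ∑ x ∈ Finset.range i, dg x :=
      Finset.sum_congr rfl fun x hx => by simp [degFace, Finset.mem_range.mp hx]
    have h2 : ∀ x, degFace i dg (i + 1 + x) = dg (i + 1 + 1 + x) := by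
      intro x
      simp only [degFace]
      rw [if_neg (by omega), if_neg (by omega)]; congr 1; omega
    simp only [h1, h2]
    simp [degFace]; ring
  · refine Submodule.smul_mem _ _ ?_
    have := St.actR_mem (ha p) (hf dg a ha)
    rw [Fin.sum_univ_castSucc]
    convert this using 2
    simp; ring

theorem IsHomogM.intDiff {St : DGBimod k R M} {p : ℕ} {r : ℤ} {f : MCoch k A M p}
    (hf : IsHomogM k St p r f) : IsHomogM k St p (r + 1) (intDiff St p r f) := by
  intro dg a ha
  change evSeq (KD.intDiff St p r f) a ∈ _
  rw [(isIntDiffM_intDiff St).eq_intSum f ha, intSum, ← add_assoc]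
  refine Submodule.sub_mem _ (St.dM_mem (hf dg a ha)) (Submodule.smul_mem _ _
    (Submodule.sum_mem _ fun i hi => ?_))
  have := hf (degDer i dg) (seqDer R i a) (seqDer_mem ha i)
  convert this using 2
  rw [add_right_comm]
  congr 1
  have hi := Finset.mem_range.mp hi
  rw [← Finset.sum_range (fun i => dg i), ← Finset.sum_range (fun j => degDer i dg j)]
  have : ∀ j, degDer i dg j = dg j + if j = i then 1 else 0 := by
    intro j; unfold degDer; split_ifs <;> simp
  simp [this, Finset.sum_add_distrib, hi]

end CochainComplexes

section Total

variable {k}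

/-! ### Complexes and quasi-isomorphisms -/

section Complexes

variable {V W U : Type} [AddCommGroup V] [Module k V] [AddCommGroup W] [Module k W]
  [AddCommGroup U] [Module k U]

/-- The subspaces `K n` of `V` form a cochain complex with differentials `D n`. -/
structure IsCpx (K : ℤ → Submodule k V) (D : ℤ → V →ₗ[k] V) : Prop where
  map : ∀ {n m : ℤ} {c : V}, n + 1 = m → c ∈ K n → D n c ∈ K m
  sq : ∀ {n m : ℤ} {c : V}, n + 1 = m → c ∈ K n → D m (D n c) = 0

/-- The maps `F n` induce bijections on cohomology. -/
structure IsQIso (K : ℤ → Submodule k V) (D : ℤ → V →ₗ[k] V) (K' : ℤ → Submodule k W)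
    (D' : ℤ → W →ₗ[k] W) (F : ℤ → V →ₗ[k] W) : Prop where
  surj : ∀ {n m : ℤ} {y : W}, m + 1 = n → y ∈ K' n → D' n y = 0 →
    ∃ x ∈ K n, D n x = 0 ∧ ∃ z ∈ K' m, F n x - y = D' m z
  inj : ∀ {n m : ℤ} {x : V}, m + 1 = n → x ∈ K n → D n x = 0 → (∃ z ∈ K' m, F n x = D' m z) →
    ∃ w ∈ K m, x = D m w

/-- The maps `F n` form a morphism of complexes. -/
structure IsCpxHom (K : ℤ → Submodule k V) (D : ℤ → V →ₗ[k] V) (K' : ℤ → Submodule k W)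
    (D' : ℤ → W →ₗ[k] W) (F : V →ₗ[k] W) : Prop where
  map : ∀ {n : ℤ} {c : V}, c ∈ K n → F c ∈ K' n
  comm : ∀ {n : ℤ} {c : V}, c ∈ K n → D' n (F c) = F (D n c)

theorem IsQIso.of_rightInverse {K : ℤ → Submodule k V} {D : ℤ → V →ₗ[k] V}
    {K' : ℤ → Submodule k W} {D' : ℤ → W →ₗ[k] W} {F : V →ₗ[k] W} {G : W →ₗ[k] V}
    (hF : IsCpxHom K D K' D' F) (hG : IsCpxHom K' D' K D G) (h : ∀ w, F (G w) = w)
    (hq : IsQIso K' D' K D (fun _ => G)) : IsQIso K D K' D' (fun _ => F) where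
  surj := fun {n m y} hm hy hDy => ⟨G y, hG.map hy, by rw [hG.comm hy, hDy, map_zero], 0,
    Submodule.zero_mem _, by simp [h]⟩
  inj := by
    rintro n m x hm hx hDx ⟨z, hz, hFx⟩
    obtain ⟨y, hy, hDy, w, hw, e⟩ := hq.surj hm hx hDx
    refine ⟨G (z + F w) - w, Submodule.sub_mem _ (hG.map (Submodule.add_mem _ hz (hF.map hw))) hw,
      ?_⟩
    have e1 : y = F x + F (D m w) := by
      rw [← map_add, ← e]; simp [h]
    rw [map_sub, hG.comm (Submodule.add_mem _ hz (hF.map hw)), map_add, hF.comm hw]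
    rw [← hFx, ← e1, ← e]
    abel

theorem IsQIso.of_leftInverse {K : ℤ → Submodule k V} {D : ℤ → V →ₗ[k] V}
    {K' : ℤ → Submodule k W} {D' : ℤ → W →ₗ[k] W} {F : V →ₗ[k] W} {G : W →ₗ[k] V}
    (hF : IsCpxHom K D K' D' F) (hG : IsCpxHom K' D' K D G) (h : ∀ v, G (F v) = v)
    (hq : IsQIso K' D' K D (fun _ => G)) : IsQIso K D K' D' (fun _ => F) where
  surj := by
    intro n m y hm hy hDy
    have h1 : D n (G y) = 0 := by rw [hG.comm hy, hDy, map_zero]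
    refine ⟨G y, hG.map hy, h1, ?_⟩
    refine hq.inj hm (Submodule.sub_mem _ (hF.map (hG.map hy)) hy) ?_ ⟨0, Submodule.zero_mem _, ?_⟩
    · rw [map_sub, hF.comm (hG.map hy), h1, hDy]; simp
    · simp [h]
  inj := by
    rintro n m x hm hx hDx ⟨z, hz, hFx⟩
    exact ⟨G z, hG.map hz, by rw [hG.comm hz, ← hFx, h]⟩

theorem pow_apply_eq {G : Module.End k V} {e x : V} (h : e = -G e) (h0 : e = x) (j : ℕ) :
    e = (-1 : k) ^ j • (G ^ j) x := by
  induction j with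
  | zero => simpa using h0
  | succ j ih =>
    rw [pow_succ', pow_succ', Module.End.mul_apply]
    calc e = -G e := h
      _ = -G ((-1 : k) ^ j • (G ^ j) x) := by rw [← ih]
      _ = _ := by rw [map_smul]; simp

/-- A filtered contraction whose perturbation series terminates contracts the total complex. -/
theorem acyclic_of_nilpotent {K : ℤ → Submodule k V} {D : ℤ → V →ₗ[k] V} (hD : IsCpx K D)
    (P Q : ℤ → V →ₗ[k] V) (H : V →ₗ[k] V) (hPQ : ∀ n c, D n c = P n c + Q n c)
    (hP : ∀ {n m c}, n + 1 = m → c ∈ K n → P n c ∈ K m)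
    (hP2 : ∀ {n m} (c), n + 1 = m → P m (P n c) = 0)
    (hQ : ∀ {n m c}, n + 1 = m → c ∈ K n → Q n c ∈ K m)
    (hH : ∀ {n m c}, m + 1 = n → c ∈ K n → H c ∈ K m)
    (hHP : ∀ {n m} (c), m + 1 = n → P m (H c) + H (P n c) = c)
    (hnil : ∀ {n m c}, m + 1 = n → c ∈ K n →
      ∃ N : ℕ, ∀ j > N, ((H ∘ₗ Q m : Module.End k V) ^ j) (H c) = 0)
    {n m : ℤ} {c : V} (hm : m + 1 = n) (hc : c ∈ K n) (hDc : D n c = 0) :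
    ∃ b ∈ K m, c = D m b := by
  obtain ⟨N, hN⟩ := hnil hm hc
  set G : Module.End k V := H ∘ₗ Q m with hG
  have hGK : ∀ x ∈ K m, G x ∈ K m := fun x hx => hH hm (hQ hm hx)
  have hpow : ∀ (j : ℕ) (x : V), x ∈ K m → ((-G) ^ j) x ∈ K m := by
    intro j
    induction j with
    | zero => intro x hx; simpa using hx
    | succ j ih =>
      intro x hx
      rw [pow_succ, Module.End.mul_apply]
      exact ih _ (Submodule.neg_mem _ (hGK x hx))
  set b : V := (∑ i ∈ Finset.range (N + 1), (-G) ^ i) (H c) with hb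
  have hbK : b ∈ K m := by
    rw [hb, LinearMap.sum_apply]
    exact Submodule.sum_mem _ fun i _ => hpow i _ (hH hm hc)
  have hbG : b + G b = H c := by
    have := congrArg (fun T : Module.End k V => T (H c)) (mul_neg_geom_sum (-G) (N + 1))
    simp only [sub_neg_eq_add, Module.End.mul_apply, LinearMap.add_apply, Module.End.one_apply,
      LinearMap.sub_apply] at this
    rw [← hb] at this
    rw [this, neg_pow, Module.End.mul_apply, hN _ (Nat.lt_succ_self N)]
    simp
  set c' := c - Q m b with hc'
  have hbc' : b = H c' := by rw [hc', map_sub, ← hbG, hG]; simp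
  set e := c - D m b with he
  have heK : e ∈ K n := Submodule.sub_mem _ hc (hD.map hm hbK)
  have heH : e = H (P n c') := by
    have := hHP c' hm
    rw [← hbc'] at this
    rw [he, hPQ, sub_add_eq_sub_sub_swap, ← hc']
    exact sub_eq_of_eq_add' this.symm
  have hc'K : c' ∈ K n := Submodule.sub_mem _ hc (hQ hm hbK)
  have hPe : P n e = P n c' := by
    have := hHP (n := n + 1) (m := n) (P n c') rfl
    rw [hP2 _ rfl, map_zero, add_zero] at this
    rw [heH, this]
  have hDe : P n e + Q n e = 0 := by
    rw [← hPQ, he, map_sub, hDc, hD.sq hm hbK, sub_zero]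
  have heG : e = -(H ∘ₗ Q n : Module.End k V) e := by
    rw [LinearMap.comp_apply, eq_neg_of_add_eq_zero_right hDe, map_neg, neg_neg, hPe]
    exact heH
  obtain ⟨N', hN'⟩ := hnil (n := n + 1) (m := n) rfl (hP rfl hc'K)
  have : e = 0 := by
    rw [pow_apply_eq heG heH (N' + 1), hN' _ (Nat.lt_succ_self _), smul_zero]
  exact ⟨b, hbK, sub_eq_zero.mp this⟩

end Complexes

/-! ### The sum Hochschild complex of a dg bimodule -/

/-- Cochains of bidegree `(p, r)`. -/
def homogM (St : DGBimod k R M) (p : ℕ) (r : ℤ) : Submodule k (MCoch k A M p) where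
  carrier := {f | IsHomogM k St p r f}
  add_mem' := fun hf hg dg a ha => Submodule.add_mem _ (hf dg a ha) (hg dg a ha)
  zero_mem' := fun dg a ha => Submodule.zero_mem _
  smul_mem' := fun c f hf dg a ha => Submodule.smul_mem _ c (hf dg a ha)

/-- Elements of total degree `n` of the sum Hochschild complex. -/
def totK (St : DGBimod k R M) (n : ℤ) : Submodule k (TotMCoch k A M) where
  carrier := {c | TotHomogM k St n c ∧ TotFinSuppM k c}
  add_mem' := by
    rintro c c' ⟨h, N, hN⟩ ⟨h', N', hN'⟩
    refine ⟨fun p => (homogM St p (n - p)).add_mem (h p) (h' p), N + N', fun p hp => ?_⟩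
    rw [Pi.add_apply, hN p (by omega), hN' p (by omega), add_zero]
  zero_mem' := ⟨fun p => (homogM St p (n - p)).zero_mem, 0, fun p _ => rfl⟩
  smul_mem' := by
    rintro x c ⟨h, N, hN⟩
    refine ⟨fun p => (homogM St p (n - p)).smul_mem x (h p), N, fun p hp => ?_⟩
    rw [Pi.smul_apply, hN p hp, smul_zero]

/-- The internal part of the total differential. -/
def totInt (St : DGBimod k R M) (n : ℤ) : TotMCoch k A M →ₗ[k] TotMCoch k A M :=
  LinearMap.pi fun p => intDiff St p (n - p) ∘ₗ LinearMap.proj p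

/-- The Hochschild part of the total differential. -/
def totHoch (St : DGBimod k R M) (n : ℤ) : TotMCoch k A M →ₗ[k] TotMCoch k A M :=
  LinearMap.pi fun p => match p with
    | 0 => 0
    | q + 1 => hochDiff St q (n - q) ∘ₗ LinearMap.proj q

theorem totHoch_succ (St : DGBimod k R M) (n : ℤ) (c : TotMCoch k A M) (q : ℕ) :
    totHoch St n c (q + 1) = hochDiff St q (n - q) (c q) := rfl

/-- The total differential. -/
def totDiff (St : DGBimod k R M) (n : ℤ) : TotMCoch k A M →ₗ[k] TotMCoch k A M :=
  totInt St n + totHoch St n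

theorem totDiff_eq (St : DGBimod k R M) (n : ℤ) (c : TotMCoch k A M) :
    totDiff St n c = TotDM k (hochDiff St) (intDiff St) n c := by
  funext p
  cases p with
  | zero => simp [totDiff, totInt, totHoch, TotDM]
  | succ q =>
    simp only [totDiff, totInt, totHoch, TotDM, LinearMap.add_apply, Pi.add_apply,
      LinearMap.pi_apply, LinearMap.comp_apply, LinearMap.proj_apply]
    push_cast
    rfl

theorem IsHomogM.congr {St : DGBimod k R M} {p : ℕ} {r r' : ℤ} {f : MCoch k A M p}
    (hf : IsHomogM k St p r f) (h : r = r') : IsHomogM k St p r' f := h ▸ hf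

theorem totInt_mem (St : DGBimod k R M) {n m : ℤ} (hm : n + 1 = m) {c : TotMCoch k A M}
    (hc : c ∈ totK St n) : totInt St n c ∈ totK St m := by
  obtain ⟨h, N, hN⟩ := hc
  refine ⟨fun p => (h p).intDiff.congr (by omega), N, fun p hp => ?_⟩
  simp [totInt, hN p hp]

theorem totHoch_mem (St : DGBimod k R M) {n m : ℤ} (hm : n + 1 = m) {c : TotMCoch k A M}
    (hc : c ∈ totK St n) : totHoch St n c ∈ totK St m := by
  obtain ⟨h, N, hN⟩ := hc
  refine ⟨fun p => ?_, N + 1, fun p hp => ?_⟩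
  · cases p with
    | zero => exact (homogM St 0 _).zero_mem
    | succ q => exact (h q).hochDiff.congr (by push_cast; omega)
  · obtain ⟨q, rfl⟩ : ∃ q, p = q + 1 := ⟨p - 1, by omega⟩
    simp [totHoch, hN q (by omega)]

theorem totInt_totInt (St : DGBimod k R M) {n m : ℤ} (hm : n + 1 = m) (c : TotMCoch k A M) :
    totInt St m (totInt St n c) = 0 := by
  funext p
  have := intDiff_intDiff St p (n - p) (c p)
  rwa [show n - p + 1 = m - p by omega] at this

theorem isCpx_totDiff (St : DGBimod k R M) : IsCpx (totK St) (totDiff St) where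
  map := fun hm hc => Submodule.add_mem _ (totInt_mem St hm hc) (totHoch_mem St hm hc)
  sq := by
    intro n m c hm hc
    simp only [totDiff, LinearMap.add_apply, map_add, totInt_totInt St hm, zero_add]
    funext p
    cases p with
    | zero => simp [totInt, totHoch]
    | succ p =>
      have h1 := hochDiff_intDiff St p (n - p) (c p) (hc.1 p)
      have h2 : totHoch St m (totHoch St n c) (p + 1) = 0 := by
        cases p with
        | zero => simp [totHoch]
        | succ q =>
          rw [totHoch_succ, show m - (q + 1 : ℕ) = n - q by push_cast; omega]
          exact hochDiff_hochDiff St q (n - q) (c q)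
      rw [show n - p + 1 = m - p by omega] at h1
      rw [Pi.add_apply, Pi.add_apply, h2, add_zero]
      refine Eq.trans (congrArg₂ (· + ·) rfl ?_) h1
      change intDiff St (p + 1) (m - (p + 1 : ℕ)) (hochDiff St p (n - p) (c p)) = _
      rw [show m - (p + 1 : ℕ) = n - p by push_cast; omega]

/-! ### Pointwise nilpotent coefficients -/

/-- Composition with a linear map of coefficients. -/
def totPost (A : Type) [Ring A] [Algebra k A] (φ : M →ₗ[k] N) :
    TotMCoch k A M →ₗ[k] TotMCoch k A N :=
  LinearMap.pi fun p => postComp A M N p φ ∘ₗ LinearMap.proj p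

theorem totPost_apply (φ : M →ₗ[k] N) (c : TotMCoch k A M) (p : ℕ) :
    totPost A φ c p = φ.compMultilinearMap (c p) := rfl

theorem intDiff_contract (St : DGBimod k R M) {h : M →ₗ[k] M} (hh : IsContracting k St h)
    (p : ℕ) (r s : ℤ) (hs : s + 1 = r) (f : MCoch k A M p) :
    intDiff St p s (h.compMultilinearMap f) + h.compMultilinearMap (intDiff St p r f) = f := by
  refine evSeq_ext R fun dg a ha => ?_
  refine (congrArg₂ (fun x y => x + h y) ((isIntDiffM_intDiff St).eq_intSum _ ha)
    ((isIntDiffM_intDiff St).eq_intSum f ha)).trans ?_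
  subst hs
  simp only [intSum, evSeq, LinearMap.compMultilinearMap_apply, map_sub, map_smul, map_sum, ε_add,
    ε_one]
  refine Eq.trans ?_ (hh.1 (f fun i => a i))
  simp

theorem frakh_zero (dH : ∀ (p : ℕ) (r : ℤ), MCoch k A M p →ₗ[k] MCoch k A M (p + 1))
    (h : M →ₗ[k] M) (p : ℕ) (r : ℤ) (j : ℕ) : frakh k dH h p r j 0 = 0 := by
  induction j with
  | zero => ext; simp [frakh, Hop]
  | succ j ih => ext; simp [frakh, Hop, ih]

theorem pow_totHoch_apply (St : DGBimod k R M) (h : M →ₗ[k] M) {n m : ℤ} (hm : m + 1 = n)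
    (c : TotMCoch k A M) (j : ℕ) :
    (∀ p, ((totPost A h ∘ₗ totHoch St m : Module.End k _) ^ j) (totPost A h c) (p + j)
      = frakh k (hochDiff St) h p (n - p) j (c p)) ∧
    ∀ p < j, ((totPost A h ∘ₗ totHoch St m : Module.End k _) ^ j) (totPost A h c) p = 0 := by
  induction j with
  | zero => exact ⟨fun p => rfl, fun p hp => by omega⟩
  | succ j ih =>
    constructor
    · intro p
      rw [pow_succ', Module.End.mul_apply, LinearMap.comp_apply, totPost_apply]
      refine congrArg h.compMultilinearMap ?_
      rw [← ih.1 p]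
      change hochDiff St (p + j) (m - (p + j : ℕ)) _ = _
      rw [show m - (p + j : ℕ) = n - p - j - 1 by push_cast; omega]
      rfl
    · intro p hp
      rw [pow_succ', Module.End.mul_apply, LinearMap.comp_apply, totPost_apply]
      cases p with
      | zero => ext; simp [totHoch]
      | succ q =>
        rw [totHoch_succ, ih.2 q (by omega), map_zero]
        ext; simp

theorem PointwiseNilpotent.acyclic {St : DGBimod k R M}
    {dH : ∀ (p : ℕ) (r : ℤ), MCoch k A M p →ₗ[k] MCoch k A M (p + 1)}
    (hdH : IsHochDiffM k St dH) (hSt : PointwiseNilpotent k St dH) {n m : ℤ} (hm : m + 1 = n)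
    {c : TotMCoch k A M} (hc : c ∈ totK St n) (hDc : totDiff St n c = 0) :
    ∃ b ∈ totK St m, c = totDiff St m b := by
  obtain rfl : dH = hochDiff St := funext fun p => funext fun r => hdH.eq_hochDiff p r
  obtain ⟨h, hh, hnil⟩ := hSt
  refine acyclic_of_nilpotent (isCpx_totDiff St) (totInt St) (totHoch St) (totPost A h)
    (fun n c => rfl) (fun h hc => totInt_mem St h hc)
    (fun c h => totInt_totInt St h c) (fun h hc => totHoch_mem St h hc) ?_ ?_ ?_
    hm hc hDc
  · rintro n m c hm ⟨hc, N, hN⟩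
    refine ⟨fun p dg a ha => ?_, N, fun p hp => ?_⟩
    · have := hh.2 (hc p dg a ha)
      rw [show (∑ i : Fin p, dg i) + (n - p) - 1 = (∑ i : Fin p, dg i) + (m - p) by omega] at this
      exact this
    · rw [totPost_apply, hN p hp]; ext; simp
  · intro n m c hm
    funext p
    exact intDiff_contract St hh p (n - p) (m - p) (by omega) (c p)
  · rintro n m c hm ⟨hc, N, hN⟩
    choose J hJ using fun p => hnil p (n - p) (c p) (hc p)
    refine ⟨∑ p ∈ Finset.range N, J p, fun j hj => ?_⟩
    funext p
    obtain ⟨h1, h2⟩ := pow_totHoch_apply St h hm c j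
    by_cases hp : p < j
    · exact h2 p hp
    · obtain ⟨q, rfl⟩ : ∃ q, p = q + j := ⟨p - j, by omega⟩
      rw [h1 q]
      by_cases hq : q < N
      · exact hJ q j (lt_of_le_of_lt
          (Finset.single_le_sum (f := J) (fun _ _ => Nat.zero_le _) (Finset.mem_range.mpr hq)) hj)
      · rw [hN q (by omega), frakh_zero]; rfl

end Total

section Cones

variable {k}

/-! ### Coefficient morphisms and mapping cones -/

theorem hochDiff_postComp {StM : DGBimod k R M} {StN : DGBimod k R N} {φ : M →ₗ[k] N} (s : ℤ)
    (hL : ∀ (i : ℤ) (a : A) (m : M), a ∈ R.gr i →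
      StN.actL a (φ m) = ε k (s * i) • φ (StM.actL a m))
    (hR : ∀ a m, StN.actR a (φ m) = φ (StM.actR a m)) (p : ℕ) (r : ℤ) (f : MCoch k A M p) :
    hochDiff StN p r (φ.compMultilinearMap f) =
      ε k s • φ.compMultilinearMap (hochDiff StM p (r + s) f) := by
  refine evSeq_ext R fun dg a ha => ?_
  refine (isHochDiffM_hochDiff StN p r _ dg a ha).trans ?_
  refine Eq.trans ?_ (congrArg (fun x => ε k s • φ x)
    (isHochDiffM_hochDiff StM p (r + s) f dg a ha)).symm
  simp only [LinearMap.compMultilinearMap_apply, hR, hL _ _ _ (ha 0), map_add, map_smul, map_sum,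
    smul_add, Finset.smul_sum, smul_smul]
  refine congrArg₂ _ (congrArg₂ _ ?_ (Finset.sum_congr rfl fun i _ => ?_)) ?_
  · congr 1
    rw [← ε_add, ← ε_add, add_mul, show (p : ℤ) + r - 1 + r * dg 0 + s * dg 0 =
      (p + r - 1 + (r * dg 0 + s * dg 0)) by ring, show s + ((p : ℤ) + (r + s) - 1 +
      (r * dg 0 + s * dg 0)) = (p + r - 1 + (r * dg 0 + s * dg 0)) + (s + s) by ring,
      ε_add k _ (s + s), ε_add k s s, ε_mul_self, mul_one]
  · congr 1
    rw [← ε_add, show s + ((p : ℤ) + (r + s) + (i : ℕ)) = (p + r + (i : ℕ)) + (s + s) by ring,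
      ε_add k _ (s + s), ε_add k s s, ε_mul_self, mul_one]
  · congr 1
    rw [← ε_add, show s + (r + s) = r + (s + s) by ring,
      ε_add k _ (s + s), ε_add k s s, ε_mul_self, mul_one]

theorem intDiff_postComp {StM : DGBimod k R M} {StN : DGBimod k R N} {φ ψ : M →ₗ[k] N} (s : ℤ)
    (hd : ∀ m, StN.dM (φ m) = ε k s • φ (StM.dM m) + ψ m) (p : ℕ) (r : ℤ) (f : MCoch k A M p) :
    intDiff StN p r (φ.compMultilinearMap f) =
      ε k s • φ.compMultilinearMap (intDiff StM p (r + s) f) + ψ.compMultilinearMap f := by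
  refine evSeq_ext R fun dg a ha => ?_
  refine (isIntDiffM_intDiff StN p r _ dg a ha).trans ?_
  refine Eq.trans ?_ (congrArg (fun x => ε k s • φ x + ψ (f fun i => a i))
    (isIntDiffM_intDiff StM p (r + s) f dg a ha)).symm
  simp only [LinearMap.compMultilinearMap_apply, hd, map_sub, map_smul, map_sum, smul_sub,
    smul_smul]
  rw [ε_add, mul_comm (ε k r), ← mul_assoc, ε_mul_self, one_mul]
  abel

theorem totDiff_totPost {StM : DGBimod k R M} {StN : DGBimod k R N} {φ ψ : M →ₗ[k] N} (s : ℤ)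
    (hd : ∀ m, StN.dM (φ m) = ε k s • φ (StM.dM m) + ψ m)
    (hL : ∀ (i : ℤ) (a : A) (m : M), a ∈ R.gr i →
      StN.actL a (φ m) = ε k (s * i) • φ (StM.actL a m))
    (hR : ∀ a m, StN.actR a (φ m) = φ (StM.actR a m)) (n m : ℤ) (hm : n + s = m)
    (c : TotMCoch k A M) :
    totDiff StN n (totPost A φ c) = ε k s • totPost A φ (totDiff StM m c) + totPost A ψ c := by
  funext p
  subst hm
  have h1 : totInt StN n (totPost A φ c) p =
      ε k s • totPost A φ (totInt StM (n + s) c) p + totPost A ψ c p := by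
    refine (intDiff_postComp s hd p (n - p) (c p)).trans ?_
    rw [show n - p + s = n + s - p by ring]
    rfl
  have h2 : totHoch StN n (totPost A φ c) p = ε k s • totPost A φ (totHoch StM (n + s) c) p := by
    cases p with
    | zero => ext; simp [totHoch, totPost_apply]
    | succ q =>
      refine (hochDiff_postComp s hL hR q (n - q) (c q)).trans ?_
      rw [show n - q + s = n + s - q by ring]
      rfl
  simp only [totDiff, LinearMap.add_apply, Pi.add_apply, h1, h2, map_add, smul_add, Pi.smul_apply]
  abel

theorem totPost_mem {StM : DGBimod k R M} {StN : DGBimod k R N} {φ : M →ₗ[k] N} (s : ℤ)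
    (hφ : ∀ (i : ℤ) (m : M), m ∈ StM.gr (i + s) → φ m ∈ StN.gr i) {n m : ℤ} (hm : n + s = m)
    {c : TotMCoch k A M} (hc : c ∈ totK StM m) : totPost A φ c ∈ totK StN n := by
  obtain ⟨hc, N, hN⟩ := hc
  refine ⟨fun p dg a ha => hφ _ _ ?_, N, fun p hp => ?_⟩
  · have := hc p dg a ha
    rwa [show (∑ i : Fin p, dg i) + (m - p) = (∑ i : Fin p, dg i) + (n - p) + s by omega] at this
  · rw [totPost_apply, hN p hp]; ext; simp

theorem IsBimodHom.isCpxHom {StM : DGBimod k R M} {StN : DGBimod k R N} {φ : M →ₗ[k] N}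
    (h : IsBimodHom k StM StN φ) :
    IsCpxHom (totK StM) (totDiff StM) (totK StN) (totDiff StN) (totPost A φ) where
  map := fun {n c} hc => totPost_mem 0 (fun i m hm => h.1 i m (by simpa using hm)) (add_zero n) hc
  comm := fun {n c} hc => by
    rw [totDiff_totPost (φ := φ) (ψ := 0) 0 (fun m => by simp [ε_zero, h.2.1])
      (fun i a m _ => by simp [ε_zero, h.2.2.1]) (fun a m => (h.2.2.2 a m).symm) n n (add_zero n)]
    have : totPost A (0 : M →ₗ[k] N) c = 0 := by funext p; ext; simp [totPost_apply]
    rw [this, ε_zero, one_smul, add_zero]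

section Cone

variable {C : Type} [AddCommGroup C] [Module k C] {StM : DGBimod k R M} {StN : DGBimod k R N}
  {φ : M →ₗ[k] N} {SC : DGBimod k R C} {inM : M →ₗ[k] C} {inN : N →ₗ[k] C}

theorem IsConeModel.totDiff_inM (h : IsConeModel k StM StN φ SC inM inN) {n m : ℤ} (hm : n + 1 = m)
    (c : TotMCoch k A M) : totDiff SC n (totPost A inM c) =
      - totPost A inM (totDiff StM m c) + totPost A inN (totPost A φ c) := by
  obtain ⟨-, hdM, -, -, -, -, hLM, -, hRM, -⟩ := h
  rw [totDiff_totPost (φ := inM) (ψ := inN ∘ₗ φ) 1 (fun m => by simp [ε_one, hdM])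
    (fun i a m ha => by rw [one_mul]; exact hLM i a m ha) hRM n m hm]
  rw [ε_one, neg_one_smul]
  rfl

theorem IsConeModel.totDiff_inN (h : IsConeModel k StM StN φ SC inM inN) (n : ℤ)
    (c : TotMCoch k A N) : totDiff SC n (totPost A inN c) = totPost A inN (totDiff StN n c) := by
  obtain ⟨-, -, hdN, -, -, -, -, hLN, -, hRN⟩ := h
  rw [totDiff_totPost (φ := inN) (ψ := 0) 0 (fun m => by simp [ε_zero, hdN])
    (fun i a m ha => by rw [zero_mul, ε_zero, one_smul]; exact hLN a m) hRN n n (add_zero n)]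
  have : totPost A (0 : N →ₗ[k] C) c = 0 := by funext p; ext; simp [totPost_apply]
  rw [this, ε_zero, one_smul, add_zero]

theorem IsConeModel.totPost_inj (h : IsConeModel k StM StN φ SC inM inN) {c c' : TotMCoch k A M}
    {e e' : TotMCoch k A N} (hc : totPost A inM c + totPost A inN e =
      totPost A inM c' + totPost A inN e') : c = c' ∧ e = e' := by
  have key : ∀ p (a : Fin p → A), ((c p a, e p a) : M × N) = (c' p a, e' p a) := fun p a =>
    h.1.1 (DFunLike.congr_fun (congrFun hc p) a)
  exact ⟨funext fun p => MultilinearMap.ext fun a => congrArg Prod.fst (key p a),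
    funext fun p => MultilinearMap.ext fun a => congrArg Prod.snd (key p a)⟩

theorem IsConeModel.exists_eq (h : IsConeModel k StM StN φ SC inM inN) {n m : ℤ} (hm : n + 1 = m)
    {c : TotMCoch k A C} (hc : c ∈ totK SC n) :
    ∃ x ∈ totK StM m, ∃ y ∈ totK StN n, c = totPost A inM x + totPost A inN y := by
  let e : (M × N) ≃ₗ[k] C := LinearEquiv.ofBijective (inM.coprod inN) h.1
  have he : ∀ c, inM (e.symm c).1 + inN (e.symm c).2 = c := fun c => e.apply_symm_apply c
  have hgr : ∀ (i : ℤ) (c : C), c ∈ SC.gr i →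
      (e.symm c).1 ∈ StM.gr (i + 1) ∧ (e.symm c).2 ∈ StN.gr i := by
    intro i c hc
    obtain ⟨m, hm, n, hn, rfl⟩ := h.2.2.2.2.2.1 i c hc
    have : e.symm (inM m + inN n) = (m, n) := e.symm_apply_apply (m, n)
    rw [this]
    exact ⟨hm, hn⟩
  refine ⟨totPost A (LinearMap.fst k M N ∘ₗ e.symm.toLinearMap) c,
    totPost_mem (-1) (fun i c hc => ?_) (by omega) hc,
    totPost A (LinearMap.snd k M N ∘ₗ e.symm.toLinearMap) c,
    totPost_mem 0 (fun i c hc => ?_) (by omega) hc, ?_⟩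
  · have := (hgr _ _ hc).1
    rwa [neg_add_cancel_right] at this
  · rw [add_zero] at hc
    exact (hgr _ _ hc).2
  · funext p
    ext a
    exact (he _).symm

theorem IsConeModel.isQIso (h : IsConeModel k StM StN φ SC inM inN)
    (hac : ∀ {n m : ℤ} {c : TotMCoch k A C}, m + 1 = n → c ∈ totK SC n → totDiff SC n c = 0 →
      ∃ b ∈ totK SC m, c = totDiff SC m b) :
    IsQIso (totK StM) (totDiff StM) (totK StN) (totDiff StN) (fun _ => totPost A φ) where
  surj := by
    intro n m y hm hy hDy
    obtain ⟨b, hb, e⟩ := hac (c := totPost A inN y) hm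
      (totPost_mem 0 (fun i m hm => h.2.2.2.2.1 i m (by simpa using hm)) (add_zero n) hy)
      (by rw [h.totDiff_inN, hDy, map_zero])
    obtain ⟨x, hx, z, hz, rfl⟩ := h.exists_eq hm hb
    rw [map_add, h.totDiff_inM hm, h.totDiff_inN] at e
    obtain ⟨e1, e2⟩ := h.totPost_inj (c := 0) (e := y) (c' := -totDiff StM n x)
      (e' := totPost A φ x + totDiff StN m z) (by
        rw [map_zero, zero_add, e, map_neg, map_add, add_assoc])
    refine ⟨x, hx, neg_eq_zero.mp e1.symm, -z, Submodule.neg_mem _ hz, ?_⟩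
    rw [e2, map_neg]
    abel
  inj := by
    rintro n m x hm hx hDx ⟨z, hz, e⟩
    obtain ⟨b, hb, e'⟩ := hac (n := m) (m := m - 1)
      (c := totPost A inM x - totPost A inN z) (by ring)
      (Submodule.sub_mem _ (totPost_mem 1 h.2.2.2.1 hm hx)
        (totPost_mem 0 (fun i m hm => h.2.2.2.2.1 i m (by simpa using hm)) (add_zero m) hz))
      (by rw [map_sub, h.totDiff_inM hm, h.totDiff_inN, hDx, map_zero, neg_zero, zero_add, e,
        sub_self])
    obtain ⟨u, hu, v, hv, rfl⟩ := h.exists_eq (m := m) (by ring) hb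
    rw [map_add, h.totDiff_inM (m := m) (by ring), h.totDiff_inN] at e'
    obtain ⟨e1, -⟩ := h.totPost_inj (c := x) (e := -z) (c' := -totDiff StM m u)
      (e' := totPost A φ u + totDiff StN (m - 1) v) (by
        rw [map_neg, map_neg, map_add, ← add_assoc, ← e', sub_eq_add_neg])
    exact ⟨-u, Submodule.neg_mem _ hu, by rw [e1, map_neg]⟩

end Cone

theorem ConePN.isQIso {StM : DGBimod k R M} {StN : DGBimod k R N} {φ : M →ₗ[k] N}
    (h : ConePN k StM StN φ) :
    IsQIso (totK StM) (totDiff StM) (totK StN) (totDiff StN) (fun _ => totPost A φ) := by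
  obtain ⟨D, dHC, hd, hn⟩ := h
  exact D.isCone.isQIso fun hm hc hDc => hn.acyclic hd hm hc hDc

theorem WeaklyConeNilpotent.isQIso {StM : DGBimod k R M} {StN : DGBimod k R N} {φ : M →ₗ[k] N}
    (hφ : IsBimodHom k StM StN φ) (h : WeaklyConeNilpotent k StM StN φ) :
    IsQIso (totK StM) (totDiff StM) (totK StN) (totDiff StN) (fun _ => totPost A φ) := by
  obtain h | ⟨ψ, hψ, h1, h⟩ | ⟨ψ, hψ, h1, h⟩ := h
  · exact h.isQIso
  · exact IsQIso.of_rightInverse hφ.isCpxHom hψ.isCpxHom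
      (fun c => funext fun p => MultilinearMap.ext fun a => h1 _) h.isQIso
  · exact IsQIso.of_leftInverse hφ.isCpxHom hψ.isCpxHom
      (fun c => funext fun p => MultilinearMap.ext fun a => h1 _) h.isQIso

end Cones

section Bimodule

variable {k}

/-! ### The complex `Hoch(A, X, B)` -/

/-- The sequence obtained from `a` by applying the differential to the entry `i`. -/
def seqDiff (R : DGAlgebra k A) (i : ℕ) (a : ℕ → A) : ℕ → A := fun j =>
  if j = i then R.d (a i) else a j

theorem seqDiff_mem {dg : ℕ → ℤ} {a : ℕ → A} (ha : ∀ i, a i ∈ R.gr (dg i)) (i j : ℕ) :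
    seqDiff R i a j ∈ R.gr (degDer i dg j) := by
  unfold seqDiff degDer
  split_ifs with h
  · subst h; exact R.d_mem (ha j)
  · exact ha j

theorem evSeq_hochDiff (St : DGBimod k R M) (p : ℕ) (r : ℤ) (f : MCoch k A M p) {dg : ℕ → ℤ}
    {a : ℕ → A} (ha : ∀ i, a i ∈ R.gr (dg i)) :
    evSeq (hochDiff St p r f) a =
      ε k ((p : ℤ) + r - 1 + r * dg 0) • St.actL (a 0) (evSeq f (seqShift a))
      + ∑ i ∈ Finset.range p, ε k ((p : ℤ) + r + i) • evSeq f (seqFace i a)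
      + ε k r • St.actR (a p) (evSeq f a) := by
  rw [Finset.sum_range]
  exact isHochDiffM_hochDiff St p r f dg a ha

theorem evSeq_intDiff (St : DGBimod k R M) (p : ℕ) (r : ℤ) (f : MCoch k A M p) {dg : ℕ → ℤ}
    {a : ℕ → A} (ha : ∀ i, a i ∈ R.gr (dg i)) :
    evSeq (intDiff St p r f) a = St.dM (evSeq f a) -
      ε k r • ∑ i ∈ Finset.range p, ε k (∑ j ∈ Finset.range i, dg j) • evSeq f (seqDiff R i a) := by
  rw [Finset.sum_range]
  exact isIntDiffM_intDiff St p r f dg a ha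

/-- Evaluation of a cochain in `Hoch(A, X, B)` on sequences. -/
def evX {p q : ℕ} (f : XCoch k A B X p q) (a : ℕ → A) (x : X) (b : ℕ → B) : X :=
  f (fun i => a i) x (fun j => b j)

theorem evX_ext (SX : ABBimod k RA RB X) {p q : ℕ} {f g : XCoch k A B X p q}
    (h : ∀ (dga : ℕ → ℤ) (a : ℕ → A), (∀ i, a i ∈ RA.gr (dga i)) →
      ∀ (ix : ℤ) (x : X), x ∈ SX.gr ix →
      ∀ (dgb : ℕ → ℤ) (b : ℕ → B), (∀ j, b j ∈ RB.gr (dgb j)) → evX f a x b = evX g a x b) :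
    f = g :=
  multilinear_ext_hom RA.isInternal fun dga a ha => linear_ext_hom SX.isInternal fun ix x hx =>
    multilinear_ext_hom RB.isInternal fun dgb b hb => h dga a ha ix x hx dgb b hb

theorem evX_zero {p q : ℕ} (a : ℕ → A) (x : X) (b : ℕ → B) :
    evX (0 : XCoch k A B X p q) a x b = 0 := rfl

theorem evX_add {p q : ℕ} (f g : XCoch k A B X p q) (a : ℕ → A) (x : X) (b : ℕ → B) :
    evX (f + g) a x b = evX f a x b + evX g a x b := rfl

/-- Cochains in `Hoch(A, X, B)` of tridegree `(p, q, r)`. -/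
def homogX (SX : ABBimod k RA RB X) (p q : ℕ) (r : ℤ) : Submodule k (XCoch k A B X p q) where
  carrier := {f | IsHomogX k SX p q r f}
  add_mem' := fun hf hg dga a ha ix x hx dgb b hb =>
    Submodule.add_mem _ (hf dga a ha ix x hx dgb b hb) (hg dga a ha ix x hx dgb b hb)
  zero_mem' := fun dga a ha ix x hx dgb b hb => Submodule.zero_mem _
  smul_mem' := fun c f hf dga a ha ix x hx dgb b hb =>
    Submodule.smul_mem _ c (hf dga a ha ix x hx dgb b hb)

/-- Elements of total degree `n` of the sum complex `Hoch(A, X, B)`. -/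
def totXK (SX : ABBimod k RA RB X) (n : ℤ) : Submodule k (TotXCoch k A B X) where
  carrier := {c | TotHomogX k SX n c ∧ TotFinSuppX k c}
  add_mem' := by
    rintro c c' ⟨h, N, hN⟩ ⟨h', N', hN'⟩
    refine ⟨fun p q => (homogX SX p q _).add_mem (h p q) (h' p q), N + N', fun p q hp => ?_⟩
    rw [Pi.add_apply, Pi.add_apply, hN p q (by omega), hN' p q (by omega), add_zero]
  zero_mem' := ⟨fun p q => (homogX SX p q _).zero_mem, 0, fun p q _ => rfl⟩
  smul_mem' := by
    rintro x c ⟨h, N, hN⟩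
    refine ⟨fun p q => (homogX SX p q _).smul_mem x (h p q), N, fun p q hp => ?_⟩
    rw [Pi.smul_apply, Pi.smul_apply, hN p q hp, smul_zero]

theorem IsHomogX.congr {SX : ABBimod k RA RB X} {p q : ℕ} {r r' : ℤ} {f : XCoch k A B X p q}
    (hf : IsHomogX k SX p q r f) (h : r = r') : IsHomogX k SX p q r' f := h ▸ hf

section Differential

variable {SX : ABBimod k RA RB X}
  {dXL : ∀ (p q : ℕ) (r : ℤ), XCoch k A B X p q →ₗ[k] XCoch k A B X (p + 1) q}
  {dXR : ∀ (p q : ℕ) (r : ℤ), XCoch k A B X p q →ₗ[k] XCoch k A B X p (q + 1)}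
  {pdX : ∀ (p q : ℕ) (r : ℤ), XCoch k A B X p q →ₗ[k] XCoch k A B X p q}

theorem IsDXL.evX_eq (h : IsDXL k SX dXL) {p q : ℕ} {r : ℤ} (f : XCoch k A B X p q)
    {dga : ℕ → ℤ} {a : ℕ → A} (ha : ∀ i, a i ∈ RA.gr (dga i)) (x : X) (b : ℕ → B) :
    evX (dXL p q r f) a x b =
      ε k ((p : ℤ) + q + r + r * dga 0) • SX.actL (a 0) (evX f (seqShift a) x b)
      + ∑ i ∈ Finset.range p, ε k ((p : ℤ) + q + r + i + 1) • evX f (seqFace i a) x b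
      + ε k ((q : ℤ) + r + 1) • evX f a (SX.actL (a p) x) b := by
  rw [Finset.sum_range]
  exact h p q r f dga a ha x b

theorem IsDXR.evX_eq (h : IsDXR k SX dXR) {p q : ℕ} {r : ℤ} (f : XCoch k A B X p q)
    (a : ℕ → A) (x : X) (b : ℕ → B) :
    evX (dXR p q r f) a x b =
      ε k ((q : ℤ) + r - 1) • evX f a (SX.actR (b 0) x) (seqShift b)
      + ∑ j ∈ Finset.range q, ε k ((q : ℤ) + r + j) • evX f a x (seqFace j b)
      + ε k r • SX.actR (b q) (evX f a x b) := by
  rw [Finset.sum_range]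
  exact h p q r f a x b

theorem IsPdX.evX_eq (h : IsPdX k SX pdX) {p q : ℕ} {r : ℤ} (f : XCoch k A B X p q)
    {dga : ℕ → ℤ} {a : ℕ → A} (ha : ∀ i, a i ∈ RA.gr (dga i)) {ix : ℤ} {x : X} (hx : x ∈ SX.gr ix)
    {dgb : ℕ → ℤ} {b : ℕ → B} (hb : ∀ j, b j ∈ RB.gr (dgb j)) :
    evX (pdX p q r f) a x b = SX.dX (evX f a x b) - ε k r • (
      (∑ i ∈ Finset.range p, ε k (∑ j ∈ Finset.range i, dga j) • evX f (seqDiff RA i a) x b)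
      + ε k (∑ j ∈ Finset.range p, dga j) • evX f a (SX.dX x) b
      + ∑ j ∈ Finset.range q, ε k ((∑ l ∈ Finset.range p, dga l) + ix
          + (∑ l ∈ Finset.range j, dgb l)) • evX f a x (seqDiff RB j b)) := by
  rw [Finset.sum_range, Finset.sum_range (n := q)]
  exact h p q r f dga a ha ix x hx dgb b hb

theorem sum_degFace (p i : ℕ) (hi : i < p) (dg : ℕ → ℤ) :
    ∑ j : Fin p, degFace i dg j = ∑ j : Fin (p + 1), dg j := by
  rw [← Finset.sum_range, ← Finset.sum_range (fun j => dg j)]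
  obtain ⟨s, rfl⟩ : ∃ s, p = i + 1 + s := ⟨p - i - 1, by omega⟩
  rw [show i + 1 + s + 1 = i + 2 + s by ring, Finset.sum_range_add _ (i + 1) s,
    Finset.sum_range_add _ (i + 2) s, Finset.sum_range_succ _ i, Finset.sum_range_succ _ (i + 1),
    Finset.sum_range_succ _ i]
  have h1 : ∑ x ∈ Finset.range i, degFace i dg x = ∑ x ∈ Finset.range i, dg x :=
    Finset.sum_congr rfl fun j hj => if_pos (Finset.mem_range.mp hj)
  have h2 : ∑ x ∈ Finset.range s, degFace i dg (i + 1 + x) = ∑ x ∈ Finset.range s, dg (i + 2 + x) :=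
    Finset.sum_congr rfl fun j hj => by
      rw [degFace, if_neg (by omega), if_neg (by omega), show i + 1 + j + 1 = i + 2 + j by ring]
  have h3 : degFace i dg i = dg i + dg (i + 1) := by simp [degFace]
  rw [h1, h2, h3]
  ring

theorem sum_degDer (p i : ℕ) (hi : i < p) (dg : ℕ → ℤ) :
    ∑ j : Fin p, degDer i dg j = (∑ j : Fin p, dg j) + 1 := by
  have : ∀ j : Fin p, degDer i dg j = dg j + if j = ⟨i, hi⟩ then 1 else 0 := fun j => by
    unfold degDer
    by_cases h : (j : ℕ) = i
    · rw [if_pos h, if_pos (Fin.ext h)]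
    · rw [if_neg h, if_neg (fun e => h (congrArg Fin.val e)), add_zero]
  simp only [this, Finset.sum_add_distrib, Finset.sum_ite_eq', Finset.mem_univ, if_true]

theorem IsHomogX.evX_mem {p q : ℕ} {r s : ℤ} {f : XCoch k A B X p q} (hf : IsHomogX k SX p q r f)
    {dga : ℕ → ℤ} {a : ℕ → A} (ha : ∀ i, a i ∈ RA.gr (dga i)) {ix : ℤ} {x : X} (hx : x ∈ SX.gr ix)
    {dgb : ℕ → ℤ} {b : ℕ → B} (hb : ∀ j, b j ∈ RB.gr (dgb j))
    (hs : (∑ i : Fin p, dga i) + ix + (∑ j : Fin q, dgb j) + r = s) : evX f a x b ∈ SX.gr s :=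
  hs ▸ hf dga a ha ix x hx dgb b hb

theorem IsHomogX.left_mem (h : IsDXL k SX dXL) {p q : ℕ} {r : ℤ} {f : XCoch k A B X p q}
    (hf : IsHomogX k SX p q r f) : IsHomogX k SX (p + 1) q r (dXL p q r f) := by
  intro dga a ha ix x hx dgb b hb
  rw [show (dXL p q r f) (fun i => a i) x (fun j => b j) = evX (dXL p q r f) a x b from rfl,
    h.evX_eq f ha]
  refine Submodule.add_mem _ (Submodule.add_mem _ (Submodule.smul_mem _ _ ?_)
    (Submodule.sum_mem _ fun i hi => Submodule.smul_mem _ _ ?_)) (Submodule.smul_mem _ _ ?_)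
  · have := SX.actL_mem (ha 0) (hf.evX_mem (a := seqShift a) (fun i => ha (i + 1)) hx hb rfl)
    rw [Fin.sum_univ_succ]
    convert this using 2
    simp
    ring
  · refine hf.evX_mem (seqFace_mem ha i) hx hb ?_
    rw [sum_degFace p i (Finset.mem_range.mp hi)]
  · refine hf.evX_mem ha (SX.actL_mem (ha p) hx) hb ?_
    rw [Fin.sum_univ_castSucc]
    simp
    ring

theorem IsHomogX.right_mem (h : IsDXR k SX dXR) {p q : ℕ} {r : ℤ} {f : XCoch k A B X p q}
    (hf : IsHomogX k SX p q r f) : IsHomogX k SX p (q + 1) r (dXR p q r f) := by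
  intro dga a ha ix x hx dgb b hb
  rw [show (dXR p q r f) (fun i => a i) x (fun j => b j) = evX (dXR p q r f) a x b from rfl,
    h.evX_eq f]
  refine Submodule.add_mem _ (Submodule.add_mem _ (Submodule.smul_mem _ _ ?_)
    (Submodule.sum_mem _ fun i hi => Submodule.smul_mem _ _ ?_)) (Submodule.smul_mem _ _ ?_)
  · refine hf.evX_mem ha (SX.actR_mem (hb 0) hx) (b := seqShift b) (fun i => hb (i + 1)) ?_
    rw [Fin.sum_univ_succ]
    simp
    ring
  · refine hf.evX_mem ha hx (seqFace_mem hb i) ?_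
    rw [sum_degFace q i (Finset.mem_range.mp hi)]
  · have := SX.actR_mem (hb q) (hf.evX_mem ha hx hb rfl)
    rw [Fin.sum_univ_castSucc]
    convert this using 2
    simp
    ring

theorem IsHomogX.int_mem (h : IsPdX k SX pdX) {p q : ℕ} {r : ℤ} {f : XCoch k A B X p q}
    (hf : IsHomogX k SX p q r f) : IsHomogX k SX p q (r + 1) (pdX p q r f) := by
  intro dga a ha ix x hx dgb b hb
  rw [show (pdX p q r f) (fun i => a i) x (fun j => b j) = evX (pdX p q r f) a x b from rfl,
    h.evX_eq f ha hx hb]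
  refine Submodule.sub_mem _ ?_ (Submodule.smul_mem _ _ (Submodule.add_mem _ (Submodule.add_mem _
    (Submodule.sum_mem _ fun i hi => Submodule.smul_mem _ _ ?_) (Submodule.smul_mem _ _ ?_))
    (Submodule.sum_mem _ fun i hi => Submodule.smul_mem _ _ ?_)))
  · have := SX.dX_mem (hf.evX_mem ha hx hb rfl)
    rwa [add_assoc] at this
  · refine hf.evX_mem (seqDiff_mem ha i) hx hb ?_
    rw [sum_degDer p i (Finset.mem_range.mp hi)]
    ring
  · exact hf.evX_mem ha (SX.dX_mem hx) hb (by ring)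
  · refine hf.evX_mem ha hx (seqDiff_mem hb i) ?_
    rw [sum_degDer q i (Finset.mem_range.mp hi)]
    ring

variable (dXL dXR pdX)

/-- The internal part of the total differential of `Hoch(A, X, B)`. -/
def totPdX (n : ℤ) : TotXCoch k A B X →ₗ[k] TotXCoch k A B X :=
  LinearMap.pi fun p => LinearMap.pi fun q =>
    pdX p q (n - p - q - 1) ∘ₗ LinearMap.proj q ∘ₗ LinearMap.proj p

/-- The left part of the total differential of `Hoch(A, X, B)`. -/
def totXL (n : ℤ) : TotXCoch k A B X →ₗ[k] TotXCoch k A B X :=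
  LinearMap.pi fun p => LinearMap.pi fun q => match p with
    | 0 => 0
    | p + 1 => dXL p q (n - p - q - 1) ∘ₗ LinearMap.proj q ∘ₗ LinearMap.proj p

/-- The right part of the total differential of `Hoch(A, X, B)`. -/
def totXR (n : ℤ) : TotXCoch k A B X →ₗ[k] TotXCoch k A B X :=
  LinearMap.pi fun p => LinearMap.pi fun q => match q with
    | 0 => 0
    | q + 1 => dXR p q (n - p - q - 1) ∘ₗ LinearMap.proj q ∘ₗ LinearMap.proj p

/-- The total differential of `Hoch(A, X, B)`. -/
def totDX (n : ℤ) : TotXCoch k A B X →ₗ[k] TotXCoch k A B X :=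
  totPdX pdX n + totXL dXL n + totXR dXR n

variable {dXL dXR pdX}

theorem totPdX_apply (n : ℤ) (c : TotXCoch k A B X) (p q : ℕ) :
    totPdX pdX n c p q = pdX p q (n - p - q - 1) (c p q) := rfl

theorem totXL_zero (n : ℤ) (c : TotXCoch k A B X) (q : ℕ) : totXL dXL n c 0 q = 0 := rfl

theorem totXL_succ (n : ℤ) (c : TotXCoch k A B X) (p q : ℕ) :
    totXL dXL n c (p + 1) q = dXL p q (n - p - q - 1) (c p q) := rfl

theorem totXR_zero (n : ℤ) (c : TotXCoch k A B X) (p : ℕ) : totXR dXR n c p 0 = 0 := rfl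

theorem totXR_succ (n : ℤ) (c : TotXCoch k A B X) (p q : ℕ) :
    totXR dXR n c p (q + 1) = dXR p q (n - p - q - 1) (c p q) := rfl

theorem totDX_apply (n : ℤ) (c : TotXCoch k A B X) (p q : ℕ) : totDX dXL dXR pdX n c p q =
    totPdX pdX n c p q + totXL dXL n c p q + totXR dXR n c p q := rfl

theorem totDX_mem (hL : IsDXL k SX dXL) (hR : IsDXR k SX dXR) (hp : IsPdX k SX pdX) {n m : ℤ}
    (hm : n + 1 = m) {c : TotXCoch k A B X} (hc : c ∈ totXK SX n) :
    totDX dXL dXR pdX n c ∈ totXK SX m := by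
  obtain ⟨h, N, hN⟩ := hc
  refine ⟨fun p q => (homogX SX p q _).add_mem ((homogX SX p q _).add_mem ?_ ?_) ?_, N + 1,
    fun p q hpq => ?_⟩
  · exact ((h p q).int_mem hp).congr (by omega)
  · cases p with
    | zero => exact (homogX SX 0 q _).zero_mem
    | succ p => exact ((h p q).left_mem hL).congr (by push_cast; omega)
  · cases q with
    | zero => exact (homogX SX p 0 _).zero_mem
    | succ q => exact ((h p q).right_mem hR).congr (by push_cast; omega)
  · rw [totDX_apply, totPdX_apply, hN p q (by omega), map_zero, zero_add]
    have h1 : totXL dXL n c p q = 0 := by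
      cases p with
      | zero => rfl
      | succ p => rw [totXL_succ, hN p q (by omega), map_zero]
    have h2 : totXR dXR n c p q = 0 := by
      cases q with
      | zero => rfl
      | succ q => rw [totXR_succ, hN p q (by omega), map_zero]
    rw [h1, h2, add_zero]

end Differential

end Bimodule

section Extension

variable {k}

/-! ### The trivial extension -/

/-- The identities satisfied by the trivial extension `A ⋉ X ⋊ B`. -/
structure TrivExt (RA : DGAlgebra k A) (RB : DGAlgebra k B)
    (SX : ABBimod k RA RB X) (RC : DGAlgebra k C)
    (iA : A →ₗ[k] C) (iX : X →ₗ[k] C) (iB : B →ₗ[k] C)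
    (prA : C →ₗ[k] A) (prX : C →ₗ[k] X) (prB : C →ₗ[k] B) : Prop where
  sum_eq : ∀ c : C, iA (prA c) + iX (prX c) + iB (prB c) = c
  prA_iA : ∀ a, prA (iA a) = a
  prX_iX : ∀ x, prX (iX x) = x
  prB_iB : ∀ b, prB (iB b) = b
  prX_iA : ∀ a, prX (iA a) = 0
  prB_iA : ∀ a, prB (iA a) = 0
  prA_iX : ∀ x, prA (iX x) = 0
  prB_iX : ∀ x, prB (iX x) = 0
  prA_iB : ∀ b, prA (iB b) = 0
  prX_iB : ∀ b, prX (iB b) = 0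
  iA_mul_iA : ∀ a a', iA a * iA a' = iA (a * a')
  iB_mul_iB : ∀ b b', iB b * iB b' = iB (b * b')
  iA_mul_iX : ∀ a x, iA a * iX x = iX (SX.actL a x)
  iX_mul_iB : ∀ x b, iX x * iB b = iX (SX.actR b x)
  iA_mul_iB : ∀ a b, iA a * iB b = 0
  iB_mul_iA : ∀ b a, iB b * iA a = 0
  iX_mul_iA : ∀ x a, iX x * iA a = 0
  iB_mul_iX : ∀ b x, iB b * iX x = 0
  iX_mul_iX : ∀ x x', iX x * iX x' = 0
  d_iA : ∀ a, RC.d (iA a) = iA (RA.d a)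
  d_iX : ∀ x, RC.d (iX x) = iX (SX.dX x)
  d_iB : ∀ b, RC.d (iB b) = iB (RB.d b)
  iA_mem : ∀ {i : ℤ} {a : A}, a ∈ RA.gr i → iA a ∈ RC.gr i
  iX_mem : ∀ {i : ℤ} {x : X}, x ∈ SX.gr i → iX x ∈ RC.gr i
  iB_mem : ∀ {i : ℤ} {b : B}, b ∈ RB.gr i → iB b ∈ RC.gr i

/-- The projection of a graded vector space onto its component of degree `i`. -/
def gradedProj {V : Type} [AddCommGroup V] [Module k V] {gr : ℤ → Submodule k V}
    (h : DirectSum.IsInternal gr) (i : ℤ) : V →ₗ[k] V :=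
  gradedLift h fun j => if j = i then (gr j).subtype else 0

section GradedProj

variable {V : Type} [AddCommGroup V] [Module k V] {gr : ℤ → Submodule k V}

theorem gradedProj_apply (h : DirectSum.IsInternal gr) (i : ℤ) {j : ℤ} {v : V} (hv : v ∈ gr j) :
    gradedProj h i v = if j = i then v else 0 := by
  rw [gradedProj, gradedLift_apply h _ hv]
  split_ifs <;> rfl

theorem gradedProj_mem (h : DirectSum.IsInternal gr) (i : ℤ) (v : V) :
    gradedProj h i v ∈ gr i := by
  have : (gr i).mkQ ∘ₗ gradedProj h i = 0 := linear_ext_hom h fun j v hv => by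
    rw [LinearMap.comp_apply, gradedProj_apply h i hv]
    split_ifs with e
    · subst e; simpa using hv
    · simp
  simpa using LinearMap.congr_fun this v

end GradedProj

section TrivExt

variable {SX : ABBimod k RA RB X} {RC : DGAlgebra k C}
  {iA : A →ₗ[k] C} {iX : X →ₗ[k] C} {iB : B →ₗ[k] C}
  {prA : C →ₗ[k] A} {prX : C →ₗ[k] X} {prB : C →ₗ[k] B}

theorem IsTrivExtModel.trivExt (h : IsTrivExtModel k RA RB SX RC iA iX iB prA prX prB) :
    TrivExt RA RB SX RC iA iX iB prA prX prB := by
  obtain ⟨h1, h2, h3, h4, h5, h6, h7, h8, h9, h10, h11, h12, h13, h14, h15, h16, h17, h18, h19,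
    h20, h21, h22, h23, h24, h25⟩ := h
  exact ⟨h1, h2, h3, h4, h5, h6, h7, h8, h9, h10, h11, h12, h13, h14, h15, h16, h17, h18, h19,
    h20, h21, h22, fun {i a} => h23 i a, fun {i x} => h24 i x, fun {i b} => h25 i b⟩

namespace TrivExt

theorem gradedProj_eq (T : TrivExt RA RB SX RC iA iX iB prA prX prB)
    (i : ℤ) (c : C) : gradedProj RC.isInternal i c =
    iA (gradedProj RA.isInternal i (prA c)) + iX (gradedProj SX.isInternal i (prX c))
      + iB (gradedProj RB.isInternal i (prB c)) := by
  have hA : gradedProj RC.isInternal i ∘ₗ iA = iA ∘ₗ gradedProj RA.isInternal i :=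
    linear_ext_hom RA.isInternal fun j a ha => by
      rw [LinearMap.comp_apply, LinearMap.comp_apply, gradedProj_apply _ i (T.iA_mem ha),
        gradedProj_apply _ i ha]
      split_ifs <;> simp
  have hX : gradedProj RC.isInternal i ∘ₗ iX = iX ∘ₗ gradedProj SX.isInternal i :=
    linear_ext_hom SX.isInternal fun j a ha => by
      rw [LinearMap.comp_apply, LinearMap.comp_apply, gradedProj_apply _ i (T.iX_mem ha),
        gradedProj_apply _ i ha]
      split_ifs <;> simp
  have hB : gradedProj RC.isInternal i ∘ₗ iB = iB ∘ₗ gradedProj RB.isInternal i :=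
    linear_ext_hom RB.isInternal fun j a ha => by
      rw [LinearMap.comp_apply, LinearMap.comp_apply, gradedProj_apply _ i (T.iB_mem ha),
        gradedProj_apply _ i ha]
      split_ifs <;> simp
  conv_lhs => rw [← T.sum_eq c]
  rw [map_add, map_add]
  exact congrArg₂ _ (congrArg₂ _ (LinearMap.congr_fun hA _) (LinearMap.congr_fun hX _))
    (LinearMap.congr_fun hB _)

theorem eq_of_mem (T : TrivExt RA RB SX RC iA iX iB prA prX prB)
    {i : ℤ} {c : C} (hc : c ∈ RC.gr i) : c =
    iA (gradedProj RA.isInternal i (prA c)) + iX (gradedProj SX.isInternal i (prX c))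
      + iB (gradedProj RB.isInternal i (prB c)) := by
  rw [← T.gradedProj_eq i c, gradedProj_apply _ i hc, if_pos rfl]

theorem prA_mem (T : TrivExt RA RB SX RC iA iX iB prA prX prB)
    {i : ℤ} {c : C} (hc : c ∈ RC.gr i) : prA c ∈ RA.gr i := by
  rw [T.eq_of_mem hc]
  simpa [T.prA_iA, T.prA_iX, T.prA_iB] using gradedProj_mem RA.isInternal i (prA c)

theorem prX_mem (T : TrivExt RA RB SX RC iA iX iB prA prX prB)
    {i : ℤ} {c : C} (hc : c ∈ RC.gr i) : prX c ∈ SX.gr i := by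
  rw [T.eq_of_mem hc]
  simpa [T.prX_iX, T.prX_iA, T.prX_iB] using gradedProj_mem SX.isInternal i (prX c)

theorem prB_mem (T : TrivExt RA RB SX RC iA iX iB prA prX prB)
    {i : ℤ} {c : C} (hc : c ∈ RC.gr i) : prB c ∈ RB.gr i := by
  rw [T.eq_of_mem hc]
  simpa [T.prB_iB, T.prB_iA, T.prB_iX] using gradedProj_mem RB.isInternal i (prB c)

theorem prX_iA_mul (T : TrivExt RA RB SX RC iA iX iB prA prX prB)
    (a : A) (c : C) : prX (iA a * c) = SX.actL a (prX c) := by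
  conv_lhs => rw [← T.sum_eq c]
  simp [mul_add, T.iA_mul_iA, T.iA_mul_iX, T.iA_mul_iB, T.prX_iX, T.prX_iA]

theorem prX_mul_iB (T : TrivExt RA RB SX RC iA iX iB prA prX prB)
    (b : B) (c : C) : prX (c * iB b) = SX.actR b (prX c) := by
  conv_lhs => rw [← T.sum_eq c]
  simp [add_mul, T.iB_mul_iB, T.iX_mul_iB, T.iA_mul_iB, T.prX_iX, T.prX_iB]

theorem prX_d (T : TrivExt RA RB SX RC iA iX iB prA prX prB)
    (c : C) : prX (RC.d c) = SX.dX (prX c) := by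
  conv_lhs => rw [← T.sum_eq c]
  simp [T.d_iA, T.d_iX, T.d_iB, T.prX_iX, T.prX_iA, T.prX_iB]

end TrivExt

/-- The sequence `a₀, …, a_{p-1}, x, b₀, b₁, …` in the trivial extension. -/
def word (iA : A →ₗ[k] C) (iX : X →ₗ[k] C) (iB : B →ₗ[k] C) (p : ℕ) (a : ℕ → A) (x : X)
    (b : ℕ → B) : ℕ → C := fun i =>
  if i < p then iA (a i) else if i = p then iX x else iB (b (i - (p + 1)))

/-- The degrees of `word`. -/
def degWord (p : ℕ) (dga : ℕ → ℤ) (ix : ℤ) (dgb : ℕ → ℤ) : ℕ → ℤ := fun i =>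
  if i < p then dga i else if i = p then ix else dgb (i - (p + 1))

section Word

variable {p : ℕ} {a : ℕ → A} {x : X} {b : ℕ → B}

theorem word_of_lt {i : ℕ} (h : i < p) : word iA iX iB p a x b i = iA (a i) := if_pos h

theorem word_self : word iA iX iB p a x b p = iX x := by simp [word]

theorem word_of_gt (j : ℕ) : word iA iX iB p a x b (p + 1 + j) = iB (b j) := by
  rw [word, if_neg (by omega), if_neg (by omega), Nat.add_sub_cancel_left]

theorem seqShift_word : seqShift (word iA iX iB (p + 1) a x b) =
    word iA iX iB p (seqShift a) x b := by
  funext i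
  simp only [seqShift, word, add_lt_add_iff_right, add_left_inj, Nat.add_sub_add_right]

theorem word_mem (T : TrivExt RA RB SX RC iA iX iB prA prX prB)
    {dga : ℕ → ℤ} (ha : ∀ i, a i ∈ RA.gr (dga i)) {ix : ℤ} (hx : x ∈ SX.gr ix)
    {dgb : ℕ → ℤ} (hb : ∀ j, b j ∈ RB.gr (dgb j)) (i : ℕ) :
    word iA iX iB p a x b i ∈ RC.gr (degWord p dga ix dgb i) := by
  unfold word degWord
  split_ifs
  · exact T.iA_mem (ha i)
  · exact T.iX_mem hx
  · exact T.iB_mem (hb _)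

theorem seqFace_word_left (T : TrivExt RA RB SX RC iA iX iB prA prX prB)
    {i : ℕ} (hi : i < p) : seqFace i (word iA iX iB (p + 1) a x b) =
    word iA iX iB p (seqFace i a) x b := by
  funext j
  unfold seqFace word
  rcases lt_trichotomy j i with h | h | h
  · rw [if_pos h, if_pos (by omega), if_pos (by omega)]
    exact congrArg iA (if_pos h).symm
  · subst h
    rw [if_neg (by omega), if_pos rfl, if_pos (by omega), if_pos (by omega), if_pos (by omega),
      T.iA_mul_iA]
    simp
  · simp only [if_neg (show ¬j < i by omega), if_neg (show ¬j = i by omega),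
      add_lt_add_iff_right, add_left_inj, Nat.add_sub_add_right]

theorem seqFace_word_mid_left (T : TrivExt RA RB SX RC iA iX iB prA prX prB) :
    seqFace p (word iA iX iB (p + 1) a x b) =
    word iA iX iB p a (SX.actL (a p) x) b := by
  funext j
  unfold seqFace word
  rcases lt_trichotomy j p with h | h | h
  · rw [if_pos h, if_pos (by omega), if_pos (by omega)]
  · subst h
    rw [if_neg (by omega), if_pos rfl, if_pos (by omega), if_neg (by omega), if_pos (by omega),
      if_neg (by omega), if_pos rfl, T.iA_mul_iX]
  · rw [if_neg (by omega), if_neg (by omega), if_neg (by omega), if_neg (by omega),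
      if_neg (by omega), if_neg (by omega)]
    congr 2
    omega

theorem seqFace_word_mid_right (T : TrivExt RA RB SX RC iA iX iB prA prX prB) :
    seqFace p (word iA iX iB p a x b) =
    word iA iX iB p a (SX.actR (b 0) x) (seqShift b) := by
  funext j
  unfold seqFace word
  rcases lt_trichotomy j p with h | h | h
  · rw [if_pos h, if_pos (by omega), if_pos (by omega)]
  · subst h
    rw [if_neg (by omega), if_pos rfl, if_neg (by omega), if_pos (by omega), if_neg (by omega),
      if_neg (by omega), if_neg (by omega), if_pos rfl, T.iX_mul_iB]
    simp
  · rw [if_neg (by omega), if_neg (by omega), if_neg (by omega), if_neg (by omega),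
      if_neg (by omega), if_neg (by omega)]
    unfold seqShift
    congr 2
    omega

theorem seqFace_word_right (T : TrivExt RA RB SX RC iA iX iB prA prX prB)
    (i : ℕ) : seqFace (p + 1 + i) (word iA iX iB p a x b) =
    word iA iX iB p a x (seqFace i b) := by
  funext j
  rcases lt_trichotomy j p with h | h | h
  · rw [seqFace, if_pos (by omega), word_of_lt h, word_of_lt h]
  · subst h
    rw [seqFace, if_pos (by omega), word_self, word_self]
  · obtain ⟨l, rfl⟩ : ∃ l, j = p + 1 + l := ⟨j - (p + 1), by omega⟩
    simp only [seqFace, add_assoc (p + 1), word_of_gt, T.iB_mul_iB]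
    rcases lt_trichotomy l i with h | h | h
    · rw [if_pos (by omega), if_pos h]
    · subst h; simp
    · rw [if_neg (by omega), if_neg (by omega), if_neg (by omega), if_neg (by omega)]

theorem seqDiff_word_left (T : TrivExt RA RB SX RC iA iX iB prA prX prB)
    {i : ℕ} (hi : i < p) : seqDiff RC i (word iA iX iB p a x b) =
    word iA iX iB p (seqDiff RA i a) x b := by
  funext j
  unfold seqDiff word
  by_cases h : j = i
  · subst h; simp [hi, T.d_iA]
  · simp only [if_neg h]

theorem seqDiff_word_mid (T : TrivExt RA RB SX RC iA iX iB prA prX prB) :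
    seqDiff RC p (word iA iX iB p a x b) =
    word iA iX iB p a (SX.dX x) b := by
  funext j
  unfold seqDiff word
  by_cases h : j = p
  · subst h; simp [T.d_iX]
  · rw [if_neg h, if_neg h, if_neg h]

theorem seqDiff_word_right (T : TrivExt RA RB SX RC iA iX iB prA prX prB)
    (i : ℕ) : seqDiff RC (p + 1 + i) (word iA iX iB p a x b) =
    word iA iX iB p a x (seqDiff RB i b) := by
  funext j
  rcases lt_trichotomy j p with h | h | h
  · rw [seqDiff, if_neg (by omega), word_of_lt h, word_of_lt h]
  · subst h
    rw [seqDiff, if_neg (by omega), word_self, word_self]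
  · obtain ⟨l, rfl⟩ : ∃ l, j = p + 1 + l := ⟨j - (p + 1), by omega⟩
    simp only [seqDiff, word_of_gt, T.d_iB]
    by_cases h : l = i
    · subst h; simp
    · rw [if_neg (by omega), if_neg h]

end Word

end TrivExt

end Extension

section SquareZero

variable {k}

section Restriction

variable {SX : ABBimod k RA RB X} {RC : DGAlgebra k C}
  {iA : A →ₗ[k] C} {iX : X →ₗ[k] C} {iB : B →ₗ[k] C}
  {prA : C →ₗ[k] A} {prX : C →ₗ[k] X} {prB : C →ₗ[k] B}
  {dXL : ∀ (p q : ℕ) (r : ℤ), XCoch k A B X p q →ₗ[k] XCoch k A B X (p + 1) q}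
  {dXR : ∀ (p q : ℕ) (r : ℤ), XCoch k A B X p q →ₗ[k] XCoch k A B X p (q + 1)}
  {pdX : ∀ (p q : ℕ) (r : ℤ), XCoch k A B X p q →ₗ[k] XCoch k A B X p q}

/-- The cochain `c` of the trivial extension vanishes on `A` and on `B`, and its `X`-component on
mixed words is `cx`. -/
structure Restricts (SX : ABBimod k RA RB X) (iA : A →ₗ[k] C) (iX : X →ₗ[k] C) (iB : B →ₗ[k] C)
    (prX : C →ₗ[k] X) (c : TotMCoch k C C) (cx : TotXCoch k A B X) : Prop where
  mixed : ∀ {p q m : ℕ}, m = p + q + 1 →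
    ∀ {dga : ℕ → ℤ} {a : ℕ → A}, (∀ i, a i ∈ RA.gr (dga i)) →
    ∀ {ix : ℤ} {x : X}, x ∈ SX.gr ix →
    ∀ {dgb : ℕ → ℤ} {b : ℕ → B}, (∀ j, b j ∈ RB.gr (dgb j)) →
      prX (evSeq (c m) (word iA iX iB p a x b)) = evX (cx p q) a x b
  left : ∀ (m : ℕ) {dga : ℕ → ℤ} {a : ℕ → A}, (∀ i, a i ∈ RA.gr (dga i)) →
    evSeq (c m) (fun i => iA (a i)) = 0
  right : ∀ (m : ℕ) {dgb : ℕ → ℤ} {b : ℕ → B}, (∀ i, b i ∈ RB.gr (dgb i)) →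
    evSeq (c m) (fun i => iB (b i)) = 0

/-- A cochain which vanishes on all words in a graded subalgebra has a differential with the same
property. -/
theorem evSeq_totDiff_eq_zero {U V : Type} [Ring U] [Algebra k U] [Ring V] [Algebra k V]
    (RU : DGAlgebra k U) (RV : DGAlgebra k V) (i : U →ₗ[k] V)
    (hmem : ∀ {j : ℤ} {u : U}, u ∈ RU.gr j → i u ∈ RV.gr j)
    (hmul : ∀ u u', i u * i u' = i (u * u')) (hd : ∀ u, RV.d (i u) = i (RU.d u))
    (n : ℤ) {c : TotMCoch k V V}
    (hc : ∀ (m : ℕ) {dg : ℕ → ℤ} {u : ℕ → U}, (∀ j, u j ∈ RU.gr (dg j)) →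
      evSeq (c m) (fun j => i (u j)) = 0)
    (m : ℕ) {dg : ℕ → ℤ} {u : ℕ → U} (hu : ∀ j, u j ∈ RU.gr (dg j)) :
    evSeq (totDiff (RV.toBimod k) n c m) (fun j => i (u j)) = 0 := by
  have hiu : ∀ j, i (u j) ∈ RV.gr (dg j) := fun j => hmem (hu j)
  have h1 : evSeq (totInt (RV.toBimod k) n c m) (fun j => i (u j)) = 0 := by
    refine (evSeq_intDiff (RV.toBimod k) m (n - m) (c m) hiu).trans ?_
    rw [hc m hu, map_zero, zero_sub, neg_eq_zero]
    refine smul_eq_zero_of_right _ (Finset.sum_eq_zero fun l _ => smul_eq_zero_of_right _ ?_)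
    have : seqDiff RV l (fun j => i (u j)) = fun j => i (seqDiff RU l u j) := by
      funext j; unfold seqDiff; split_ifs
      · exact hd _
      · rfl
    rw [this]
    exact hc m (seqDiff_mem hu l)
  have h2 : evSeq (totHoch (RV.toBimod k) n c m) (fun j => i (u j)) = 0 := by
    cases m with
    | zero => rfl
    | succ m =>
      refine (evSeq_hochDiff (RV.toBimod k) m (n - m) (c m) hiu).trans ?_
      have e1 : evSeq (c m) (seqShift fun j => i (u j)) = 0 :=
        hc m (u := seqShift u) (fun j => hu (j + 1))
      rw [e1, hc m hu, map_zero, map_zero, smul_zero, smul_zero, add_zero, zero_add]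
      refine Finset.sum_eq_zero fun l _ => smul_eq_zero_of_right _ ?_
      have : seqFace l (fun j => i (u j)) = fun j => i (seqFace l u j) := by
        funext j; unfold seqFace; split_ifs
        · rfl
        · exact hmul _ _
        · rfl
      rw [this]
      exact hc m (seqFace_mem hu l)
  exact (congrArg₂ (· + ·) h1 h2).trans (add_zero 0)

theorem ε_congr {m n : ℤ} (h : Even (m - n)) : ε k m = ε k n := by
  have : m = n + (m - n) := by ring
  rw [this, ε_add, show ε k (m - n) = 1 from if_pos h, mul_one]

section

variable (T : TrivExt RA RB SX RC iA iX iB prA prX prB) {c : TotMCoch k C C}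
  {cx : TotXCoch k A B X} (hc : Restricts SX iA iX iB prX c cx) {p q : ℕ} (n : ℤ)
  {dga : ℕ → ℤ} {a : ℕ → A} (ha : ∀ i, a i ∈ RA.gr (dga i)) {ix : ℤ} {x : X} (hx : x ∈ SX.gr ix)
  {dgb : ℕ → ℤ} {b : ℕ → B} (hb : ∀ j, b j ∈ RB.gr (dgb j))

theorem Restricts.left_terms (T : TrivExt RA RB SX RC iA iX iB prA prX prB)
    (hc : Restricts SX iA iX iB prX c cx) (hL : IsDXL k SX dXL)
    (ha : ∀ i, a i ∈ RA.gr (dga i)) (hx : x ∈ SX.gr ix) (hb : ∀ j, b j ∈ RB.gr (dgb j)) :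
    ε k (((p + q : ℕ) : ℤ) + (n - (p + q : ℕ)) - 1
        + (n - (p + q : ℕ)) * degWord p dga ix dgb 0) •
      prX (word iA iX iB p a x b 0 * evSeq (c (p + q)) (seqShift (word iA iX iB p a x b)))
    + ∑ i ∈ Finset.range p, ε k (((p + q : ℕ) : ℤ) + (n - (p + q : ℕ)) + i) •
      prX (evSeq (c (p + q)) (seqFace i (word iA iX iB p a x b)))
    = evX (totXL dXL n cx p q) a x b := by
  cases p with
  | zero =>
    have : evSeq (c (0 + q)) (seqShift (word iA iX iB 0 a x b)) = 0 := by
      rw [← hc.right (0 + q) hb]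
      exact evSeq_congr _ fun j _ => by simp [seqShift, word]
    rw [this]
    simp [totXL_zero, evX_zero]
  | succ p =>
    rw [totXL_succ, hL.evX_eq _ ha, seqShift_word, word_of_lt (Nat.succ_pos p), T.prX_iA_mul,
      hc.mixed (q := q) (by omega) (a := seqShift a) (fun i => ha (i + 1)) hx hb,
      Finset.sum_range_succ, seqFace_word_mid_left T,
      hc.mixed (q := q) (by omega) ha (SX.actL_mem (ha p) hx) hb, ← add_assoc]
    refine congrArg₂ _ (congrArg₂ _ ?_ (Finset.sum_congr rfl fun i hi => ?_)) ?_
    · refine congrArg (· • _) (congrArg (ε k) ?_)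
      simp only [degWord, Nat.succ_pos, if_true]
      push_cast
      ring
    · rw [seqFace_word_left T (Finset.mem_range.mp hi),
        hc.mixed (q := q) (by omega) (seqFace_mem ha i) hx hb]
      refine congrArg (· • _) (congrArg (ε k) ?_)
      push_cast
      ring
    · refine congrArg (· • _) (ε_congr ⟨p, ?_⟩)
      push_cast
      ring

theorem Restricts.right_terms (T : TrivExt RA RB SX RC iA iX iB prA prX prB)
    (hc : Restricts SX iA iX iB prX c cx) (hR : IsDXR k SX dXR)
    (ha : ∀ i, a i ∈ RA.gr (dga i)) (hx : x ∈ SX.gr ix) (hb : ∀ j, b j ∈ RB.gr (dgb j)) :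
    ∑ j ∈ Finset.range q, ε k (((p + q : ℕ) : ℤ) + (n - (p + q : ℕ)) + (p + j : ℕ)) •
      prX (evSeq (c (p + q)) (seqFace (p + j) (word iA iX iB p a x b)))
    + ε k (n - (p + q : ℕ)) •
      prX (evSeq (c (p + q)) (word iA iX iB p a x b) * word iA iX iB p a x b (p + q))
    = evX (totXR dXR n cx p q) a x b := by
  cases q with
  | zero =>
    have : evSeq (c (p + 0)) (word iA iX iB p a x b) = 0 := by
      rw [← hc.left (p + 0) ha]
      exact evSeq_congr _ fun j hj => word_of_lt hj
    rw [this]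
    simp [totXR_zero, evX_zero]
  | succ q =>
    rw [totXR_succ, hR.evX_eq, Finset.sum_range_succ', add_zero p, seqFace_word_mid_right T,
      hc.mixed (q := q) (by omega) ha (SX.actR_mem (hb 0) hx) (b := seqShift b)
        (fun i => hb (i + 1)),
      show p + (q + 1) = p + 1 + q by ring, word_of_gt, T.prX_mul_iB,
      hc.mixed (q := q) (by omega) ha hx hb, add_comm (Finset.sum _ _)]
    refine congrArg₂ _ (congrArg₂ _ ?_ (Finset.sum_congr rfl fun i hi => ?_)) ?_
    · refine congrArg (· • _) (ε_congr ⟨p + 1, ?_⟩)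
      push_cast
      ring
    · rw [show p + (i + 1) = p + 1 + i by ring, seqFace_word_right T,
        hc.mixed (q := q) (by omega) ha hx (seqFace_mem hb i)]
      refine congrArg (· • _) (ε_congr ⟨p + 1, ?_⟩)
      push_cast
      ring
    · refine congrArg (· • _) (congrArg (ε k) ?_)
      push_cast
      ring

theorem Restricts.int_terms (T : TrivExt RA RB SX RC iA iX iB prA prX prB)
    (hc : Restricts SX iA iX iB prX c cx) (hp : IsPdX k SX pdX)
    (ha : ∀ i, a i ∈ RA.gr (dga i)) (hx : x ∈ SX.gr ix) (hb : ∀ j, b j ∈ RB.gr (dgb j)) :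
    prX (evSeq (totInt (RC.toBimod k) n c (p + q + 1)) (word iA iX iB p a x b))
    = evX (totPdX pdX n cx p q) a x b := by
  have hw := word_mem (p := p) T ha hx hb
  refine (congrArg prX (evSeq_intDiff (RC.toBimod k) _ _ (c (p + q + 1)) hw)).trans ?_
  rw [totPdX_apply, hp.evX_eq _ ha hx hb, map_sub]
  refine congrArg₂ _ ?_ ?_
  · exact (T.prX_d _).trans (congrArg _ (hc.mixed rfl ha hx hb))
  · rw [map_smul, map_sum, show p + q + 1 = p + 1 + q by ring, Finset.sum_range_add,
      Finset.sum_range_succ]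
    refine congrArg₂ _ (congrArg (ε k) (by push_cast; ring))
      (congrArg₂ _ (congrArg₂ _ (Finset.sum_congr rfl fun i hi => ?_) ?_)
        (Finset.sum_congr rfl fun j hj => ?_))
    · have hi' := Finset.mem_range.mp hi
      rw [map_smul, seqDiff_word_left T hi', hc.mixed (q := q) (by omega) (seqDiff_mem ha i) hx hb]
      refine congrArg (· • _) (congrArg (ε k) (Finset.sum_congr rfl fun l hl => ?_))
      exact if_pos (by have := Finset.mem_range.mp hl; omega)
    · rw [map_smul, seqDiff_word_mid T, hc.mixed (q := q) (by omega) ha (SX.dX_mem hx) hb]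
      refine congrArg (· • _) (congrArg (ε k) (Finset.sum_congr rfl fun l hl => ?_))
      exact if_pos (Finset.mem_range.mp hl)
    · rw [map_smul, seqDiff_word_right T, hc.mixed (q := q) (by omega) ha hx (seqDiff_mem hb j),
        Finset.sum_range_add, Finset.sum_range_succ]
      refine congrArg (· • _) (congrArg (ε k) (congrArg₂ _ (congrArg₂ _
        (Finset.sum_congr rfl fun l hl => ?_) ?_) (Finset.sum_congr rfl fun l hl => ?_)))
      · exact if_pos (Finset.mem_range.mp hl)
      · simp [degWord]
      · rw [degWord, if_neg (by omega), if_neg (by omega), Nat.add_sub_cancel_left]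

end

theorem Restricts.totDiff_totDX (T : TrivExt RA RB SX RC iA iX iB prA prX prB)
    {c : TotMCoch k C C} {cx : TotXCoch k A B X} (hc : Restricts SX iA iX iB prX c cx)
    (hL : IsDXL k SX dXL) (hR : IsDXR k SX dXR) (hp : IsPdX k SX pdX) (n : ℤ) :
    Restricts SX iA iX iB prX (totDiff (RC.toBimod k) n c) (totDX dXL dXR pdX n cx) where
  mixed := by
    intro p q m hm dga a ha ix x hx dgb b hb
    subst hm
    have hw := word_mem (p := p) T ha hx hb
    rw [totDX_apply, evX_add, evX_add, add_assoc (evX _ _ _ _), ← hc.int_terms n T hp ha hx hb,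
      ← hc.left_terms n T hL ha hx hb, ← hc.right_terms n T hR ha hx hb]
    refine (map_add prX _ _).trans (congrArg₂ _ rfl ?_)
    refine (congrArg prX
      (evSeq_hochDiff (RC.toBimod k) (p + q) (n - (p + q : ℕ)) (c (p + q)) hw)).trans ?_
    rw [map_add, map_add, map_sum, Finset.sum_range_add]
    simp only [map_smul]
    rw [← add_assoc, ← add_assoc]
    rfl
  left := fun m _ _ ha => evSeq_totDiff_eq_zero RA RC iA T.iA_mem T.iA_mul_iA T.d_iA n hc.left m ha
  right := fun m _ _ hb =>
    evSeq_totDiff_eq_zero RB RC iB T.iB_mem T.iB_mul_iB T.d_iB n hc.right m hb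

/-- The cochain of the trivial extension induced by a cochain in `Hoch(A, X, B)`. -/
def extX (iX : X →ₗ[k] C) (prA : C →ₗ[k] A) (prX : C →ₗ[k] X) (prB : C →ₗ[k] B) {p q m : ℕ}
    (hm : p + q + 1 = m) (f : XCoch k A B X p q) : MCoch k C C m :=
  ((((multilinearCurryLeftEquiv k (fun _ : Fin (q + 1) => C) C).symm.toLinearMap ∘ₗ
      LinearMap.lcomp k _ prX ∘ₗ LinearMap.llcomp k X _ _
        (postComp C X C q iX ∘ₗ
          MultilinearMap.compLinearMapₗ (fun _ : Fin q => prB))).compMultilinearMap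
    (f.compLinearMap (fun _ => prA))).uncurrySum (N := fun _ => C)).domDomCongr
      ((finSumFinEquiv (m := p) (n := q + 1)).trans (finCongr hm))

theorem evSeq_extX {p q m : ℕ} (hm : p + q + 1 = m) (f : XCoch k A B X p q) (w : ℕ → C) :
    evSeq (extX iX prA prX prB hm f) w =
      iX (evX f (fun i => prA (w i)) (prX (w p)) (fun j => prB (w (p + 1 + j)))) := by
  subst hm
  refine congrArg iX (congrArg (f _ _) (funext fun j => congrArg (fun l => prB (w l)) ?_))
  simp
  ring

theorem IsHomogX.extX_mem (T : TrivExt RA RB SX RC iA iX iB prA prX prB) {p q m : ℕ}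
    (hm : p + q + 1 = m) {r : ℤ} {f : XCoch k A B X p q} (hf : IsHomogX k SX p q r f) :
    IsHomogM k (RC.toBimod k) m r (extX iX prA prX prB hm f) := by
  intro dg w hw
  rw [show (extX iX prA prX prB hm f) (fun i => w i) = evSeq (extX iX prA prX prB hm f) w
    from rfl, evSeq_extX]
  refine T.iX_mem (hf.evX_mem (fun i => T.prA_mem (hw i)) (T.prX_mem (hw p))
    (fun j => T.prB_mem (hw (p + 1 + j))) ?_)
  subst hm
  rw [← Finset.sum_range, ← Finset.sum_range (fun j => dg j),
    ← Finset.sum_range (fun j => dg (p + 1 + j)), show p + q + 1 = p + 1 + q by ring,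
    Finset.sum_range_add, Finset.sum_range_succ]

/-- The extension by zero to the trivial extension of an element of `Hoch(A, X, B)`. -/
def totExtX (iX : X →ₗ[k] C) (prA : C →ₗ[k] A) (prX : C →ₗ[k] X) (prB : C →ₗ[k] B)
    (cx : TotXCoch k A B X) : TotMCoch k C C := fun m => match m with
  | 0 => 0
  | m + 1 => ∑ s : Fin (m + 1), extX iX prA prX prB (by have := s.isLt; omega) (cx s (m - s))

theorem evSeq_totExtX (cx : TotXCoch k A B X) (m : ℕ) (w : ℕ → C) :
    evSeq (totExtX iX prA prX prB cx (m + 1)) w = ∑ s ∈ Finset.range (m + 1),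
      iX (evX (cx s (m - s)) (fun i => prA (w i)) (prX (w s)) (fun j => prB (w (s + 1 + j)))) := by
  rw [Finset.sum_range]
  refine (sum_apply _ _ _).trans (Finset.sum_congr rfl fun s _ => ?_)
  exact evSeq_extX _ _ w

theorem evX_arg_zero {p q : ℕ} (f : XCoch k A B X p q) (a : ℕ → A) (b : ℕ → B) :
    evX f a 0 b = 0 := by
  rw [evX, map_zero]; rfl

theorem evX_congr {p q : ℕ} (f : XCoch k A B X p q) {a a' : ℕ → A} (x : X) {b b' : ℕ → B}
    (ha : ∀ i < p, a i = a' i) (hb : ∀ j < q, b j = b' j) : evX f a x b = evX f a' x b' := by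
  unfold evX
  rw [show (fun i : Fin p => a i) = fun i : Fin p => a' i from funext fun i => ha i i.2,
    show (fun i : Fin q => b i) = fun i : Fin q => b' i from funext fun i => hb i i.2]

theorem restricts_totExtX (T : TrivExt RA RB SX RC iA iX iB prA prX prB) (cx : TotXCoch k A B X) :
    Restricts SX iA iX iB prX (totExtX iX prA prX prB cx) cx where
  mixed := by
    intro p q m hm dga a ha ix x hx dgb b hb
    subst hm
    rw [evSeq_totExtX, map_sum, Finset.sum_eq_single p]
    · rw [T.prX_iX, Nat.add_sub_cancel_left, word_self, T.prX_iX]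
      refine evX_congr _ _ (fun i hi => ?_) fun j _ => ?_
      · rw [word_of_lt hi, T.prA_iA]
      · rw [word_of_gt, T.prB_iB]
    · intro s _ hs
      have : prX (word iA iX iB p a x b s) = 0 := by
        rw [word]
        split_ifs with h
        · exact T.prX_iA _
        · exact T.prX_iB _
      rw [this, evX_arg_zero, map_zero, map_zero]
    · exact fun h => absurd (Finset.mem_range.mpr (by omega)) h
  left := by
    intro m dga a ha
    cases m with
    | zero => rfl
    | succ m =>
      rw [evSeq_totExtX]
      exact Finset.sum_eq_zero fun s _ => by rw [T.prX_iA, evX_arg_zero, map_zero]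
  right := by
    intro m dga a ha
    cases m with
    | zero => rfl
    | succ m =>
      rw [evSeq_totExtX]
      exact Finset.sum_eq_zero fun s _ => by rw [T.prX_iB, evX_arg_zero, map_zero]

theorem totExtX_mem (T : TrivExt RA RB SX RC iA iX iB prA prX prB) {n : ℤ} {cx : TotXCoch k A B X}
    (h : cx ∈ totXK SX n) : totExtX iX prA prX prB cx ∈ totK (RC.toBimod k) n := by
  obtain ⟨h, N, hN⟩ := h
  refine ⟨fun m => ?_, N + 1, fun m hm => ?_⟩
  · cases m with
    | zero => exact (homogM (RC.toBimod k) 0 _).zero_mem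
    | succ m =>
      refine (homogM (RC.toBimod k) (m + 1) _).sum_mem fun s _ => ?_
      exact ((h s (m - s)).extX_mem T _).congr (by have := s.isLt; push_cast; omega)
  · cases m with
    | zero => omega
    | succ m =>
      refine Finset.sum_eq_zero fun s _ => ?_
      rw [hN s (m - s) (by have := s.isLt; omega)]
      refine evSeq_ext RC fun dg w hw => ?_
      rw [evSeq_extX, evX_zero, map_zero]
      rfl

theorem isCpx_totDX (T : TrivExt RA RB SX RC iA iX iB prA prX prB)
    (hL : IsDXL k SX dXL) (hR : IsDXR k SX dXR) (hp : IsPdX k SX pdX) :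
    IsCpx (V := TotXCoch k A B X) (totXK SX) (totDX dXL dXR pdX) where
  map := fun hm hc => totDX_mem hL hR hp hm hc
  sq := by
    intro n m cx hm hcx
    have h1 := ((restricts_totExtX T cx).totDiff_totDX T hL hR hp n).totDiff_totDX T hL hR hp m
    rw [(isCpx_totDiff (RC.toBimod k)).sq hm (totExtX_mem T hcx)] at h1
    funext p q
    refine evX_ext SX fun dga a ha ix x hx dgb b hb => ?_
    rw [← h1.mixed rfl ha hx hb]
    exact map_zero prX

end Restriction

end SquareZero

section Connecting

variable {k}

/-! ### Quasi-isomorphisms of degree one -/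

section Shift

variable {V W U : Type} [AddCommGroup V] [Module k V] [AddCommGroup W] [Module k W]
  [AddCommGroup U] [Module k U]

/-- The maps `F n` anticommute with the differentials and induce bijections from the cohomology of
`K` in degree `n` to the cohomology of `K'` in degree `n + 1`. -/
structure IsShiftQIso (K : ℤ → Submodule k V) (D : ℤ → V →ₗ[k] V) (K' : ℤ → Submodule k W)
    (D' : ℤ → W →ₗ[k] W) (F : ℤ → V →ₗ[k] W) : Prop where
  map : ∀ {n m : ℤ} {c : V}, n + 1 = m → c ∈ K n → F n c ∈ K' m
  comm : ∀ {n m : ℤ} {c : V}, n + 1 = m → c ∈ K n → D' m (F n c) = -F m (D n c)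
  surj : ∀ {n m : ℤ} {y : W}, n + 1 = m → y ∈ K' m → D' m y = 0 →
    ∃ x ∈ K n, D n x = 0 ∧ ∃ z ∈ K' n, F n x - y = D' n z
  inj : ∀ {n m : ℤ} {x : V}, m + 1 = n → x ∈ K n → D n x = 0 → (∃ z ∈ K' n, F n x = D' n z) →
    ∃ w ∈ K m, x = D m w

theorem IsShiftQIso.comp {K : ℤ → Submodule k V} {D : ℤ → V →ₗ[k] V}
    {K' : ℤ → Submodule k W} {D' : ℤ → W →ₗ[k] W} {K'' : ℤ → Submodule k U} {D'' : ℤ → U →ₗ[k] U}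
    {F : ℤ → W →ₗ[k] U} {G : V →ₗ[k] W} (hF : IsShiftQIso K' D' K'' D'' F)
    (hG : IsCpxHom K D K' D' G) (hq : IsQIso K D K' D' (fun _ => G)) :
    IsShiftQIso K D K'' D'' (fun n => F n ∘ₗ G) where
  map := fun hm hc => hF.map hm (hG.map hc)
  comm := fun {n m c} hm hc => by
    rw [LinearMap.comp_apply, hF.comm hm (hG.map hc), hG.comm hc, LinearMap.comp_apply]
  surj := by
    intro n m y hm hy hDy
    obtain ⟨x, hx, hDx, z, hz, e⟩ := hF.surj hm hy hDy
    obtain ⟨x', hx', hDx', z', hz', e'⟩ := hq.surj (m := n - 1) (by ring) hx hDx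
    refine ⟨x', hx', hDx', z - F (n - 1) z', Submodule.sub_mem _ hz (hF.map (by ring) hz'), ?_⟩
    rw [map_sub, ← e, hF.comm (by ring) hz', ← e', map_sub, LinearMap.comp_apply]
    abel
  inj := by
    rintro n m x hm hx hDx ⟨z, hz, e⟩
    have h1 : D' n (G x) = 0 := by rw [hG.comm hx, hDx, map_zero]
    exact hq.inj hm hx hDx (hF.inj hm (hG.map hx) h1 ⟨z, hz, e⟩)

/-- A map of degree one is a quasi-isomorphism if it is injective and the target has an exhaustive
filtration whose lowest step is the image and whose higher steps can be killed by coboundaries. -/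
theorem IsShiftQIso.of_filtration {K : ℤ → Submodule k V} {D : ℤ → V →ₗ[k] V}
    {K' : ℤ → Submodule k W} {D' : ℤ → W →ₗ[k] W} {F : ℤ → V →ₗ[k] W}
    (hD' : IsCpx K' D') (S : ℕ → Submodule k W)
    (hmap : ∀ {n m : ℤ} {c : V}, n + 1 = m → c ∈ K n → F n c ∈ K' m)
    (hcomm : ∀ {n m : ℤ} {c : V}, n + 1 = m → c ∈ K n → D' m (F n c) = -F m (D n c))
    (hinj : ∀ {n : ℤ} {c : V}, F n c = 0 → c = 0)
    (hS0 : ∀ (n : ℤ) (c : V), F n c ∈ S 0)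
    (hS : ∀ {n : ℤ} {c : W}, c ∈ K' n → ∃ N, c ∈ S N)
    (hstep : ∀ {n m : ℤ} {N : ℕ} {c : W}, n + 1 = m → c ∈ K' m → c ∈ S (N + 1) → D' m c ∈ S 0 →
      ∃ g ∈ K' n, c - D' n g ∈ S N)
    (hbase : ∀ {n m : ℤ} {c : W}, n + 1 = m → c ∈ K' m → c ∈ S 0 → D' m c ∈ S 0 →
      ∃ e ∈ K n, F n e = c) : IsShiftQIso K D K' D' F := by
  have peel : ∀ {n m : ℤ} (N : ℕ) {c : W}, n + 1 = m → c ∈ K' m → c ∈ S N → D' m c ∈ S 0 →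
      ∃ g ∈ K' n, ∃ e ∈ K n, F n e = c - D' n g := by
    intro n m N
    induction N with
    | zero =>
      intro c hm hc hcS hDc
      obtain ⟨e, he, h⟩ := hbase hm hc hcS hDc
      exact ⟨0, Submodule.zero_mem _, e, he, by rw [h, map_zero, sub_zero]⟩
    | succ N ih =>
      intro c hm hc hcS hDc
      obtain ⟨g, hg, hgS⟩ := hstep hm hc hcS hDc
      have h1 : D' m (c - D' n g) = D' m c := by rw [map_sub, hD'.sq hm hg, sub_zero]
      obtain ⟨g', hg', e, he, h⟩ :=
        ih hm (Submodule.sub_mem _ hc (hD'.map hm hg)) hgS (h1.symm ▸ hDc)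
      exact ⟨g + g', Submodule.add_mem _ hg hg', e, he, by rw [h, map_add]; abel⟩
  refine ⟨hmap, hcomm, ?_, ?_⟩
  · intro n m y hm hy hDy
    obtain ⟨N, hN⟩ := hS hy
    obtain ⟨g, hg, e, he, h⟩ := peel N hm hy hN (hDy.symm ▸ Submodule.zero_mem _)
    refine ⟨e, he, ?_, -g, Submodule.neg_mem _ hg, by rw [h, map_neg]; abel⟩
    refine hinj (n := m) ?_
    rw [← neg_eq_zero, ← hcomm hm he, h, map_sub, hDy, hD'.sq hm hg, sub_zero]
  · rintro n m x hm hx hDx ⟨z, hz, e⟩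
    obtain ⟨N, hN⟩ := hS hz
    obtain ⟨g, hg, w, hw, h⟩ := peel N hm hz hN (e ▸ hS0 n x)
    refine ⟨-w, Submodule.neg_mem _ hw, ?_⟩
    rw [map_neg, ← add_eq_zero_iff_eq_neg]
    refine hinj (n := n) ?_
    have h2 := hcomm hm hw
    rw [h, map_sub, hD'.sq hm hg, sub_zero, ← e] at h2
    rw [map_add, h2, neg_add_cancel]

end Shift

theorem neg_ε (n : ℤ) : -ε k n = ε k (n + 1) := by rw [ε_add, ε_one, mul_neg_one]

theorem ε_congr_neg {m n : ℤ} (h : Even (m - n - 1)) : ε k m = -ε k n := by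
  rw [neg_ε]
  exact ε_congr (by rwa [← sub_sub])

/-- Evaluation of multilinear maps at a tuple. -/
def evalAt {V W : Type} [AddCommGroup V] [Module k V] [AddCommGroup W] [Module k W] {p : ℕ}
    (a : Fin p → V) : MultilinearMap k (fun _ : Fin p => V) W →ₗ[k] W where
  toFun f := f a
  map_add' _ _ := rfl
  map_smul' _ _ := rfl

/-- Extension of a finite sequence by zero. -/
def finSeq {V : Type} [Zero V] {p : ℕ} (a : Fin p → V) (i : ℕ) : V :=
  if h : i < p then a ⟨i, h⟩ else 0

theorem finSeq_coe {V : Type} [Zero V] {p : ℕ} (a : Fin p → V) :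
    (fun i : Fin p => finSeq a i) = a := by
  funext i; simp [finSeq]

theorem finSeq_mem {V : Type} [AddCommGroup V] [Module k V] {gr : ℤ → Submodule k V} {p : ℕ}
    {a : Fin p → V} {dg : Fin p → ℤ} (h : ∀ i, a i ∈ gr (dg i)) (i : ℕ) :
    finSeq a i ∈ gr (finSeq dg i) := by
  unfold finSeq
  split_ifs with hi
  · exact h _
  · exact Submodule.zero_mem _

theorem sum_finSeq {p : ℕ} (dg : Fin p → ℤ) : ∑ i : Fin p, finSeq dg i = ∑ i, dg i :=
  Finset.sum_congr rfl fun i _ => congrFun (finSeq_coe dg) i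

/-! ### The embedding of `Hoch(A, Hom_B(X, X))` -/

section Phi

variable {SX : ABBimod k RA RB X} {E : Type} [AddCommGroup E] [Module k E]
  {dXL : ∀ (p q : ℕ) (r : ℤ), XCoch k A B X p q →ₗ[k] XCoch k A B X (p + 1) q}
  {dXR : ∀ (p q : ℕ) (r : ℤ), XCoch k A B X p q →ₗ[k] XCoch k A B X p (q + 1)}
  {pdX : ∀ (p q : ℕ) (r : ℤ), XCoch k A B X p q →ₗ[k] XCoch k A B X p q}
  {dR : ∀ (q : ℕ) (r : ℤ), YCoch k B X q →ₗ[k] YCoch k B X (q + 1)}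

theorem dXR_apply_eq (hR : IsDXR k SX dXR) (hdR : IsDR k SX dR) {p q : ℕ} (r s : ℤ)
    (f : XCoch k A B X p q) (a : Fin p → A) :
    dXR p q r f a = ε k s • dR q (r + s) (f a) := by
  refine LinearMap.ext fun x => MultilinearMap.ext fun b => ?_
  have h1 := hR p q r f (finSeq a) x (finSeq b)
  have h2 := hdR q (r + s) (f a) x (finSeq b)
  rw [finSeq_coe a, finSeq_coe b] at h1
  rw [finSeq_coe b] at h2
  rw [LinearMap.smul_apply, smul_apply, h1, h2, smul_add, smul_add, Finset.smul_sum]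
  simp only [smul_smul, ← ε_add]
  refine congrArg₂ _ (congrArg₂ _ ?_ (Finset.sum_congr rfl fun i _ => ?_)) ?_ <;>
  exact congrArg (· • _) (ε_congr ⟨-s, by ring⟩)

/-- The values of a homogeneous cochain on a tuple of homogeneous elements of `A`. -/
theorem IsHomogX.isHomogY {p q : ℕ} {r : ℤ} {f : XCoch k A B X p q} (hf : IsHomogX k SX p q r f)
    {dg : Fin p → ℤ} {a : Fin p → A} (ha : ∀ i, a i ∈ RA.gr (dg i)) :
    IsHomogY k SX q (r + ∑ i, dg i) (f a) := by
  intro ix x hx dgb b hb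
  have := hf _ (finSeq a) (finSeq_mem ha) ix x hx dgb b hb
  rw [sum_finSeq, finSeq_coe a] at this
  convert this using 2
  ring

/-- Right exactness of the partial Hochschild sequence with coefficients. -/
theorem exists_dXR_eq (hR : IsDXR k SX dXR) (hdR : IsDR k SX dR) (hex : ExactR k SX dR)
    {p q : ℕ} {r : ℤ} {f : XCoch k A B X p (q + 1)} (hf : IsHomogX k SX p (q + 1) r f)
    (h0 : dXR p (q + 1) r f = 0) :
    ∃ g : XCoch k A B X p q, IsHomogX k SX p q r g ∧ dXR p q r g = f := by
  have key : ∀ J : Fin p → (Σ i, Module.Basis.ofVectorSpaceIndex k (RA.gr i)),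
      ∃ g : YCoch k B X q, IsHomogY k SX q (r + ∑ i, (J i).1) g ∧
        dR q (r + ∑ i, (J i).1) g = f (fun i => homBasis RA.isInternal (J i)) := by
    intro J
    refine hex.2 q _ _ (hf.isHomogY fun i => homBasis_mem _ (J i)) ?_
    have h1 := dXR_apply_eq hR hdR r (∑ i, (J i).1) f (fun i => homBasis RA.isInternal (J i))
    rw [h0, zero_apply] at h1
    exact (smul_eq_zero.mp h1.symm).resolve_left (ε_ne_zero k _)
  choose g hg hdg using key
  refine ⟨multilinearExtend (homBasis RA.isInternal) p fun J => ε k (∑ i, (J i).1) • g J, ?_, ?_⟩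
  · intro dga a ha ix x hx dgb b hb
    have := multilinear_mem_of_homBasis RA.isInternal
      ((evalAt (fun j : Fin q => b j) ∘ₗ LinearMap.applyₗ x).compMultilinearMap
        (multilinearExtend (homBasis RA.isInternal) p fun J => ε k (∑ i, (J i).1) • g J))
      SX.gr (ix + (∑ j : Fin q, dgb j) + r) ?_ (fun i => dga i) (fun i => a i) (fun i => ha i)
    · rw [add_assoc, add_assoc, ← add_assoc ix]
      exact this
    · intro J
      have h1 := hg J ix x hx dgb b hb
      simp only [LinearMap.compMultilinearMap_apply, multilinearExtend_basis]
      refine Submodule.smul_mem _ _ ?_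
      convert h1 using 2
      ring
  · refine Module.Basis.ext_multilinear (fun _ => homBasis RA.isInternal) fun J => ?_
    rw [dXR_apply_eq hR hdR r (∑ i, (J i).1), multilinearExtend_basis, map_smul, smul_smul,
      ε_mul_self,
      one_smul, hdg]

/-- The embedding `Φ`. -/
def phi (EM : EndBModel k SX E) (p : ℕ) (r : ℤ) : MCoch k A E p →ₗ[k] XCoch k A B X p 0 :=
  ε k r • postComp A E (YCoch k B X 0) p
    ((LinearMap.llcomp k X X (MultilinearMap k (fun _ : Fin 0 => B) X) (constML k)).comp EM.toEnd)

variable {EM : EndBModel k SX E}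

theorem phi_apply (p : ℕ) (r : ℤ) (f : MCoch k A E p) (a : Fin p → A) (x : X) (b : Fin 0 → B) :
    phi EM p r f a x b = ε k r • EM.toEnd (f a) x := rfl

theorem evX_phi (p : ℕ) (r : ℤ) (f : MCoch k A E p) (a : ℕ → A) (x : X) (b : ℕ → B) :
    evX (phi EM p r f) a x b = ε k r • EM.toEnd (evSeq f a) x := rfl

theorem phi_injective (p : ℕ) (r : ℤ) {f : MCoch k A E p} (h : phi EM p r f = 0) : f = 0 := by
  refine MultilinearMap.ext fun a => EM.inj (LinearMap.ext fun x => ?_)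
  have := phi_apply (EM := EM) p r f a x Fin.elim0
  rw [h] at this
  rw [(smul_eq_zero.mp this.symm).resolve_left (ε_ne_zero k _)]
  simp

theorem IsHomogM.phi_mem {p : ℕ} {r : ℤ} {f : MCoch k A E p} (hf : IsHomogM k EM.SE p r f) :
    IsHomogX k SX p 0 r (phi EM p r f) := by
  intro dga a ha ix x hx dgb b hb
  have := EM.graded (hf dga a ha) hx
  rw [phi_apply]
  refine Submodule.smul_mem _ _ ?_
  convert this using 2
  simp
  ring

theorem exists_phi_eq (hR : IsDXR k SX dXR) (hdR : IsDR k SX dR) (hex : ExactR k SX dR)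
    {p : ℕ} {r : ℤ} {f : XCoch k A B X p 0} (hf : IsHomogX k SX p 0 r f)
    (h0 : dXR p 0 r f = 0) : ∃ e : MCoch k A E p, IsHomogM k EM.SE p r e ∧ phi EM p r e = f := by
  have key : ∀ J : Fin p → (Σ i, Module.Basis.ofVectorSpaceIndex k (RA.gr i)),
      ∃ e ∈ EM.SE.gr (r + ∑ i, (J i).1), ∀ x b,
        EM.toEnd e x = f (fun i => homBasis RA.isInternal (J i)) x b := by
    intro J
    have hY := hf.isHomogY fun i => homBasis_mem RA.isInternal (J i)
    have h1 := dXR_apply_eq hR hdR r (∑ i, (J i).1) f (fun i => homBasis RA.isInternal (J i))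
    rw [h0, zero_apply] at h1
    have h2 := (hex.1 _ _ hY).mp ((smul_eq_zero.mp h1.symm).resolve_left (ε_ne_zero k _))
    obtain ⟨e, he, h⟩ := EM.surj (r + ∑ i, (J i).1)
      (evalAt (fun j : Fin 0 => j.elim0) ∘ₗ
        f (fun i => homBasis RA.isInternal (J i))) h2 (fun i x hx => by
          have := hY i x hx (fun _ => 0) (fun _ => 0) (fun _ => Submodule.zero_mem _)
          rw [Fin.sum_univ_zero, add_zero] at this
          convert this using 2
          exact congrArg (f (fun i => homBasis RA.isInternal (J i)) x) (Subsingleton.elim _ _))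
    refine ⟨e, he, fun x b => ?_⟩
    rw [h, Subsingleton.elim b fun j : Fin 0 => j.elim0]
    rfl
  choose e he h using key
  refine ⟨multilinearExtend (homBasis RA.isInternal) p fun J => ε k r • e J, ?_, ?_⟩
  · intro dg a ha
    refine multilinear_mem_of_homBasis RA.isInternal _ EM.SE.gr r (fun J => ?_) (fun i => dg i)
      (fun i => a i) (fun i => ha i)
    rw [multilinearExtend_basis, add_comm]
    exact Submodule.smul_mem _ _ (he J)
  · refine Module.Basis.ext_multilinear (fun _ => homBasis RA.isInternal) fun J =>
      LinearMap.ext fun x => MultilinearMap.ext fun b => ?_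
    rw [phi_apply, multilinearExtend_basis, map_smul, LinearMap.smul_apply, ε_smul_smul, h]

theorem dXR_phi (hR : IsDXR k SX dXR) {p : ℕ} {r : ℤ} {f : MCoch k A E p}
    (hf : IsHomogM k EM.SE p r f) (s : ℤ) : dXR p 0 s (phi EM p r f) = 0 := by
  refine evX_ext SX fun dga a ha ix x hx dgb b hb => ?_
  rw [hR.evX_eq, evX_phi, evX_phi, evX_zero, EM.rlin (hf dga a ha)]
  rw [Finset.range_zero, Finset.sum_empty, map_smul, add_zero, ← add_smul,
    show ((0 : ℕ) : ℤ) + s - 1 = s - 1 by simp, ε_sub, ε_one]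
  simp

theorem dXL_phi (hL : IsDXL k SX dXL) (p : ℕ) (r : ℤ) (f : MCoch k A E p) :
    dXL p 0 r (phi EM p r f) = -phi EM (p + 1) r (hochDiff EM.SE p r f) := by
  refine evX_ext SX fun dga a ha ix x hx dgb b hb => ?_
  have e1 : evX (-phi EM (p + 1) r (hochDiff EM.SE p r f)) a x b
      = -evX (phi EM (p + 1) r (hochDiff EM.SE p r f)) a x b := rfl
  rw [e1, hL.evX_eq _ ha, evX_phi, evX_phi, evX_phi, evSeq_hochDiff EM.SE p r f ha]
  simp only [evX_phi, map_add, map_smul, map_sum, LinearMap.add_apply, LinearMap.smul_apply,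
    LinearMap.sum_apply, EM.actL_eq, EM.actR_eq, smul_add, neg_add, ← neg_smul, smul_smul,
    Finset.smul_sum, ← Finset.sum_neg_distrib]
  simp only [← ε_add]
  refine congrArg₂ _ (congrArg₂ _ ?_ (Finset.sum_congr rfl fun i _ => ?_)) ?_
  · refine congrArg (· • _) (ε_congr_neg ⟨0, ?_⟩)
    push_cast
    ring
  · refine congrArg (· • _) (ε_congr_neg ⟨0, ?_⟩)
    push_cast
    ring
  · refine congrArg (· • _) (ε_congr_neg ⟨0, ?_⟩)
    push_cast
    ring

theorem pdX_phi (hp : IsPdX k SX pdX) {p : ℕ} {r : ℤ} {f : MCoch k A E p}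
    (hf : IsHomogM k EM.SE p r f) :
    pdX p 0 r (phi EM p r f) = -phi EM p (r + 1) (intDiff EM.SE p r f) := by
  refine evX_ext SX fun dga a ha ix x hx dgb b hb => ?_
  have e1 : evX (-phi EM p (r + 1) (intDiff EM.SE p r f)) a x b
      = -evX (phi EM p (r + 1) (intDiff EM.SE p r f)) a x b := rfl
  rw [e1, hp.evX_eq _ ha hx hb, evX_phi, evX_phi, evX_phi, evSeq_intDiff EM.SE p r f ha]
  simp only [evX_phi, map_sub, map_smul, map_sum, LinearMap.sub_apply, LinearMap.smul_apply,
    LinearMap.sum_apply, EM.d_eq _ (hf dga a ha), smul_add, smul_sub, smul_smul,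
    Finset.smul_sum, Finset.range_zero, Finset.sum_empty, add_zero]
  simp only [← ε_add]
  rw [← Finset.sum_range (fun i => dga i)]
  have e2 : ε k (r + 1 + (∑ i ∈ Finset.range p, dga i + r))
      = -ε k (r + (∑ i ∈ Finset.range p, dga i + r)) := ε_congr_neg ⟨0, by ring⟩
  have e3 : ∀ i : ℕ, ε k (r + 1 + (r + ∑ j ∈ Finset.range i, dga j))
      = -ε k (r + (∑ j ∈ Finset.range i, dga j + r)) := fun i => ε_congr_neg ⟨0, by ring⟩
  have e4 : ε k (r + 1) = -ε k r := ε_congr_neg ⟨0, by ring⟩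
  simp only [e2, e3, e4, neg_smul, Finset.sum_neg_distrib]
  abel

end Phi

end Connecting

section LeftEdge

variable {k}

section TotPhi

variable {SX : ABBimod k RA RB X} {E : Type} [AddCommGroup E] [Module k E]
  {dXL : ∀ (p q : ℕ) (r : ℤ), XCoch k A B X p q →ₗ[k] XCoch k A B X (p + 1) q}
  {dXR : ∀ (p q : ℕ) (r : ℤ), XCoch k A B X p q →ₗ[k] XCoch k A B X p (q + 1)}
  {pdX : ∀ (p q : ℕ) (r : ℤ), XCoch k A B X p q →ₗ[k] XCoch k A B X p q}
  {dR : ∀ (q : ℕ) (r : ℤ), YCoch k B X q →ₗ[k] YCoch k B X (q + 1)}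

/-- Cochains concentrated in the columns `q ≤ N`. -/
def columns (k A B X : Type) [Field k] [Ring A] [Algebra k A] [Ring B] [Algebra k B]
    [AddCommGroup X] [Module k X] (N : ℕ) : Submodule k (TotXCoch k A B X) where
  carrier := {c | ∀ p q, N < q → c p q = 0}
  add_mem' := fun {c c'} h h' p q hq => by
    rw [Pi.add_apply, Pi.add_apply, h p q hq, h' p q hq, add_zero]
  zero_mem' := fun p q hq => rfl
  smul_mem' := fun x c h p q hq => by rw [Pi.smul_apply, Pi.smul_apply, h p q hq, smul_zero]

/-- Extension by zero of a family of cochains in column `0`. -/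
def columnZero : (∀ p, XCoch k A B X p 0) →ₗ[k] TotXCoch k A B X :=
  LinearMap.pi fun p => LinearMap.pi fun q => match q with
    | 0 => LinearMap.proj p
    | _ + 1 => 0

/-- The embedding `Φ` on total cochains of degree `n`. -/
def totPhi (EM : EndBModel k SX E) (n : ℤ) : TotMCoch k A E →ₗ[k] TotXCoch k A B X :=
  columnZero ∘ₗ LinearMap.pi fun p => phi EM p (n - p) ∘ₗ LinearMap.proj p

variable {EM : EndBModel k SX E}

theorem totPhi_zero (n : ℤ) (c : TotMCoch k A E) (p : ℕ) :
    totPhi EM n c p 0 = phi EM p (n - p) (c p) := rfl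

theorem totPhi_succ (n : ℤ) (c : TotMCoch k A E) (p q : ℕ) : totPhi EM n c p (q + 1) = 0 := rfl

theorem totPhi_mem {n m : ℤ} {c : TotMCoch k A E} (hm : n + 1 = m) (hc : c ∈ totK EM.SE n) :
    totPhi EM n c ∈ totXK SX m := by
  obtain ⟨h, N, hN⟩ := hc
  refine ⟨fun p q => ?_, N, fun p q hpq => ?_⟩
  · cases q with
    | zero => exact (h p).phi_mem.congr (by push_cast; omega)
    | succ q => exact (homogX SX p (q + 1) _).zero_mem
  · cases q with
    | zero => rw [totPhi_zero, hN p (by omega), map_zero]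
    | succ q => rfl

theorem totDX_totPhi (hL : IsDXL k SX dXL) (hR : IsDXR k SX dXR) (hp : IsPdX k SX pdX) {n m : ℤ}
    {c : TotMCoch k A E} (hm : n + 1 = m) (hc : c ∈ totK EM.SE n) :
    totDX dXL dXR pdX m (totPhi EM n c) = -totPhi EM m (totDiff EM.SE n c) := by
  have hr : ∀ p : ℕ, m - p - (0 : ℕ) - 1 = n - p := fun p => by push_cast; omega
  have h1 : ∀ p, pdX p 0 (m - p - (0 : ℕ) - 1) (phi EM p (n - p) (c p)) =
      -phi EM p (m - p) (totInt EM.SE n c p) := fun p => by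
    rw [hr, pdX_phi hp (hc.1 p), show n - p + 1 = m - p by omega]
    rfl
  have h2 : ∀ p, totXL dXL m (totPhi EM n c) p 0 = -phi EM p (m - p) (totHoch EM.SE n c p) := by
    intro p
    cases p with
    | zero =>
      exact ((congrArg Neg.neg (map_zero (phi EM 0 (m - (0 : ℕ))))).trans
        (neg_zero (G := XCoch k A B X 0 0))).symm
    | succ p =>
      rw [totXL_succ, totPhi_zero, hr, dXL_phi hL, totHoch_succ]
      congr 3
      push_cast
      omega
  have h3 : ∀ p q, totXL dXL m (totPhi EM n c) p (q + 1) = 0 := by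
    intro p q
    cases p with
    | zero => rfl
    | succ p => rw [totXL_succ, totPhi_succ, map_zero]
  funext p q
  rw [totDX_apply, totPdX_apply]
  rcases q with _ | _ | q
  · rw [totXR_zero, totPhi_zero, h1, h2, add_zero, Pi.neg_apply, Pi.neg_apply, totPhi_zero,
      totDiff, LinearMap.add_apply, Pi.add_apply, map_add]
    exact (neg_add (α := XCoch k A B X p 0) _ _).symm
  · rw [totXR_succ, totPhi_zero, dXR_phi hR (hc.1 p), totPhi_succ, map_zero, h3, add_zero,
      add_zero]
    exact (neg_zero (G := XCoch k A B X p 1)).symm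
  · rw [totXR_succ, totPhi_succ, totPhi_succ, map_zero, map_zero, h3, zero_add, add_zero]
    exact (neg_zero (G := XCoch k A B X p (q + 2))).symm

theorem totXL_mem_columns {n : ℤ} {N : ℕ} {c : TotXCoch k A B X} (hc : c ∈ columns k A B X N) :
    totXL dXL n c ∈ columns k A B X N := by
  intro p q hq
  cases p with
  | zero => rfl
  | succ p => rw [totXL_succ, hc p q hq, map_zero]

theorem totPdX_mem_columns {n : ℤ} {N : ℕ} {c : TotXCoch k A B X} (hc : c ∈ columns k A B X N) :
    totPdX pdX n c ∈ columns k A B X N := fun p q hq => by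
  rw [totPdX_apply, hc p q hq, map_zero]

/-- The differential of a cochain in the columns `q ≤ N` is given in column `N + 1` by `dXR`. -/
theorem totDX_apply_of_mem_columns {n : ℤ} {N : ℕ} {c : TotXCoch k A B X}
    (hc : c ∈ columns k A B X N) (p : ℕ) :
    totDX dXL dXR pdX n c p (N + 1) = dXR p N (n - p - N - 1) (c p N) := by
  rw [totDX_apply, totPdX_mem_columns hc p _ N.lt_succ_self,
    totXL_mem_columns hc p _ N.lt_succ_self, zero_add, zero_add, totXR_succ]

theorem exists_sub_totDX_mem_columns (hR : IsDXR k SX dXR)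
    (hdR : IsDR k SX dR) (hex : ExactR k SX dR) {n m : ℤ} {N : ℕ} {c : TotXCoch k A B X}
    (hm : n + 1 = m) (hc : c ∈ totXK SX m) (hcN : c ∈ columns k A B X (N + 1))
    (hDc : totDX dXL dXR pdX m c ∈ columns k A B X 0) :
    ∃ g ∈ totXK SX n, c - totDX dXL dXR pdX n g ∈ columns k A B X N := by
  have key : ∀ p, ∃ g : XCoch k A B X p N, IsHomogX k SX p N (n - p - N - 1) g ∧
      dXR p N (n - p - N - 1) g = c p (N + 1) ∧ (c p (N + 1) = 0 → g = 0) := by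
    intro p
    by_cases h0 : c p (N + 1) = 0
    · exact ⟨0, (homogX SX p N _).zero_mem, by rw [h0, map_zero], fun _ => rfl⟩
    · have hr : m - p - (N + 1 : ℕ) - 1 = n - p - N - 1 := by push_cast; omega
      have h1 := totDX_apply_of_mem_columns (dXL := dXL) (dXR := dXR) (pdX := pdX) (n := m) hcN p
      rw [hDc p _ (by omega)] at h1
      obtain ⟨g, hg, h⟩ := exists_dXR_eq hR hdR hex (hc.1 p (N + 1)) h1.symm
      rw [hr] at hg h
      exact ⟨g, hg, h, fun h' => absurd h' h0⟩
  choose g hg hdg hg0 using key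
  have hcol : (fun p => Pi.single N (g p) : TotXCoch k A B X) ∈ columns k A B X N :=
    fun p q hq => Pi.single_eq_of_ne hq.ne' _
  obtain ⟨-, L, hL⟩ := hc
  refine ⟨fun p => Pi.single N (g p), ⟨fun p q => ?_, L + N, fun p q hpq => ?_⟩, fun p q hq => ?_⟩
  · by_cases h : q = N
    · subst h
      beta_reduce
      rw [Pi.single_eq_same]
      exact hg p
    · beta_reduce
      rw [Pi.single_eq_of_ne h]
      exact (homogX SX p q _).zero_mem
  · by_cases h : q = N
    · subst h
      beta_reduce
      rw [Pi.single_eq_same]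
      exact hg0 p (hL p _ (by omega))
    · exact Pi.single_eq_of_ne h _
  · obtain ⟨q, rfl⟩ : ∃ q', q = q' + 1 := ⟨q - 1, by omega⟩
    by_cases h : q = N
    · subst h
      rw [Pi.sub_apply, Pi.sub_apply, totDX_apply_of_mem_columns hcol, Pi.single_eq_same, hdg]
      exact sub_self (G := XCoch k A B X p (q + 1)) _
    · rw [Pi.sub_apply, Pi.sub_apply, hcN p _ (by omega), totDX_apply,
        totPdX_mem_columns hcol p _ (by omega), totXL_mem_columns hcol p _ (by omega), totXR_succ,
        Pi.single_eq_of_ne h, map_zero, add_zero, add_zero]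
      exact sub_zero (G := XCoch k A B X p (q + 1)) _

theorem exists_totPhi_eq (hR : IsDXR k SX dXR) (hdR : IsDR k SX dR) (hex : ExactR k SX dR)
    {n m : ℤ} {c : TotXCoch k A B X} (hm : n + 1 = m) (hc : c ∈ totXK SX m)
    (hc0 : c ∈ columns k A B X 0) (hDc : totDX dXL dXR pdX m c ∈ columns k A B X 0) :
    ∃ e ∈ totK EM.SE n, totPhi EM n e = c := by
  have key : ∀ p : ℕ, ∃ e : MCoch k A E p, IsHomogM k EM.SE p (n - p) e ∧
      phi EM p (n - p) e = c p 0 := by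
    intro p
    have hr : m - p - (0 : ℕ) - 1 = n - p := by push_cast; omega
    have h1 := totDX_apply_of_mem_columns (dXL := dXL) (dXR := dXR) (pdX := pdX) (n := m) hc0 p
    rw [hDc p _ (by omega)] at h1
    have h2 := exists_phi_eq (EM := EM) hR hdR hex (hc.1 p 0) h1.symm
    rwa [hr] at h2
  choose e he h using key
  obtain ⟨-, L, hL⟩ := hc
  refine ⟨e, ⟨he, L, fun p hp => phi_injective p (n - p) ((h p).trans (hL p 0 hp))⟩, ?_⟩
  funext p q
  cases q with
  | zero => exact h p
  | succ q => exact (hc0 p _ q.succ_pos).symm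

/-- The embedding of `Hoch(A, Hom_B(X, X))` into `Hoch(A, X, B)` is a quasi-isomorphism. -/
theorem isShiftQIso_totPhi (hD : IsCpx (V := TotXCoch k A B X) (totXK SX) (totDX dXL dXR pdX))
    (hL : IsDXL k SX dXL) (hR : IsDXR k SX dXR) (hp : IsPdX k SX pdX)
    (hdR : IsDR k SX dR) (hex : ExactR k SX dR) :
    IsShiftQIso (V := TotMCoch k A E) (W := TotXCoch k A B X) (totK EM.SE) (totDiff EM.SE)
      (totXK SX) (totDX dXL dXR pdX) (totPhi EM) := by
  refine IsShiftQIso.of_filtration hD (columns k A B X) totPhi_mem (totDX_totPhi hL hR hp)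
    (fun {n c} h => funext fun p => phi_injective p (n - p) (congrFun (congrFun h p) 0))
    (fun n c p q hq => ?_) (fun {n c} hc => ?_)
    (exists_sub_totDX_mem_columns hR hdR hex) (exists_totPhi_eq hR hdR hex)
  · obtain ⟨q, rfl⟩ : ∃ q', q = q' + 1 := ⟨q - 1, by omega⟩
    rfl
  · obtain ⟨-, N, hN⟩ := hc
    exact ⟨N, fun p q hq => hN p q (by omega)⟩

/-- The connecting map `Hoch(A) → Hoch(A, X, B)` in total degree `n`. -/
def totAX (dAX : ∀ (p : ℕ) (r : ℤ), Coch k A (p : ℤ) →ₗ[k] XCoch k A B X p 0) (n : ℤ) :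
    TotMCoch k A A →ₗ[k] TotXCoch k A B X :=
  columnZero ∘ₗ LinearMap.pi fun p => dAX p (n - p) ∘ₗ LinearMap.proj p

theorem totAX_eq {dAX : ∀ (p : ℕ) (r : ℤ), Coch k A (p : ℤ) →ₗ[k] XCoch k A B X p 0}
    (hAX : IsDAX k SX dAX) {ρA : A →ₗ[k] E} (hρ : IsRhoA k SX EM ρA) (n : ℤ) :
    totAX dAX n = totPhi EM n ∘ₗ totPost A ρA := by
  refine LinearMap.ext fun c => ?_
  funext p q
  cases q with
  | succ q => rfl
  | zero =>
    refine MultilinearMap.ext fun a => LinearMap.ext fun x => MultilinearMap.ext fun b => ?_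
    have h := hAX p (n - p) (c p) (finSeq a) x b
    rw [finSeq_coe a] at h
    have h1 : c p (fun i => finSeq a i) = c p a := congrArg (c p) (finSeq_coe a)
    exact h.trans (congrArg (ε k (n - p) • ·)
      ((congrArg (fun y => SX.actL y x) h1).trans (hρ (c p a) x).symm))

/-- If the left action map is weakly cone-nilpotent and the right partial Hochschild sequence is
exact, then the connecting map `Hoch(A) → Hoch(A, X, B)` is a quasi-isomorphism. -/
theorem isShiftQIso_totAX (hD : IsCpx (V := TotXCoch k A B X) (totXK SX) (totDX dXL dXR pdX))
    (hL : IsDXL k SX dXL) (hR : IsDXR k SX dXR) (hp : IsPdX k SX pdX)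
    (hdR : IsDR k SX dR) (hex : ExactR k SX dR)
    {dAX : ∀ (p : ℕ) (r : ℤ), Coch k A (p : ℤ) →ₗ[k] XCoch k A B X p 0} (hAX : IsDAX k SX dAX)
    {ρA : A →ₗ[k] E} (hρ : IsRhoA k SX EM ρA) (hb : IsBimodHom k (RA.toBimod k) EM.SE ρA)
    (hw : WeaklyConeNilpotent k (RA.toBimod k) EM.SE ρA) :
    IsShiftQIso (V := TotMCoch k A A) (W := TotXCoch k A B X) (totK (RA.toBimod k))
      (totDiff (RA.toBimod k)) (totXK SX) (totDX dXL dXR pdX) (totAX dAX) := by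
  rw [show totAX dAX = _ from funext (totAX_eq hAX hρ)]
  exact (isShiftQIso_totPhi hD hL hR hp hdR hex).comp hb.isCpxHom (WeaklyConeNilpotent.isQIso hb hw)

end TotPhi

end LeftEdge

section Slices

variable {k}

section Twist

variable {V : Type} [AddCommGroup V] [Module k V] {gr : ℤ → Submodule k V}

/-- The involution `v ↦ (-1)^{s|v|} v`. -/
def twist (h : DirectSum.IsInternal gr) (s : ℤ) : V →ₗ[k] V :=
  gradedLift h (fun i => ε k (s * i) • (gr i).subtype)

theorem twist_apply (h : DirectSum.IsInternal gr) (s : ℤ) {i : ℤ} {v : V} (hv : v ∈ gr i) :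
    twist h s v = ε k (s * i) • v := by
  rw [twist, gradedLift_apply h _ hv]; rfl

theorem twist_mem (h : DirectSum.IsInternal gr) (s : ℤ) {i : ℤ} {v : V} (hv : v ∈ gr i) :
    twist h s v ∈ gr i := by
  rw [twist_apply h s hv]; exact (gr i).smul_mem _ hv

theorem twist_twist (h : DirectSum.IsInternal gr) (s : ℤ) (v : V) :
    twist h s (twist h s v) = v := by
  have : (twist h s).comp (twist h s) = LinearMap.id := linear_ext_hom h fun i v hv => by
    simp [twist_apply h s hv, ε_smul_smul]
  exact LinearMap.congr_fun this v

theorem prod_ε_mul (s : ℤ) {p : ℕ} (dg : Fin p → ℤ) :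
    ∏ i, ε k (s * dg i) = ε k (s * ∑ i, dg i) := by
  induction p with
  | zero => simp [ε_zero]
  | succ p ih => rw [Fin.prod_univ_succ, Fin.sum_univ_succ, mul_add, ε_add, ih]

theorem map_twist {W : Type} [AddCommGroup W] [Module k W] (h : DirectSum.IsInternal gr) (s : ℤ)
    {p : ℕ} (f : MultilinearMap k (fun _ : Fin p => V) W) {dg : Fin p → ℤ} {a : Fin p → V}
    (ha : ∀ i, a i ∈ gr (dg i)) :
    f (fun i => twist h s (a i)) = ε k (s * ∑ i, dg i) • f a := by
  have h1 : (fun i => twist h s (a i)) = fun i => ε k (s * dg i) • a i :=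
    funext fun i => twist_apply h s (ha i)
  rw [h1, MultilinearMap.map_smul_univ]
  rw [prod_ε_mul]

end Twist

section Slice

variable {SX : ABBimod k RA RB X} {p q : ℕ}

/-- Twisting of a cochain in `Hom(A^{⊗p} ⊗ X, X)` by the sign `(-1)^{s(|a₁| + ⋯ + |x|)}`. -/
def twistZ (SX : ABBimod k RA RB X) (s : ℤ) (g : ZCoch k A X p) : ZCoch k A X p :=
  (LinearMap.lcomp k X (twist SX.isInternal s)).compMultilinearMap
    (g.compLinearMap fun _ => twist RA.isInternal s)

theorem twistZ_apply (s : ℤ) (g : ZCoch k A X p) (a : Fin p → A) (x : X) :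
    twistZ SX s g a x = g (fun i => twist RA.isInternal s (a i)) (twist SX.isInternal s x) := rfl

theorem twistZ_apply_of_mem (s : ℤ) (g : ZCoch k A X p) {dg : Fin p → ℤ} {a : Fin p → A}
    (ha : ∀ i, a i ∈ RA.gr (dg i)) {ix : ℤ} {x : X} (hx : x ∈ SX.gr ix) :
    twistZ SX s g a x = ε k (s * (∑ i, dg i + ix)) • g a x := by
  rw [twistZ_apply, map_twist RA.isInternal s g ha, twist_apply SX.isInternal s hx, map_smul,
    LinearMap.smul_apply, smul_smul, ← ε_add]
  congr 2
  ring

theorem twistZ_twistZ (s : ℤ) (g : ZCoch k A X p) : twistZ SX s (twistZ SX s g) = g := by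
  refine MultilinearMap.ext fun a => LinearMap.ext fun x => ?_
  simp only [twistZ_apply, twist_twist]

/-- The restriction of a cochain in `Hoch(A, X, B)` to a fixed tuple of elements of `B`. -/
def slice (f : XCoch k A B X p q) (b : Fin q → B) : ZCoch k A X p :=
  (LinearMap.llcomp k X (MultilinearMap k (fun _ : Fin q => B) X) X
    (evalAt b)).compMultilinearMap f

theorem twistZ_smul (s : ℤ) (c : k) (g : ZCoch k A X p) :
    twistZ SX s (c • g) = c • twistZ SX s g := rfl

theorem slice_apply (f : XCoch k A B X p q) (b : Fin q → B) (a : Fin p → A) (x : X) :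
    slice f b a x = f a x b := rfl

theorem slice_ext {f g : XCoch k A B X p q}
    (h : ∀ J : Fin q → (Σ i, Module.Basis.ofVectorSpaceIndex k (RB.gr i)),
      slice f (fun j => homBasis RB.isInternal (J j)) =
      slice g (fun j => homBasis RB.isInternal (J j))) : f = g :=
  MultilinearMap.ext fun a => LinearMap.ext fun x =>
    Module.Basis.ext_multilinear (fun _ => homBasis RB.isInternal) fun J =>
      LinearMap.congr_fun (DFunLike.congr_fun (h J) a) x

/-- The cochain in `Hoch(A, X, B)` with prescribed slices over basis tuples. -/
def assemble (RB : DGAlgebra k B)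
    (φ : (Fin q → (Σ i, Module.Basis.ofVectorSpaceIndex k (RB.gr i))) → ZCoch k A X p) :
    XCoch k A B X p q where
  toFun a :=
    { toFun := fun x => multilinearExtend (homBasis RB.isInternal) q fun J => φ J a x
      map_add' := fun x y => by
        rw [← map_add]
        exact congrArg _ (funext fun J => map_add _ _ _)
      map_smul' := fun c x => by
        rw [RingHom.id_apply, ← map_smul]
        exact congrArg _ (funext fun J => map_smul _ _ _) }
  map_update_add' a i y z := LinearMap.ext fun x => by
    simp only [LinearMap.add_apply, LinearMap.coe_mk, AddHom.coe_mk]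
    rw [← map_add]
    refine congrArg _ (funext fun J => ?_)
    rw [MultilinearMap.map_update_add]
    rfl
  map_update_smul' a i c y := LinearMap.ext fun x => by
    simp only [LinearMap.smul_apply, LinearMap.coe_mk, AddHom.coe_mk]
    rw [← map_smul]
    refine congrArg _ (funext fun J => ?_)
    rw [MultilinearMap.map_update_smul]
    rfl

theorem assemble_apply
    (φ : (Fin q → (Σ i, Module.Basis.ofVectorSpaceIndex k (RB.gr i))) → ZCoch k A X p)
    (a : Fin p → A) (x : X) :
    assemble RB φ a x = multilinearExtend (homBasis RB.isInternal) q fun J => φ J a x := rfl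

theorem slice_assemble
    (φ : (Fin q → (Σ i, Module.Basis.ofVectorSpaceIndex k (RB.gr i))) → ZCoch k A X p)
    (J : Fin q → (Σ i, Module.Basis.ofVectorSpaceIndex k (RB.gr i))) :
    slice (assemble RB φ) (fun j => homBasis RB.isInternal (J j)) = φ J :=
  MultilinearMap.ext fun a => LinearMap.ext fun x => by
    rw [slice_apply, assemble_apply, multilinearExtend_basis]

theorem assemble_mem {r : ℤ}
    {φ : (Fin q → (Σ i, Module.Basis.ofVectorSpaceIndex k (RB.gr i))) → ZCoch k A X p}
    (h : ∀ J, IsHomogZ k SX p (r + ∑ j, (J j).1) (φ J)) :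
    IsHomogX k SX p q r (assemble RB φ) := by
  intro dga a ha ix x hx dgb b hb
  have := multilinear_mem_of_homBasis RB.isInternal (assemble RB φ (fun i => a i) x) SX.gr
    ((∑ i : Fin p, dga i) + ix + r) (fun J => ?_) (fun j => dgb j) (fun j => b j) (fun j => hb j)
  · convert this using 2
    ring
  · rw [assemble_apply, multilinearExtend_basis]
    convert h J dga a ha ix x hx using 2
    ring

theorem IsHomogZ.smul_mem {r : ℤ} {g : ZCoch k A X p} (hg : IsHomogZ k SX p r g) (c : k) :
    IsHomogZ k SX p r (c • g) :=
  fun dga a ha ix x hx => Submodule.smul_mem _ _ (hg dga a ha ix x hx)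

theorem IsHomogZ.twistZ_mem {r : ℤ} {g : ZCoch k A X p} (hg : IsHomogZ k SX p r g) (s : ℤ) :
    IsHomogZ k SX p r (twistZ SX s g) :=
  fun dga a ha ix x hx => hg dga _ (fun i => twist_mem RA.isInternal s (ha i)) ix _
    (twist_mem SX.isInternal s hx)

theorem IsHomogX.isHomogZ {r : ℤ} {f : XCoch k A B X p q} (hf : IsHomogX k SX p q r f)
    {dg : Fin q → ℤ} {b : Fin q → B} (hb : ∀ j, b j ∈ RB.gr (dg j)) :
    IsHomogZ k SX p (r + ∑ j, dg j) (slice f b) := by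
  intro dga a ha ix x hx
  have := hf dga a ha ix x hx _ (finSeq b) (finSeq_mem hb)
  rw [sum_finSeq, finSeq_coe b] at this
  rw [slice_apply]
  convert this using 2
  ring

variable {dXL : ∀ (p q : ℕ) (r : ℤ), XCoch k A B X p q →ₗ[k] XCoch k A B X (p + 1) q}
  {dL : ∀ (p : ℕ) (r : ℤ), ZCoch k A X p →ₗ[k] ZCoch k A X (p + 1)}

theorem twistZ_slice_dXL (hL : IsDXL k SX dXL) (hdL : IsDL k SX dL) (r s : ℤ)
    (f : XCoch k A B X p q) (b : Fin q → B) :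
    twistZ SX s (slice (dXL p q r f) b) = ε k (q + s) • dL p (r + s) (twistZ SX s (slice f b)) := by
  refine multilinear_ext_hom RA.isInternal fun dga a ha =>
    linear_ext_hom SX.isInternal fun ix x hx => ?_
  have h1 := hL p q r f dga a ha x (finSeq b)
  rw [finSeq_coe b] at h1
  have h2 := hdL p (r + s) (twistZ SX s (slice f b)) dga a ha x
  have e0 : ∑ i : Fin (p + 1), dga i = dga 0 + ∑ i : Fin p, dga ((i : ℕ) + 1) :=
    Fin.sum_univ_succ _
  have e1 : ∑ i : Fin (p + 1), dga i = ∑ i : Fin p, dga i + dga p := Fin.sum_univ_castSucc _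
  rw [twistZ_apply_of_mem s _ (fun i => ha i) hx, slice_apply, h1, smul_apply,
    LinearMap.smul_apply, h2]
  rw [twistZ_apply_of_mem s _ (fun i : Fin p => ha ((i : ℕ) + 1)) hx,
    twistZ_apply_of_mem s _ (fun i : Fin p => ha i) (SX.actL_mem (ha p) hx)]
  simp only [smul_add, Finset.smul_sum, slice_apply, map_smul, smul_smul, ← ε_add]
  refine congrArg₂ _ (congrArg₂ _ ?_ (Finset.sum_congr rfl fun i _ => ?_)) ?_
  · refine congrArg (· • _) (ε_congr ?_)
    rw [e0]
    exact ⟨-s, by ring⟩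
  · have h3 := twistZ_apply_of_mem (SX := SX) s (slice f b)
      (fun j : Fin p => seqFace_mem ha i j) hx
    have h4 : twistZ SX s (slice f b) (fun j => seqFace (i : ℕ) a j) x = _ := h3
    rw [sum_degFace p i i.2, slice_apply] at h4
    refine Eq.trans ?_ (congrArg (_ • ·) h4.symm)
    rw [smul_smul, ← ε_add]
    exact congrArg (· • _) (ε_congr ⟨-s, by ring⟩)
  · refine congrArg (· • _) (ε_congr ?_)
    rw [e1]
    exact ⟨-s, by ring⟩

/-- Left exactness of the partial Hochschild sequence with coefficients. -/
theorem exists_dXL_eq (hL : IsDXL k SX dXL) (hdL : IsDL k SX dL) (hex : ExactL k SX dL)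
    {r : ℤ} {f : XCoch k A B X (p + 1) q} (hf : IsHomogX k SX (p + 1) q r f)
    (h0 : dXL (p + 1) q r f = 0) :
    ∃ g : XCoch k A B X p q, IsHomogX k SX p q r g ∧ dXL p q r g = f := by
  have key : ∀ J : Fin q → (Σ i, Module.Basis.ofVectorSpaceIndex k (RB.gr i)),
      ∃ g : ZCoch k A X p, IsHomogZ k SX p (r + ∑ j, (J j).1) g ∧
        dL p (r + ∑ j, (J j).1) g =
          twistZ SX (∑ j, (J j).1) (slice f fun j => homBasis RB.isInternal (J j)) := by
    intro J
    refine hex.2 p _ _ ((hf.isHomogZ fun j => homBasis_mem _ (J j)).twistZ_mem _) ?_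
    have h1 := twistZ_slice_dXL hL hdL r (∑ j, (J j).1) f fun j => homBasis RB.isInternal (J j)
    rw [h0] at h1
    exact (smul_eq_zero.mp h1.symm).resolve_left (ε_ne_zero k _)
  choose g hg hdg using key
  refine ⟨assemble RB fun J => ε k (q + ∑ j, (J j).1) • twistZ SX (∑ j, (J j).1) (g J),
    assemble_mem fun J => ((hg J).twistZ_mem _).smul_mem _, slice_ext (RB := RB) fun J => ?_⟩
  generalize hG : (assemble RB fun J => ε k (q + ∑ j, (J j).1) •
    twistZ SX (∑ j, (J j).1) (g J)) = G
  have h2 : slice G (fun j => homBasis RB.isInternal (J j)) =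
      ε k (q + ∑ j, (J j).1) • twistZ SX (∑ j, (J j).1) (g J) := by
    rw [← hG, slice_assemble]
  have h1 := twistZ_slice_dXL hL hdL r (∑ j, (J j).1) G fun j => homBasis RB.isInternal (J j)
  rw [h2, twistZ_smul, twistZ_twistZ, map_smul, smul_smul, ε_mul_self, one_smul, hdg] at h1
  rw [← twistZ_twistZ (SX := SX) (∑ j, (J j).1) (slice (dXL p q r G) _), h1, twistZ_twistZ]

end Slice

end Slices

section RightSwap

variable {k}

/-! ### The embedding of `Hoch(B, Hom_A(X, X))` -/

section Psi

variable {SX : ABBimod k RA RB X} {E' : Type} [AddCommGroup E'] [Module k E']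
  {dXL : ∀ (p q : ℕ) (r : ℤ), XCoch k A B X p q →ₗ[k] XCoch k A B X (p + 1) q}
  {dXR : ∀ (p q : ℕ) (r : ℤ), XCoch k A B X p q →ₗ[k] XCoch k A B X p (q + 1)}
  {pdX : ∀ (p q : ℕ) (r : ℤ), XCoch k A B X p q →ₗ[k] XCoch k A B X p q}
  {dL : ∀ (p : ℕ) (r : ℤ), ZCoch k A X p →ₗ[k] ZCoch k A X (p + 1)}

/-- The cochain `(x, b) ↦ (-1)^{s|b|} f(b)(x)`. -/
def swapEval (EM : EndAModel k SX E') {q : ℕ} (f : MCoch k B E' q) (s : ℤ) :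
    X →ₗ[k] MultilinearMap k (fun _ : Fin q => B) X where
  toFun x := (EM.toEnd.flip x).compMultilinearMap (f.compLinearMap fun _ => twist RB.isInternal s)
  map_add' x y := by rw [map_add]; rfl
  map_smul' c x := by rw [map_smul]; rfl

/-- The cochain `(x, b) ↦ (-1)^{|x||b|} f(b)(x)`. -/
def gradedSwap (EM : EndAModel k SX E') {q : ℕ} (f : MCoch k B E' q) : YCoch k B X q :=
  gradedLift SX.isInternal fun i => swapEval EM f i ∘ₗ (SX.gr i).subtype

theorem gradedSwap_apply (EM : EndAModel k SX E') {q : ℕ} (f : MCoch k B E' q) {ix : ℤ} {x : X}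
    (hx : x ∈ SX.gr ix) (b : Fin q → B) :
    gradedSwap EM f x b = EM.toEnd (f fun j => twist RB.isInternal ix (b j)) x :=
  congrArg (fun g : MultilinearMap k (fun _ : Fin q => B) X => g b)
    (gradedLift_apply SX.isInternal _ hx)

theorem gradedSwap_apply_of_mem (EM : EndAModel k SX E') {q : ℕ} (f : MCoch k B E' q) {ix : ℤ}
    {x : X} (hx : x ∈ SX.gr ix) {dg : Fin q → ℤ} {b : Fin q → B} (hb : ∀ j, b j ∈ RB.gr (dg j)) :
    gradedSwap EM f x b = ε k (ix * ∑ j, dg j) • EM.toEnd (f b) x := by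
  rw [gradedSwap_apply EM f hx, map_twist RB.isInternal ix f hb, map_smul, LinearMap.smul_apply]

theorem gradedSwap_add (EM : EndAModel k SX E') {q : ℕ} (f g : MCoch k B E' q) :
    gradedSwap EM (f + g) = gradedSwap EM f + gradedSwap EM g :=
  linear_ext_hom SX.isInternal fun ix x hx => MultilinearMap.ext fun b => by
    rw [LinearMap.add_apply, add_apply, gradedSwap_apply EM _ hx, gradedSwap_apply EM _ hx,
      gradedSwap_apply EM _ hx, add_apply, map_add, LinearMap.add_apply]

theorem gradedSwap_smul (EM : EndAModel k SX E') {q : ℕ} (c : k) (f : MCoch k B E' q) :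
    gradedSwap EM (c • f) = c • gradedSwap EM f :=
  linear_ext_hom SX.isInternal fun ix x hx => MultilinearMap.ext fun b => by
    rw [LinearMap.smul_apply, smul_apply, gradedSwap_apply EM _ hx, gradedSwap_apply EM _ hx,
      smul_apply, map_smul, LinearMap.smul_apply]

/-- The embedding `Ψ`. -/
def psi (EM : EndAModel k SX E') (q : ℕ) (r : ℤ) : MCoch k B E' q →ₗ[k] XCoch k A B X 0 q where
  toFun f := ε k (q + r - 1) • MultilinearMap.constOfIsEmpty k _ (gradedSwap EM f)
  map_add' f g := by rw [gradedSwap_add, ← smul_add]; rfl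
  map_smul' c f := by
    rw [gradedSwap_smul, RingHom.id_apply, smul_comm c (ε k (q + r - 1))]; rfl

variable {EM : EndAModel k SX E'}

theorem psi_apply (q : ℕ) (r : ℤ) (f : MCoch k B E' q) (a : Fin 0 → A) (x : X) (b : Fin q → B) :
    psi EM q r f a x b = ε k (q + r - 1) • gradedSwap EM f x b := rfl

theorem psi_apply_of_mem (q : ℕ) (r : ℤ) (f : MCoch k B E' q) (a : Fin 0 → A) {ix : ℤ} {x : X}
    (hx : x ∈ SX.gr ix) {dg : Fin q → ℤ} {b : Fin q → B} (hb : ∀ j, b j ∈ RB.gr (dg j)) :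
    psi EM q r f a x b = ε k (q + r - 1 + ix * ∑ j, dg j) • EM.toEnd (f b) x := by
  rw [psi_apply, gradedSwap_apply_of_mem EM f hx hb, smul_smul, ← ε_add]

theorem evX_psi (q : ℕ) (r : ℤ) (f : MCoch k B E' q) (a : ℕ → A) {ix : ℤ} {x : X}
    (hx : x ∈ SX.gr ix) {dg : ℕ → ℤ} {b : ℕ → B} (hb : ∀ j, b j ∈ RB.gr (dg j)) :
    evX (psi EM q r f) a x b =
      ε k (q + r - 1 + ix * ∑ j ∈ Finset.range q, dg j) • EM.toEnd (evSeq f b) x := by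
  rw [Finset.sum_range]
  exact psi_apply_of_mem q r f _ hx fun j => hb j

theorem psi_injective (q : ℕ) (r : ℤ) {f : MCoch k B E' q} (h : psi EM q r f = 0) : f = 0 := by
  refine Module.Basis.ext_multilinear (fun _ => homBasis RB.isInternal) fun J => EM.inj
    (linear_ext_hom SX.isInternal fun ix x hx => ?_)
  have := psi_apply_of_mem (EM := EM) q r f Fin.elim0 hx fun j => homBasis_mem RB.isInternal (J j)
  rw [h] at this
  rw [(smul_eq_zero.mp this.symm).resolve_left (ε_ne_zero k _)]
  simp

theorem IsHomogM.psi_mem {q : ℕ} {r : ℤ} {f : MCoch k B E' q} (hf : IsHomogM k EM.SE q r f) :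
    IsHomogX k SX 0 q r (psi EM q r f) := by
  intro dga a ha ix x hx dgb b hb
  have := EM.graded (hf dgb b hb) hx
  rw [psi_apply_of_mem q r f _ hx fun j => hb j]
  refine Submodule.smul_mem _ _ ?_
  convert this using 2
  simp
  ring

theorem dXL_psi (hL : IsDXL k SX dXL) {q : ℕ} {r : ℤ} {f : MCoch k B E' q}
    (hf : IsHomogM k EM.SE q r f) : dXL 0 q r (psi EM q r f) = 0 := by
  refine evX_ext SX fun dga a ha ix x hx dgb b hb => ?_
  rw [hL.evX_eq _ ha, evX_psi q r f _ hx hb, evX_psi q r f _ (SX.actL_mem (ha 0) hx) hb, evX_zero,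
    EM.llin (hf dgb b hb) (ha 0), Finset.range_zero, Finset.sum_empty, map_smul, add_zero,
    ← Finset.sum_range (fun j => dgb j)]
  simp only [smul_smul, ← ε_add, ← add_smul]
  refine smul_eq_zero_of_left ?_ _
  rw [add_eq_zero_iff_eq_neg]
  refine ε_congr_neg ⟨-1 - dga 0 * ∑ j ∈ Finset.range q, dgb j, ?_⟩
  push_cast
  ring

theorem dXR_psi (hR : IsDXR k SX dXR) {q : ℕ} {r : ℤ} {f : MCoch k B E' q}
    (hf : IsHomogM k EM.SE q r f) :
    dXR 0 q r (psi EM q r f) = -psi EM (q + 1) r (hochDiff EM.SE q r f) := by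
  refine evX_ext SX fun dga a ha ix x hx dgb b hb => ?_
  have e1 : evX (-psi EM (q + 1) r (hochDiff EM.SE q r f)) a x b
      = -evX (psi EM (q + 1) r (hochDiff EM.SE q r f)) a x b := rfl
  have hs : ∑ j ∈ Finset.range (q + 1), dgb j = dgb 0 + ∑ j ∈ Finset.range q, dgb (j + 1) :=
    (Finset.sum_range_succ' _ _).trans (add_comm _ _)
  have hsh : ∀ j, seqShift b j ∈ RB.gr (dgb (j + 1)) := fun j => hb (j + 1)
  rw [e1, hR.evX_eq, evX_psi q r f _ (SX.actR_mem (hb 0) hx) hsh, evX_psi q r f _ hx hb,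
    evX_psi (q + 1) r _ _ hx hb, evSeq_hochDiff EM.SE q r f hb]
  simp only [map_add, map_smul, map_sum, LinearMap.add_apply, LinearMap.smul_apply,
    LinearMap.sum_apply, EM.actR_eq _ _ _ (hb q) hx, EM.actL_eq _ _ _ (hb 0) (hf _ _ hsh) hx,
    smul_add, neg_add, ← neg_smul, smul_smul,
    Finset.smul_sum, ← Finset.sum_neg_distrib]
  rw [← Finset.sum_range (fun j => dgb (j + 1))]
  simp only [← ε_add]
  refine congrArg₂ _ (congrArg₂ _ ?_ (Finset.sum_congr rfl fun i hi => ?_)) ?_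
  · refine congrArg (· • _) (ε_congr_neg ⟨-1 - ix * dgb 0 - r * dgb 0, ?_⟩)
    rw [hs]
    push_cast
    ring
  · have h2 := sum_degFace q i (Finset.mem_range.mp hi) dgb
    rw [← Finset.sum_range (fun j => degFace i dgb j), ← Finset.sum_range (fun j => dgb j)] at h2
    rw [evX_psi q r f _ hx (seqFace_mem hb i), h2, smul_smul, ← ε_add]
    refine congrArg (· • _) (ε_congr_neg ⟨-1, ?_⟩)
    push_cast
    ring
  · rw [Finset.sum_range_succ]
    refine congrArg (· • _) (ε_congr_neg ⟨-1 - ix * dgb q, ?_⟩)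
    push_cast
    ring

theorem pdX_psi (hp : IsPdX k SX pdX) {q : ℕ} {r : ℤ} {f : MCoch k B E' q}
    (hf : IsHomogM k EM.SE q r f) :
    pdX 0 q r (psi EM q r f) = -psi EM q (r + 1) (intDiff EM.SE q r f) := by
  refine evX_ext SX fun dga a ha ix x hx dgb b hb => ?_
  have e1 : evX (-psi EM q (r + 1) (intDiff EM.SE q r f)) a x b
      = -evX (psi EM q (r + 1) (intDiff EM.SE q r f)) a x b := rfl
  have h2 : ∀ i ∈ Finset.range q, evX (psi EM q r f) a x (seqDiff RB i b) =
      ε k (q + r - 1 + ix * (∑ j ∈ Finset.range q, dgb j + 1)) •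
        EM.toEnd (evSeq f (seqDiff RB i b)) x := fun i hi => by
    have h2 := sum_degDer q i (Finset.mem_range.mp hi) dgb
    rw [← Finset.sum_range (fun j => degDer i dgb j), ← Finset.sum_range (fun j => dgb j)] at h2
    rw [evX_psi q r f _ hx (seqDiff_mem hb i), h2]
  rw [e1, hp.evX_eq _ ha hx hb, Finset.sum_congr rfl fun i hi => congrArg (_ • ·) (h2 i hi),
    evX_psi q r f _ hx hb, evX_psi q r f _ (SX.dX_mem hx) hb, evX_psi q _ _ _ hx hb,
    evSeq_intDiff EM.SE q r f hb]
  simp only [map_sub, map_smul, map_sum, LinearMap.sub_apply, LinearMap.smul_apply,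
    LinearMap.sum_apply, EM.d_eq _ (hf dgb b hb), smul_add, smul_sub, smul_smul,
    Finset.smul_sum, Finset.range_zero, Finset.sum_empty, zero_add]
  simp only [← ε_add]
  rw [← Finset.sum_range (fun i => dgb i)]
  generalize ∑ i ∈ Finset.range q, dgb i = s
  have e2 : ε k (q + (r + 1) - 1 + ix * s) = -ε k (q + r - 1 + ix * s) := ε_congr_neg ⟨0, by ring⟩
  have e3 : ε k (q + (r + 1) - 1 + ix * s + (s + r)) =
      -ε k (r + (0 + (q + r - 1 + (ix + 1) * s))) := ε_congr_neg ⟨0, by ring⟩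
  have e4 : ∀ i, ε k (q + (r + 1) - 1 + ix * s + (r + ∑ j ∈ Finset.range i, dgb j)) =
      -ε k (r + (ix + ∑ l ∈ Finset.range i, dgb l + (q + r - 1 + ix * (s + 1)))) :=
    fun i => ε_congr_neg ⟨-ix, by ring⟩
  simp only [e2, e3, e4, neg_smul, Finset.sum_neg_distrib]
  abel

theorem exists_psi_eq (hL : IsDXL k SX dXL) (hdL : IsDL k SX dL) (hex : ExactL k SX dL)
    {q : ℕ} {r : ℤ} {f : XCoch k A B X 0 q} (hf : IsHomogX k SX 0 q r f)
    (h0 : dXL 0 q r f = 0) : ∃ e : MCoch k B E' q, IsHomogM k EM.SE q r e ∧ psi EM q r e = f := by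
  have key : ∀ J : Fin q → (Σ i, Module.Basis.ofVectorSpaceIndex k (RB.gr i)),
      ∃ e ∈ EM.SE.gr (r + ∑ j, (J j).1), ∀ a x,
        EM.toEnd e x =
          twistZ SX (∑ j, (J j).1) (slice f fun j => homBasis RB.isInternal (J j)) a x := by
    intro J
    have hZ := (hf.isHomogZ fun j => homBasis_mem RB.isInternal (J j)).twistZ_mem (∑ j, (J j).1)
    have h1 := twistZ_slice_dXL hL hdL r (∑ j, (J j).1) f fun j => homBasis RB.isInternal (J j)
    rw [h0] at h1
    have h2 := (hex.1 _ _ hZ).mp ((smul_eq_zero.mp h1.symm).resolve_left (ε_ne_zero k _))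
    obtain ⟨e, he, h⟩ := EM.surj (r + ∑ j, (J j).1)
      (twistZ SX (∑ j, (J j).1) (slice f fun j => homBasis RB.isInternal (J j))
        fun j : Fin 0 => j.elim0) h2 (fun i x hx => by
          have := hZ (fun _ => 0) (fun _ => 0) (fun _ => Submodule.zero_mem _) i x hx
          rw [Fin.sum_univ_zero, zero_add] at this
          rwa [Subsingleton.elim (fun j : Fin 0 => j.elim0) (fun _ : Fin 0 => (0 : A))])
    refine ⟨e, he, fun a x => ?_⟩
    rw [h, Subsingleton.elim a fun j : Fin 0 => j.elim0]
  choose e he h using key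
  refine ⟨multilinearExtend (homBasis RB.isInternal) q fun J => ε k (q + r - 1) • e J, ?_, ?_⟩
  · intro dg b hb
    refine multilinear_mem_of_homBasis RB.isInternal _ EM.SE.gr r (fun J => ?_) (fun i => dg i)
      (fun i => b i) (fun i => hb i)
    rw [multilinearExtend_basis, add_comm]
    exact Submodule.smul_mem _ _ (he J)
  · refine MultilinearMap.ext fun a => linear_ext_hom SX.isInternal fun ix x hx =>
      Module.Basis.ext_multilinear (fun _ => homBasis RB.isInternal) fun J => ?_
    have ha : ∀ i : Fin 0, a i ∈ RA.gr ((fun _ => 0) i) := fun i => i.elim0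
    rw [psi_apply_of_mem q r _ a hx fun j => homBasis_mem RB.isInternal (J j),
      multilinearExtend_basis, map_smul, LinearMap.smul_apply, h J a,
      twistZ_apply_of_mem _ _ ha hx, slice_apply, smul_smul, smul_smul, ← ε_add, ← ε_add,
      Fin.sum_univ_zero, ε_congr (n := 0) ⟨q + r - 1 + ix * ∑ j, (J j).1, by ring⟩, ε_zero,
      one_smul]

end Psi

end RightSwap

section RightEdge

variable {k}

section TotPsi

variable {SX : ABBimod k RA RB X} {E' : Type} [AddCommGroup E'] [Module k E']
  {dXL : ∀ (p q : ℕ) (r : ℤ), XCoch k A B X p q →ₗ[k] XCoch k A B X (p + 1) q}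
  {dXR : ∀ (p q : ℕ) (r : ℤ), XCoch k A B X p q →ₗ[k] XCoch k A B X p (q + 1)}
  {pdX : ∀ (p q : ℕ) (r : ℤ), XCoch k A B X p q →ₗ[k] XCoch k A B X p q}
  {dL : ∀ (p : ℕ) (r : ℤ), ZCoch k A X p →ₗ[k] ZCoch k A X (p + 1)}

/-- Cochains concentrated in the rows `p ≤ N`. -/
def rows (k A B X : Type) [Field k] [Ring A] [Algebra k A] [Ring B] [Algebra k B]
    [AddCommGroup X] [Module k X] (N : ℕ) : Submodule k (TotXCoch k A B X) where
  carrier := {c | ∀ p q, N < p → c p q = 0}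
  add_mem' := fun {c c'} h h' p q hp => by
    rw [Pi.add_apply, Pi.add_apply, h p q hp, h' p q hp, add_zero]
  zero_mem' := fun p q hp => rfl
  smul_mem' := fun x c h p q hp => by rw [Pi.smul_apply, Pi.smul_apply, h p q hp, smul_zero]

/-- Extension by zero of a family of cochains in row `0`. -/
def rowZero : (∀ q, XCoch k A B X 0 q) →ₗ[k] TotXCoch k A B X :=
  LinearMap.pi fun p => match p with
    | 0 => LinearMap.id
    | _ + 1 => 0

/-- The embedding `Ψ` on total cochains of degree `n`. -/
def totPsi (EM : EndAModel k SX E') (n : ℤ) : TotMCoch k B E' →ₗ[k] TotXCoch k A B X :=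
  rowZero ∘ₗ LinearMap.pi fun q => psi EM q (n - q) ∘ₗ LinearMap.proj q

variable {EM : EndAModel k SX E'}

theorem totPsi_zero (n : ℤ) (c : TotMCoch k B E') (q : ℕ) :
    totPsi EM n c 0 q = psi EM q (n - q) (c q) := rfl

theorem totPsi_succ (n : ℤ) (c : TotMCoch k B E') (p q : ℕ) : totPsi EM n c (p + 1) q = 0 := rfl

theorem totPsi_mem {n m : ℤ} {c : TotMCoch k B E'} (hm : n + 1 = m) (hc : c ∈ totK EM.SE n) :
    totPsi EM n c ∈ totXK SX m := by
  obtain ⟨h, N, hN⟩ := hc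
  refine ⟨fun p q => ?_, N, fun p q hpq => ?_⟩
  · cases p with
    | zero => exact (h q).psi_mem.congr (by push_cast; omega)
    | succ p => exact (homogX SX (p + 1) q _).zero_mem
  · cases p with
    | zero => rw [totPsi_zero, hN q (by omega), map_zero]
    | succ p => rfl

theorem totDX_totPsi (hL : IsDXL k SX dXL) (hR : IsDXR k SX dXR) (hp : IsPdX k SX pdX) {n m : ℤ}
    {c : TotMCoch k B E'} (hm : n + 1 = m) (hc : c ∈ totK EM.SE n) :
    totDX dXL dXR pdX m (totPsi EM n c) = -totPsi EM m (totDiff EM.SE n c) := by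
  have hr : ∀ q : ℕ, m - (0 : ℕ) - q - 1 = n - q := fun q => by push_cast; omega
  have h1 : ∀ q, pdX 0 q (m - (0 : ℕ) - q - 1) (psi EM q (n - q) (c q)) =
      -psi EM q (m - q) (totInt EM.SE n c q) := fun q => by
    rw [hr, pdX_psi hp (hc.1 q), show n - q + 1 = m - q by omega]
    rfl
  have h2 : ∀ q, totXR dXR m (totPsi EM n c) 0 q = -psi EM q (m - q) (totHoch EM.SE n c q) := by
    intro q
    cases q with
    | zero =>
      exact ((congrArg Neg.neg (map_zero (psi EM 0 (m - (0 : ℕ))))).trans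
        (neg_zero (G := XCoch k A B X 0 0))).symm
    | succ q =>
      rw [totXR_succ, totPsi_zero, hr, dXR_psi hR (hc.1 q), totHoch_succ]
      congr 3
      push_cast
      omega
  have h3 : ∀ p q, totXR dXR m (totPsi EM n c) (p + 1) q = 0 := by
    intro p q
    cases q with
    | zero => rfl
    | succ q => rw [totXR_succ, totPsi_succ, map_zero]
  funext p q
  rw [totDX_apply, totPdX_apply]
  rcases p with _ | _ | p
  · rw [totXL_zero, totPsi_zero, h1, h2, add_zero, Pi.neg_apply, Pi.neg_apply, totPsi_zero,
      totDiff, LinearMap.add_apply, Pi.add_apply, map_add]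
    exact (neg_add (α := XCoch k A B X 0 q) _ _).symm
  · rw [totXL_succ, totPsi_zero, hr, dXL_psi hL (hc.1 q), totPsi_succ, map_zero, h3, add_zero,
      add_zero]
    exact (neg_zero (G := XCoch k A B X 1 q)).symm
  · rw [totXL_succ, totPsi_succ, totPsi_succ, map_zero, map_zero, h3, zero_add, add_zero]
    exact (neg_zero (G := XCoch k A B X (p + 2) q)).symm

theorem totXR_mem_rows {n : ℤ} {N : ℕ} {c : TotXCoch k A B X} (hc : c ∈ rows k A B X N) :
    totXR dXR n c ∈ rows k A B X N := by
  intro p q hp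
  cases q with
  | zero => rfl
  | succ q => rw [totXR_succ, hc p q hp, map_zero]

theorem totPdX_mem_rows {n : ℤ} {N : ℕ} {c : TotXCoch k A B X} (hc : c ∈ rows k A B X N) :
    totPdX pdX n c ∈ rows k A B X N := fun p q hp => by
  rw [totPdX_apply, hc p q hp, map_zero]

/-- The differential of a cochain in the rows `p ≤ N` is given in row `N + 1` by `dXL`. -/
theorem totDX_apply_of_mem_rows {n : ℤ} {N : ℕ} {c : TotXCoch k A B X}
    (hc : c ∈ rows k A B X N) (q : ℕ) :
    totDX dXL dXR pdX n c (N + 1) q = dXL N q (n - N - q - 1) (c N q) := by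
  rw [totDX_apply, totPdX_mem_rows hc _ q N.lt_succ_self,
    totXR_mem_rows hc _ q N.lt_succ_self, zero_add, add_zero, totXL_succ]

theorem exists_sub_totDX_mem_rows (hL : IsDXL k SX dXL)
    (hdL : IsDL k SX dL) (hex : ExactL k SX dL) {n m : ℤ} {N : ℕ} {c : TotXCoch k A B X}
    (hm : n + 1 = m) (hc : c ∈ totXK SX m) (hcN : c ∈ rows k A B X (N + 1))
    (hDc : totDX dXL dXR pdX m c ∈ rows k A B X 0) :
    ∃ g ∈ totXK SX n, c - totDX dXL dXR pdX n g ∈ rows k A B X N := by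
  have key : ∀ q, ∃ g : XCoch k A B X N q, IsHomogX k SX N q (n - N - q - 1) g ∧
      dXL N q (n - N - q - 1) g = c (N + 1) q ∧ (c (N + 1) q = 0 → g = 0) := by
    intro q
    by_cases h0 : c (N + 1) q = 0
    · exact ⟨0, (homogX SX N q _).zero_mem, by rw [h0, map_zero], fun _ => rfl⟩
    · have hr : m - (N + 1 : ℕ) - q - 1 = n - N - q - 1 := by push_cast; omega
      have h1 := totDX_apply_of_mem_rows (dXL := dXL) (dXR := dXR) (pdX := pdX) (n := m) hcN q
      rw [hDc _ q (by omega)] at h1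
      obtain ⟨g, hg, h⟩ := exists_dXL_eq hL hdL hex (hc.1 (N + 1) q) h1.symm
      rw [hr] at hg h
      exact ⟨g, hg, h, fun h' => absurd h' h0⟩
  choose g hg hdg hg0 using key
  have hs : (Pi.single N g : TotXCoch k A B X) N = g :=
    Pi.single_eq_same (M := fun p => ∀ q, XCoch k A B X p q) N g
  have hne : ∀ {p}, p ≠ N → (Pi.single N g : TotXCoch k A B X) p = 0 := fun h =>
    Pi.single_eq_of_ne (M := fun p => ∀ q, XCoch k A B X p q) h g
  have hrow : (Pi.single N g : TotXCoch k A B X) ∈ rows k A B X N :=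
    fun p q hp => congrFun (hne hp.ne') q
  obtain ⟨-, L, hL'⟩ := hc
  refine ⟨Pi.single N g, ⟨fun p q => ?_, L + N, fun p q hpq => ?_⟩, fun p q hp => ?_⟩
  · by_cases h : p = N
    · subst h
      rw [hs]
      exact hg q
    · rw [hne h]
      exact (homogX SX p q _).zero_mem
  · by_cases h : p = N
    · subst h
      rw [hs]
      exact hg0 q (hL' _ q (by omega))
    · exact congrFun (hne h) q
  · obtain ⟨p, rfl⟩ : ∃ p', p = p' + 1 := ⟨p - 1, by omega⟩
    by_cases h : p = N
    · subst h
      rw [Pi.sub_apply, Pi.sub_apply, totDX_apply_of_mem_rows hrow, hs, hdg]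
      exact sub_self (G := XCoch k A B X (p + 1) q) _
    · rw [Pi.sub_apply, Pi.sub_apply, hcN _ q (by omega), totDX_apply,
        totPdX_mem_rows hrow _ q (by omega), totXR_mem_rows hrow _ q (by omega), totXL_succ,
        hne h, Pi.zero_apply, map_zero, add_zero, add_zero]
      exact sub_zero (G := XCoch k A B X (p + 1) q) _

theorem exists_totPsi_eq (hL : IsDXL k SX dXL) (hdL : IsDL k SX dL) (hex : ExactL k SX dL)
    {n m : ℤ} {c : TotXCoch k A B X} (hm : n + 1 = m) (hc : c ∈ totXK SX m)
    (hc0 : c ∈ rows k A B X 0) (hDc : totDX dXL dXR pdX m c ∈ rows k A B X 0) :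
    ∃ e ∈ totK EM.SE n, totPsi EM n e = c := by
  have key : ∀ q : ℕ, ∃ e : MCoch k B E' q, IsHomogM k EM.SE q (n - q) e ∧
      psi EM q (n - q) e = c 0 q := by
    intro q
    have hr : m - (0 : ℕ) - q - 1 = n - q := by push_cast; omega
    have h1 := totDX_apply_of_mem_rows (dXL := dXL) (dXR := dXR) (pdX := pdX) (n := m) hc0 q
    rw [hDc _ q (by omega)] at h1
    have h2 := exists_psi_eq (EM := EM) hL hdL hex (hc.1 0 q) h1.symm
    rwa [hr] at h2
  choose e he h using key
  obtain ⟨-, L, hL'⟩ := hc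
  refine ⟨e, ⟨he, L, fun q hq => psi_injective q (n - q) ((h q).trans (hL' 0 q (by omega)))⟩, ?_⟩
  funext p q
  cases p with
  | zero => exact h q
  | succ p => exact (hc0 _ q p.succ_pos).symm

/-- The embedding of `Hoch(B, Hom_A(X, X))` into `Hoch(A, X, B)` is a quasi-isomorphism. -/
theorem isShiftQIso_totPsi (hD : IsCpx (V := TotXCoch k A B X) (totXK SX) (totDX dXL dXR pdX))
    (hL : IsDXL k SX dXL) (hR : IsDXR k SX dXR) (hp : IsPdX k SX pdX)
    (hdL : IsDL k SX dL) (hex : ExactL k SX dL) :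
    IsShiftQIso (V := TotMCoch k B E') (W := TotXCoch k A B X) (totK EM.SE) (totDiff EM.SE)
      (totXK SX) (totDX dXL dXR pdX) (totPsi EM) := by
  refine IsShiftQIso.of_filtration hD (rows k A B X) totPsi_mem (totDX_totPsi hL hR hp)
    (fun {n c} h => funext fun q => psi_injective q (n - q) (congrFun (congrFun h 0) q))
    (fun n c p q hp => ?_) (fun {n c} hc => ?_)
    (exists_sub_totDX_mem_rows hL hdL hex) (exists_totPsi_eq hL hdL hex)
  · obtain ⟨p, rfl⟩ : ∃ p', p = p' + 1 := ⟨p - 1, by omega⟩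
    rfl
  · obtain ⟨-, N, hN⟩ := hc
    exact ⟨N, fun p q hp => hN p q (by omega)⟩

/-- The connecting map `Hoch(B) → Hoch(A, X, B)` in total degree `n`. -/
def totXB (dXB : ∀ (q : ℕ) (r : ℤ), Coch k B (q : ℤ) →ₗ[k] XCoch k A B X 0 q) (n : ℤ) :
    TotMCoch k B B →ₗ[k] TotXCoch k A B X :=
  rowZero ∘ₗ LinearMap.pi fun q => dXB q (n - q) ∘ₗ LinearMap.proj q

theorem totXB_eq {dXB : ∀ (q : ℕ) (r : ℤ), Coch k B (q : ℤ) →ₗ[k] XCoch k A B X 0 q}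
    (hXB : IsDXB k SX dXB) {ρB : B →ₗ[k] E'} (hρ : IsRhoB k SX EM ρB) {n : ℤ}
    {c : TotMCoch k B B} (hc : c ∈ totK (RB.toBimod k) n) :
    totXB dXB n c = totPsi EM n (totPost B ρB c) := by
  funext p q
  cases p with
  | succ p => rfl
  | zero =>
    refine evX_ext SX fun dga a ha ix x hx dgb b hb => ?_
    have h := hXB q (n - q) (c q) (fun i => a i) ix x hx b
    have hm : evSeq (c q) b ∈ RB.gr (∑ j ∈ Finset.range q, dgb j + (n - q)) := by
      rw [Finset.sum_range]
      exact hc.1 q dgb b hb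
    have h2 := hρ (evSeq (c q) b) x hm hx
    rw [totPsi_zero, evX_psi q _ _ _ hx hb]
    refine h.trans ?_
    refine Eq.trans ?_ (congrArg (_ • ·) h2.symm)
    rw [smul_smul, ← ε_add]
    exact congrArg (· • _) (ε_congr ⟨-ix * ∑ j ∈ Finset.range q, dgb j, by ring⟩)

end TotPsi

section Congr

variable {V W : Type} [AddCommGroup V] [Module k V] [AddCommGroup W] [Module k W]

theorem IsShiftQIso.congr {K : ℤ → Submodule k V} {D : ℤ → V →ₗ[k] V} {K' : ℤ → Submodule k W}
    {D' : ℤ → W →ₗ[k] W} {F F' : ℤ → V →ₗ[k] W} (h : IsShiftQIso K D K' D' F) (hD : IsCpx K D)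
    (hF : ∀ {n : ℤ} {c : V}, c ∈ K n → F' n c = F n c) : IsShiftQIso K D K' D' F' where
  map hm hc := by rw [hF hc]; exact h.map hm hc
  comm hm hc := by rw [hF hc, hF (hD.map hm hc)]; exact h.comm hm hc
  surj hm hy hDy := by
    obtain ⟨x, hx, hDx, z, hz, e⟩ := h.surj hm hy hDy
    exact ⟨x, hx, hDx, z, hz, by rw [hF hx, e]⟩
  inj hm hx hDx hz := by
    rw [hF hx] at hz
    exact h.inj hm hx hDx hz

end Congr

section TotXB

variable {SX : ABBimod k RA RB X} {E' : Type} [AddCommGroup E'] [Module k E']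
  {EM : EndAModel k SX E'}
  {dXL : ∀ (p q : ℕ) (r : ℤ), XCoch k A B X p q →ₗ[k] XCoch k A B X (p + 1) q}
  {dXR : ∀ (p q : ℕ) (r : ℤ), XCoch k A B X p q →ₗ[k] XCoch k A B X p (q + 1)}
  {pdX : ∀ (p q : ℕ) (r : ℤ), XCoch k A B X p q →ₗ[k] XCoch k A B X p q}
  {dL : ∀ (p : ℕ) (r : ℤ), ZCoch k A X p →ₗ[k] ZCoch k A X (p + 1)}

/-- If the right action map is weakly cone-nilpotent and the left partial Hochschild sequence is
exact, then the connecting map `Hoch(B) → Hoch(A, X, B)` is a quasi-isomorphism. -/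
theorem isShiftQIso_totXB (hD : IsCpx (V := TotXCoch k A B X) (totXK SX) (totDX dXL dXR pdX))
    (hL : IsDXL k SX dXL) (hR : IsDXR k SX dXR) (hp : IsPdX k SX pdX)
    (hdL : IsDL k SX dL) (hex : ExactL k SX dL)
    {dXB : ∀ (q : ℕ) (r : ℤ), Coch k B (q : ℤ) →ₗ[k] XCoch k A B X 0 q} (hXB : IsDXB k SX dXB)
    {ρB : B →ₗ[k] E'} (hρ : IsRhoB k SX EM ρB) (hb : IsBimodHom k (RB.toBimod k) EM.SE ρB)
    (hw : WeaklyConeNilpotent k (RB.toBimod k) EM.SE ρB) :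
    IsShiftQIso (V := TotMCoch k B B) (W := TotXCoch k A B X) (totK (RB.toBimod k))
      (totDiff (RB.toBimod k)) (totXK SX) (totDX dXL dXR pdX) (totXB dXB) :=
  ((isShiftQIso_totPsi hD hL hR hp hdL hex).comp hb.isCpxHom
    (WeaklyConeNilpotent.isQIso hb hw)).congr (isCpx_totDiff _) (totXB_eq hXB hρ)

end TotXB

end RightEdge

section Edges

variable {k}

section Edge

variable {U V W : Type} [AddCommGroup U] [Module k U] [AddCommGroup V] [Module k V]
  [AddCommGroup W] [Module k W]
variable {K : ℤ → Submodule k U} {D : ℤ → U →ₗ[k] U} {K' : ℤ → Submodule k V}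
  {D' : ℤ → V →ₗ[k] V} {L : ℤ → Submodule k W} {DL : ℤ → W →ₗ[k] W}
  {F : ℤ → U →ₗ[k] W} {G : ℤ → V →ₗ[k] W}

/-- If `F` is a quasi-isomorphism up to a shift, every cocycle `b` is the last component of a
cocycle `(a, x, b)` of the complex glued along `F` and `G`. -/
theorem IsShiftQIso.exists_glued_cocycle (hF : IsShiftQIso K D L DL F)
    (hG : IsShiftQIso K' D' L DL G) {n : ℤ} {b : V} (hb : b ∈ K' n) (hDb : D' n b = 0) :
    ∃ a ∈ K n, D n a = 0 ∧ ∃ x ∈ L n, DL n x + F n a + G n b = 0 := by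
  obtain ⟨a, ha, hDa, z, hz, e⟩ := hF.surj rfl (neg_mem (hG.map rfl hb)) (by
    rw [map_neg, hG.comm rfl hb, hDb, map_zero, neg_zero, neg_zero])
  refine ⟨a, ha, hDa, -z, neg_mem hz, ?_⟩
  rw [map_neg, ← e]
  abel

/-- If `F` is a quasi-isomorphism up to a shift, a cocycle `(a, x, b)` of the complex glued
along `F` and `G` is a coboundary as soon as `b` is. -/
theorem IsShiftQIso.exists_glued_coboundary (hF : IsShiftQIso K D L DL F)
    (hG : IsShiftQIso K' D' L DL G) {n m : ℤ} (hm : m + 1 = n) {a : U} {x : W} {b : V}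
    (ha : a ∈ K n) (hx : x ∈ L n) (hDa : D n a = 0) (hDx : DL n x + F n a + G n (D' m b) = 0)
    (hb : b ∈ K' m) :
    ∃ a' ∈ K m, a = D m a' ∧ ∃ x' ∈ L m, x = DL m x' + F m a' + G m b := by
  have h := hG.comm hm hb
  obtain ⟨a', ha', rfl⟩ := hF.inj hm ha hDa ⟨-x + G m b, add_mem (neg_mem hx) (hG.map hm hb), by
    rw [map_add, map_neg, h, ← sub_eq_zero, ← hDx]
    abel⟩
  have h' := hF.comm hm ha'
  obtain ⟨a'', ha'', hDa'', z, hz, e⟩ := hF.surj hm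
    (sub_mem (sub_mem hx (hG.map hm hb)) (hF.map hm ha')) (by
      rw [map_sub, map_sub, h, h', ← hDx]
      abel)
  refine ⟨a' + a'', add_mem ha' ha'', by rw [map_add, hDa'', add_zero], -z, neg_mem hz, ?_⟩
  rw [map_neg, ← e, map_add]
  abel

end Edge

theorem TotD_eq_totDiff {dH : ∀ p r : ℤ, Coch k A p →ₗ[k] Coch k A (p + 1)}
    {pd : ∀ p r : ℤ, Coch k A p →ₗ[k] Coch k A p} (hH : IsHochDiff k RA dH)
    (hp : IsIntDiff k RA pd) (n : ℤ) (c : TotCoch k A) :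
    TotD k dH pd n c = totDiff (RA.toBimod k) n c := by
  have hH' : IsHochDiffM k (RA.toBimod k) (fun (p : ℕ) r => dH p r) :=
    fun p r f dg a ha => hH p (Int.natCast_nonneg p) r f dg a ha
  have hp' : IsIntDiffM k (RA.toBimod k) (fun (p : ℕ) r => pd p r) :=
    fun p r f dg a ha => hp p (Int.natCast_nonneg p) r f dg a ha
  rw [totDiff_eq]
  funext p
  cases p with
  | zero => exact LinearMap.congr_fun (hp'.eq_intDiff 0 n) _
  | succ q =>
    exact congrArg₂ (fun f g : MCoch k A A (q + 1) => f + g)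
      (LinearMap.congr_fun (hp'.eq_intDiff (q + 1) (n - ((q : ℤ) + 1))) (c (q + 1)))
      (LinearMap.congr_fun (hH'.eq_hochDiff q (n - q)) (c q))

theorem totIsCoboundary_sub_self {dH : ∀ p r : ℤ, Coch k A p →ₗ[k] Coch k A (p + 1)}
    {pd : ∀ p r : ℤ, Coch k A p →ₗ[k] Coch k A p} (hH : IsHochDiff k RA dH)
    (hp : IsIntDiff k RA pd) (n : ℤ) (c : TotCoch k A) :
    TotIsCoboundary k RA dH pd n fun p => c p - c p := by
  have h0 : (0 : TotMCoch k A A) ∈ totK (RA.toBimod k) (n - 1) := zero_mem _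
  refine ⟨(0 : TotMCoch k A A), h0.1, h0.2, fun p => ?_⟩
  rw [TotD_eq_totDiff hH hp]
  exact (sub_self (c p)).trans (congrFun (map_zero (totDiff (RA.toBimod k) (n - 1))) p).symm

section TotDXpart

variable {dXL : ∀ (p q : ℕ) (r : ℤ), XCoch k A B X p q →ₗ[k] XCoch k A B X (p + 1) q}
  {dXR : ∀ (p q : ℕ) (r : ℤ), XCoch k A B X p q →ₗ[k] XCoch k A B X p (q + 1)}
  {pdX : ∀ (p q : ℕ) (r : ℤ), XCoch k A B X p q →ₗ[k] XCoch k A B X p q}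
  {dAX : ∀ (p : ℕ) (r : ℤ), Coch k A (p : ℤ) →ₗ[k] XCoch k A B X p 0}
  {dXB : ∀ (q : ℕ) (r : ℤ), Coch k B (q : ℤ) →ₗ[k] XCoch k A B X 0 q}

theorem totAX_apply_zero (n : ℤ) (c : TotMCoch k A A) (p : ℕ) :
    (totAX dAX n c : TotXCoch k A B X) p 0 = dAX p (n - p) (c p) := rfl

theorem totAX_apply_succ (n : ℤ) (c : TotMCoch k A A) (p q : ℕ) :
    (totAX dAX n c : TotXCoch k A B X) p (q + 1) = 0 := rfl

theorem totXB_zero_apply (n : ℤ) (c : TotMCoch k B B) (q : ℕ) :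
    (totXB dXB n c : TotXCoch k A B X) 0 q = dXB q (n - q) (c q) := rfl

theorem totXB_succ_apply (n : ℤ) (c : TotMCoch k B B) (p q : ℕ) :
    (totXB dXB n c : TotXCoch k A B X) (p + 1) q = 0 := rfl

theorem TotDXpart_eq (n : ℤ) (cA : TotMCoch k A A) (cx : TotXCoch k A B X)
    (cB : TotMCoch k B B) :
    TotDXpart k dXL dXR pdX dAX dXB n cA cx cB =
      (totDX dXL dXR pdX n cx + totAX dAX n cA + totXB dXB n cB : TotXCoch k A B X) := by
  funext p q
  rw [Pi.add_apply, Pi.add_apply, Pi.add_apply, Pi.add_apply, totDX_apply, totPdX_apply]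
  have hp1 : ∀ p : ℕ, n - ((p + 1 : ℕ) : ℤ) = n - (p + 1) := fun p => by push_cast; rfl
  have h0 : n - ((0 : ℕ) : ℤ) = n := by simp
  rcases p with _ | p <;> rcases q with _ | q
  · rw [totXL_zero, totXR_zero, totAX_apply_zero, totXB_zero_apply, h0, h0, add_zero, add_zero]
    rfl
  · rw [totXL_zero, totXR_succ, totAX_apply_succ, totXB_zero_apply, h0, hp1, add_zero, add_zero]
    rfl
  · rw [totXL_succ, totXR_zero, totAX_apply_zero, totXB_succ_apply, hp1, add_zero, add_zero]
    simp only [Nat.cast_zero, sub_zero]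
    rfl
  · rw [totXL_succ, totXR_succ, totAX_apply_succ, totXB_succ_apply, hp1, add_zero, add_zero]
    simp only [Nat.cast_succ]
    rfl

end TotDXpart

end Edges

section Products

variable {k}

section Projections

variable {i : A →ₗ[k] C} {pr : C →ₗ[k] A}

theorem piA_bracket (hi : ∀ a, pr (i a) = a)
    {brA : ∀ p₁ r₁ p₂ r₂ : ℤ, Coch k A p₁ →ₗ[k] Coch k A p₂ →ₗ[k] Coch k A (p₁ + p₂ - 1)}
    {brC : ∀ p₁ r₁ p₂ r₂ : ℤ, Coch k C p₁ →ₗ[k] Coch k C p₂ →ₗ[k] Coch k C (p₁ + p₂ - 1)}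
    (hA : IsBracket k brA) (hC : IsBracket k brC) (p₁ r₁ p₂ r₂ : ℤ)
    {F : Coch k C p₁} {G : Coch k C p₂} (hF : ∀ c, pr (F c) = piA k i pr F fun j => pr (c j))
    (hG : ∀ c, pr (G c) = piA k i pr G fun j => pr (c j)) :
    piA k i pr (brC p₁ r₁ p₂ r₂ F G) = brA p₁ r₁ p₂ r₂ (piA k i pr F) (piA k i pr G) := by
  have hext {n : ℕ} (a : Fin n → A) (m : ℕ) : pr (ext0 (fun j => i (a j)) m) = ext0 a m := by
    unfold ext0
    split_ifs
    · exact hi _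
    · exact map_zero pr
  have hcomp (p q : ℤ) {f : Coch k C p} {g : Coch k C q}
      (hf : ∀ c, pr (f c) = piA k i pr f fun j => pr (c j))
      (hg : ∀ c, pr (g c) = piA k i pr g fun j => pr (c j)) (m : ℕ)
      (a : Fin (p + q - 1).toNat → A) :
      pr (compAtF p q ⇑f ⇑g m fun j => i (a j)) =
        compAtF p q ⇑(piA k i pr f) ⇑(piA k i pr g) m a := by
    unfold compAtF
    rw [hf]
    congr 1
    funext j
    split_ifs
    · exact hext a _
    · rw [hg]
      exact congrArg _ (funext fun l => hext a _)
    · exact hext a _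
  refine MultilinearMap.ext fun a => ?_
  refine (congrArg pr (hC p₁ r₁ p₂ r₂ F G fun j => i (a j))).trans ?_
  rw [hA, map_sub, map_smul, map_sum, map_sum]
  simp only [map_smul, hcomp p₁ p₂ hF hG]
  congr 2
  exact Finset.sum_congr rfl fun j _ => congrArg _ (hcomp p₂ p₁ hG hF _ _)

theorem piA_cup {RC : DGAlgebra k C} (hi : ∀ {n : ℤ} {a : A}, a ∈ RA.gr n → i a ∈ RC.gr n)
    (hmul : ∀ c c', pr (c * c') = pr c * pr c')
    {cupA : ∀ p₁ r₁ p₂ r₂ : ℤ, Coch k A p₁ →ₗ[k] Coch k A p₂ →ₗ[k] Coch k A (p₁ + p₂)}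
    {cupC : ∀ p₁ r₁ p₂ r₂ : ℤ, Coch k C p₁ →ₗ[k] Coch k C p₂ →ₗ[k] Coch k C (p₁ + p₂)}
    (hA : IsCup k RA cupA) (hC : IsCup k RC cupC) {p₁ p₂ : ℤ} (h₁ : 0 ≤ p₁) (h₂ : 0 ≤ p₂)
    (r₁ r₂ : ℤ) (F : Coch k C p₁) (G : Coch k C p₂) :
    piA k i pr (cupC p₁ r₁ p₂ r₂ F G) = cupA p₁ r₁ p₂ r₂ (piA k i pr F) (piA k i pr G) := by
  refine multilinear_ext_hom RA.isInternal fun dg a ha => ?_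
  rw [hA p₁ h₁ p₂ h₂ r₁ r₂ _ _ dg a ha]
  refine (congrArg pr (hC p₁ h₁ p₂ h₂ r₁ r₂ F G dg (fun j => i (a j)) fun j => hi (ha j))).trans ?_
  rw [map_smul, hmul]
  rfl

end Projections

section TrivExtProjections

variable {SX : ABBimod k RA RB X} {RC : DGAlgebra k C}
  {iA : A →ₗ[k] C} {iX : X →ₗ[k] C} {iB : B →ₗ[k] C}
  {prA : C →ₗ[k] A} {prX : C →ₗ[k] X} {prB : C →ₗ[k] B}

namespace TrivExt

theorem mul_eq (T : TrivExt RA RB SX RC iA iX iB prA prX prB) (c c' : C) :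
    c * c' = iA (prA c * prA c') +
      iX (SX.actL (prA c) (prX c') + SX.actR (prB c') (prX c)) + iB (prB c * prB c') := by
  conv_lhs => rw [← T.sum_eq c, ← T.sum_eq c']
  simp only [add_mul, mul_add, T.iA_mul_iA, T.iB_mul_iB, T.iA_mul_iX, T.iX_mul_iB, T.iA_mul_iB,
    T.iB_mul_iA, T.iX_mul_iA, T.iB_mul_iX, T.iX_mul_iX, map_add, add_zero, zero_add]
  abel

theorem prA_mul (T : TrivExt RA RB SX RC iA iX iB prA prX prB) (c c' : C) :
    prA (c * c') = prA c * prA c' := by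
  rw [T.mul_eq, map_add, map_add, T.prA_iA, T.prA_iX, T.prA_iB, add_zero, add_zero]

theorem prB_mul (T : TrivExt RA RB SX RC iA iX iB prA prX prB) (c c' : C) :
    prB (c * c') = prB c * prB c' := by
  rw [T.mul_eq, map_add, map_add, T.prB_iA, T.prB_iX, T.prB_iB, zero_add, zero_add]

theorem prA_apply (T : TrivExt RA RB SX RC iA iX iB prA prX prB) {p : ℤ} {F : Coch k C p}
    (hF : InHochOfX k iA iX iB prA prX prB p F) (c : Fin p.toNat → C) :
    prA (F c) = piA k iA prA F fun j => prA (c j) := by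
  obtain ⟨gA, gB, gX, h⟩ := hF
  have key (c : Fin p.toNat → C) : prA (F c) = gA fun j => prA (c j) := by
    rw [h, map_add, map_add, map_sum, T.prA_iA, T.prA_iB, add_zero,
      Finset.sum_eq_zero fun s _ => T.prA_iX _, add_zero]
  rw [key]
  refine .trans ?_ (key _).symm
  simp only [T.prA_iA]

theorem prB_apply (T : TrivExt RA RB SX RC iA iX iB prA prX prB) {p : ℤ} {F : Coch k C p}
    (hF : InHochOfX k iA iX iB prA prX prB p F) (c : Fin p.toNat → C) :
    prB (F c) = piB k iB prB F fun j => prB (c j) := by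
  obtain ⟨gA, gB, gX, h⟩ := hF
  have key (c : Fin p.toNat → C) : prB (F c) = gB fun j => prB (c j) := by
    rw [h, map_add, map_add, map_sum, T.prB_iA, T.prB_iB, zero_add,
      Finset.sum_eq_zero fun s _ => T.prB_iX _, add_zero]
  rw [key]
  refine .trans ?_ (key _).symm
  simp only [T.prB_iB]

end TrivExt

end TrivExtProjections

end Products

/-- **Theorem A.** For a Keller admissible triple `(A, X, B)`
over a field `k` of characteristic zero (the action maps `ρ_A`, `ρ_B` are
weakly cone-nilpotent quasi-isomorphisms, and the two partial Hochschild
sequences are exact), the two natural projections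
`π_A : Hoch_⊕^•(X) → Hoch_⊕^•(A)` and `π_B : Hoch_⊕^•(X) → Hoch_⊕^•(B)` are
quasi-isomorphisms and induce isomorphisms of Gerstenhaber algebras
`HH_⊕^•(A) ≅ H^•(Hoch_⊕(X)) ≅ HH_⊕^•(B)`: they are bijective on cohomology and
preserve the Gerstenhaber brackets and cup products. -/
theorem statement11
    (k : Type) [Field k] [CharZero k]
    (A : Type) [Ring A] [Algebra k A] (B : Type) [Ring B] [Algebra k B]
    (X : Type) [AddCommGroup X] [Module k X]
    (E : Type) [AddCommGroup E] [Module k E]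
    (E' : Type) [AddCommGroup E'] [Module k E']
    (C : Type) [Ring C] [Algebra k C]
    (RA : KD.DGAlgebra k A) (RB : KD.DGAlgebra k B) (SX : KD.ABBimod k RA RB X)
    (EM : KD.EndBModel k SX E) (EM' : KD.EndAModel k SX E')
    -- the trivial-extension model `C = A ⋉ X ⋊ B`:
    (RC : KD.DGAlgebra k C)
    (iA : A →ₗ[k] C) (iX : X →ₗ[k] C) (iB : B →ₗ[k] C)
    (prA : C →ₗ[k] A) (prX : C →ₗ[k] X) (prB : C →ₗ[k] B)
    (htriv : KD.IsTrivExtModel k RA RB SX RC iA iX iB prA prX prB)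
    -- structure operators of all the Hochschild complexes involved:
    (dHA : ∀ p r : ℤ, KD.Coch k A p →ₗ[k] KD.Coch k A (p + 1))
    (pdA : ∀ p r : ℤ, KD.Coch k A p →ₗ[k] KD.Coch k A p)
    (cupA : ∀ p₁ r₁ p₂ r₂ : ℤ, KD.Coch k A p₁ →ₗ[k] KD.Coch k A p₂ →ₗ[k] KD.Coch k A (p₁ + p₂))
    (brA : ∀ p₁ r₁ p₂ r₂ : ℤ, KD.Coch k A p₁ →ₗ[k] KD.Coch k A p₂ →ₗ[k] KD.Coch k A (p₁ + p₂ - 1))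
    (dHB : ∀ p r : ℤ, KD.Coch k B p →ₗ[k] KD.Coch k B (p + 1))
    (pdB : ∀ p r : ℤ, KD.Coch k B p →ₗ[k] KD.Coch k B p)
    (cupB : ∀ p₁ r₁ p₂ r₂ : ℤ, KD.Coch k B p₁ →ₗ[k] KD.Coch k B p₂ →ₗ[k] KD.Coch k B (p₁ + p₂))
    (brB : ∀ p₁ r₁ p₂ r₂ : ℤ, KD.Coch k B p₁ →ₗ[k] KD.Coch k B p₂ →ₗ[k] KD.Coch k B (p₁ + p₂ - 1))
    (dHC : ∀ p r : ℤ, KD.Coch k C p →ₗ[k] KD.Coch k C (p + 1))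
    (pdC : ∀ p r : ℤ, KD.Coch k C p →ₗ[k] KD.Coch k C p)
    (cupC : ∀ p₁ r₁ p₂ r₂ : ℤ, KD.Coch k C p₁ →ₗ[k] KD.Coch k C p₂ →ₗ[k] KD.Coch k C (p₁ + p₂))
    (brC : ∀ p₁ r₁ p₂ r₂ : ℤ, KD.Coch k C p₁ →ₗ[k] KD.Coch k C p₂ →ₗ[k] KD.Coch k C (p₁ + p₂ - 1))
    (dXL : ∀ (p q : ℕ) (r : ℤ), KD.XCoch k A B X p q →ₗ[k] KD.XCoch k A B X (p + 1) q)
    (dXR : ∀ (p q : ℕ) (r : ℤ), KD.XCoch k A B X p q →ₗ[k] KD.XCoch k A B X p (q + 1))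
    (pdX : ∀ (p q : ℕ) (r : ℤ), KD.XCoch k A B X p q →ₗ[k] KD.XCoch k A B X p q)
    (dAX : ∀ (p : ℕ) (r : ℤ), KD.Coch k A (p : ℤ) →ₗ[k] KD.XCoch k A B X p 0)
    (dXB : ∀ (q : ℕ) (r : ℤ), KD.Coch k B (q : ℤ) →ₗ[k] KD.XCoch k A B X 0 q)
    (hdHA : KD.IsHochDiff k RA dHA) (hpdA : KD.IsIntDiff k RA pdA)
    (hcupA : KD.IsCup k RA cupA) (hbrA : KD.IsBracket k brA)
    (hdHB : KD.IsHochDiff k RB dHB) (hpdB : KD.IsIntDiff k RB pdB)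
    (hcupB : KD.IsCup k RB cupB) (hbrB : KD.IsBracket k brB)
    (hdHC : KD.IsHochDiff k RC dHC) (hpdC : KD.IsIntDiff k RC pdC)
    (hcupC : KD.IsCup k RC cupC) (hbrC : KD.IsBracket k brC)
    (hdXL : KD.IsDXL k SX dXL) (hdXR : KD.IsDXR k SX dXR) (hpdX : KD.IsPdX k SX pdX)
    (hdAX : KD.IsDAX k SX dAX) (hdXB : KD.IsDXB k SX dXB)
    (dR : ∀ (q : ℕ) (r : ℤ), KD.YCoch k B X q →ₗ[k] KD.YCoch k B X (q + 1))
    (dL : ∀ (p : ℕ) (r : ℤ), KD.ZCoch k A X p →ₗ[k] KD.ZCoch k A X (p + 1))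
    (hdR : KD.IsDR k SX dR) (hdL : KD.IsDL k SX dL)
    -- Keller admissibility: (i) the action maps are weakly cone-nilpotent
    -- quasi-isomorphisms …
    (ρA : A →ₗ[k] E) (hρA : KD.IsRhoA k SX EM ρA)
    (ρB : B →ₗ[k] E') (hρB : KD.IsRhoB k SX EM' ρB)
    (hρAhom : KD.IsBimodHom k (RA.toBimod k) EM.SE ρA)
    (hρAqis : KD.IsQuasiIso k (RA.toBimod k) EM.SE ρA)
    (hρAwcn : KD.WeaklyConeNilpotent k (RA.toBimod k) EM.SE ρA)
    (hρBhom : KD.IsBimodHom k (RB.toBimod k) EM'.SE ρB)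
    (hρBqis : KD.IsQuasiIso k (RB.toBimod k) EM'.SE ρB)
    (hρBwcn : KD.WeaklyConeNilpotent k (RB.toBimod k) EM'.SE ρB)
    -- … and (ii) the two partial Hochschild sequences are exact:
    (hExactR : KD.ExactR k SX dR) (hExactL : KD.ExactL k SX dL) :
    -- Conclusion: `π_B` and `π_A` are quasi-isomorphisms …
    ((∀ (n : ℤ) (β : KD.TotCoch k B),
        KD.TotHomog k RB n β → KD.TotFinSupp k β → KD.TotIsCocycle k dHB pdB n β →
        ∃ (cA : KD.TotCoch k A) (cx : KD.TotXCoch k A B X) (cB : KD.TotCoch k B),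
          KD.TotHomog k RA n cA ∧ KD.TotFinSupp k cA ∧
          KD.TotHomogX k SX n cx ∧ KD.TotFinSuppX k cx ∧
          KD.TotHomog k RB n cB ∧ KD.TotFinSupp k cB ∧
          KD.TotXIsCocycle k dHA pdA dHB pdB dXL dXR pdX dAX dXB n cA cx cB ∧
          KD.TotIsCoboundary k RB dHB pdB n (fun q => cB q - β q))
      ∧ (∀ (n : ℤ) (cA : KD.TotCoch k A) (cx : KD.TotXCoch k A B X) (cB : KD.TotCoch k B),
        KD.TotHomog k RA n cA → KD.TotFinSupp k cA →
        KD.TotHomogX k SX n cx → KD.TotFinSuppX k cx →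
        KD.TotHomog k RB n cB → KD.TotFinSupp k cB →
        KD.TotXIsCocycle k dHA pdA dHB pdB dXL dXR pdX dAX dXB n cA cx cB →
        KD.TotIsCoboundary k RB dHB pdB n cB →
        KD.TotXIsCoboundary k SX dHA pdA dHB pdB dXL dXR pdX dAX dXB n cA cx cB))
    ∧ ((∀ (n : ℤ) (α : KD.TotCoch k A),
        KD.TotHomog k RA n α → KD.TotFinSupp k α → KD.TotIsCocycle k dHA pdA n α →
        ∃ (cA : KD.TotCoch k A) (cx : KD.TotXCoch k A B X) (cB : KD.TotCoch k B),
          KD.TotHomog k RA n cA ∧ KD.TotFinSupp k cA ∧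
          KD.TotHomogX k SX n cx ∧ KD.TotFinSuppX k cx ∧
          KD.TotHomog k RB n cB ∧ KD.TotFinSupp k cB ∧
          KD.TotXIsCocycle k dHA pdA dHB pdB dXL dXR pdX dAX dXB n cA cx cB ∧
          KD.TotIsCoboundary k RA dHA pdA n (fun p => cA p - α p))
      ∧ (∀ (n : ℤ) (cA : KD.TotCoch k A) (cx : KD.TotXCoch k A B X) (cB : KD.TotCoch k B),
        KD.TotHomog k RA n cA → KD.TotFinSupp k cA →
        KD.TotHomogX k SX n cx → KD.TotFinSuppX k cx →
        KD.TotHomog k RB n cB → KD.TotFinSupp k cB →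
        KD.TotXIsCocycle k dHA pdA dHB pdB dXL dXR pdX dAX dXB n cA cx cB →
        KD.TotIsCoboundary k RA dHA pdA n cA →
        KD.TotXIsCoboundary k SX dHA pdA dHB pdB dXL dXR pdX dAX dXB n cA cx cB))
    ∧ -- … and they preserve the Gerstenhaber brackets and cup products, so
    -- that the induced isomorphisms are isomorphisms of Gerstenhaber algebras:
    (∀ (p₁ p₂ : ℕ) (r₁ r₂ : ℤ) (F : KD.Coch k C (p₁ : ℤ)) (G : KD.Coch k C (p₂ : ℤ)),
      KD.IsHomog k RC p₁ r₁ F → KD.IsHomog k RC p₂ r₂ G →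
      KD.InHochOfX k iA iX iB prA prX prB p₁ F →
      KD.InHochOfX k iA iX iB prA prX prB p₂ G →
      KD.piA k iA prA (brC p₁ r₁ p₂ r₂ F G)
        = brA p₁ r₁ p₂ r₂ (KD.piA k iA prA F) (KD.piA k iA prA G)
      ∧ KD.piB k iB prB (brC p₁ r₁ p₂ r₂ F G)
        = brB p₁ r₁ p₂ r₂ (KD.piB k iB prB F) (KD.piB k iB prB G)
      ∧ KD.piA k iA prA (cupC p₁ r₁ p₂ r₂ F G)
        = cupA p₁ r₁ p₂ r₂ (KD.piA k iA prA F) (KD.piA k iA prA G)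
      ∧ KD.piB k iB prB (cupC p₁ r₁ p₂ r₂ F G)
        = cupB p₁ r₁ p₂ r₂ (KD.piB k iB prB F) (KD.piB k iB prB G)) := by
  have T := htriv.trivExt
  have hD := KD.isCpx_totDX T hdXL hdXR hpdX
  have hfA := KD.isShiftQIso_totAX hD hdXL hdXR hpdX hdR hExactR hdAX hρA hρAhom hρAwcn
  have hfB := KD.isShiftQIso_totXB hD hdXL hdXR hpdX hdL hExactL hdXB hρB hρBhom hρBwcn
  have eA := KD.TotD_eq_totDiff hdHA hpdA
  have eB := KD.TotD_eq_totDiff hdHB hpdB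
  have eX := KD.TotDXpart_eq (dXL := dXL) (dXR := dXR) (pdX := pdX) (dAX := dAX) (dXB := dXB)
  refine ⟨⟨fun n β hβ hβs hβc => ?_, ?_⟩, ⟨fun n α hα hαs hαc => ?_, ?_⟩, ?_⟩
  · obtain ⟨a, ha, hDa, x, hx, h⟩ := hfA.exists_glued_cocycle hfB (n := n) (b := β) ⟨hβ, hβs⟩
      ((eB n β).symm.trans (funext hβc))
    rw [← eA] at hDa
    rw [← eX] at h
    exact ⟨a, x, β, ha.1, ha.2, hx.1, hx.2, hβ, hβs,
      ⟨congrFun hDa, hβc, fun p q => congrFun (congrFun h p) q⟩,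
      KD.totIsCoboundary_sub_self hdHB hpdB n β⟩
  · rintro n cA cx cB hA hAs hX hXs hB hBs ⟨hDA, hDB, hDX⟩ ⟨b, hb, hbs, hcb⟩
    obtain rfl : cB = KD.TotD k dHB pdB (n - 1) b := funext hcb
    have hDX' := (eX n cA cx _).symm.trans (funext fun p => funext fun q => hDX p q)
    rw [eB] at hDX'
    obtain ⟨a, ha, h1, x, hx, h2⟩ := hfA.exists_glued_coboundary hfB (sub_add_cancel n 1)
      (a := cA) (x := cx) (b := b) ⟨hA, hAs⟩ ⟨hX, hXs⟩ ((eA n cA).symm.trans (funext hDA)) hDX'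
      ⟨hb, hbs⟩
    rw [← eA] at h1
    rw [← eX] at h2
    exact ⟨a, x, b, ha.1, ha.2, hx.1, hx.2, hb, hbs, congrFun h1, fun _ => rfl,
      fun p q => congrFun (congrFun h2 p) q⟩
  · obtain ⟨b, hb, hDb, x, hx, h⟩ := hfB.exists_glued_cocycle hfA (n := n) (b := α) ⟨hα, hαs⟩
      ((eA n α).symm.trans (funext hαc))
    rw [← eB] at hDb
    rw [add_right_comm, ← eX] at h
    exact ⟨α, x, b, hα, hαs, hx.1, hx.2, hb.1, hb.2,
      ⟨hαc, congrFun hDb, fun p q => congrFun (congrFun h p) q⟩,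
      KD.totIsCoboundary_sub_self hdHA hpdA n α⟩
  · rintro n cA cx cB hA hAs hX hXs hB hBs ⟨hDA, hDB, hDX⟩ ⟨a, ha, has, hca⟩
    obtain rfl : cA = KD.TotD k dHA pdA (n - 1) a := funext hca
    have hDX' := (eX n _ cx cB).symm.trans (funext fun p => funext fun q => hDX p q)
    rw [eA, add_right_comm] at hDX'
    obtain ⟨b, hb, h1, x, hx, h2⟩ := hfB.exists_glued_coboundary hfA (sub_add_cancel n 1)
      (a := cB) (x := cx) (b := a) ⟨hB, hBs⟩ ⟨hX, hXs⟩ ((eB n cB).symm.trans (funext hDB)) hDX'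
      ⟨ha, has⟩
    rw [← eB] at h1
    rw [add_right_comm, ← eX] at h2
    exact ⟨a, x, b, ha, has, hx.1, hx.2, hb.1, hb.2, fun _ => rfl, congrFun h1,
      fun p q => congrFun (congrFun h2 p) q⟩
  · intro p₁ p₂ r₁ r₂ F G _ _ hF hG
    exact ⟨KD.piA_bracket T.prA_iA hbrA hbrC _ _ _ _ (T.prA_apply hF) (T.prA_apply hG),
      KD.piA_bracket T.prB_iB hbrB hbrC _ _ _ _ (T.prB_apply hF) (T.prB_apply hG),
      KD.piA_cup T.iA_mem T.prA_mul hcupA hcupC (Int.natCast_nonneg _) (Int.natCast_nonneg _)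
        _ _ F G,
      KD.piA_cup T.iB_mem T.prB_mul hcupB hcupC (Int.natCast_nonneg _) (Int.natCast_nonneg _)
        _ _ F G⟩
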